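/- Let d ≥ 3 and fix ω. Suppose (C_∞(ω), O(ω)) satisfies the graph assumption and there exist p, q ∈ (1,∞] with 1/p + 1/q < 2/d' such that for every x ∈ C_∞(ω) there exists N_{10}(ω,x) with sup_{n ≥ N_{10}(ω,x)} max{ ‖μ^ω‖_{p,B^ω(x,n)}, ‖ν^ω‖_{q,B^ω(x,n)}, ‖κ^ω‖_{p,B^ω(x,n)}, ‖1/κ^ω‖_{1,B^ω(x,n)} } ≤ C_int < ∞. Then there exist λ = λ(d) ∈ (0,1), γ = γ(d',p,q) ∈ (1,∞) and c_{29} = c_{29}(d',p,q,C_int) ∈ (0,∞) such that: for any x ∈ C_∞(ω) there exists N_{11}(ω,x) such that for all y ∈ C_∞(ω) with ρ^ω(x,y) ≥ N_{11}(ω,x) and all h ∈ [0,1], g^ω(x,y) ≤ c_{29} F_γ( h ρ^ω(x,y)² ) ρ^ω(x,y)^{2−d} max_{z ∉ B^ω(x,n)} exp( −λ √h d_κ^ω(x,z) ), where n = ρ^ω(x,y)/4 and F_γ(r) := (1+r)^γ (1+1/r)^{1/2}. -/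

import Mathlib

open MeasureTheory Filter ENNReal Topology
open scoped Classical

namespace FPPPaper

/-! ## Basic geometry of `ℤ^d` -/

/-- Vertices of the lattice `ℤ^d`. -/
abbrev Vert (d : ℕ) := Fin d → ℤ

/-- Nearest-neighbour adjacency on `ℤ^d`. -/
def adj {d : ℕ} (x y : Vert d) : Prop := (∑ i, (x i - y i).natAbs) = 1

/-- The `ℓ^∞`-distance on `ℤ^d`. -/
def linfDist {d : ℕ} (x y : Vert d) : ℕ := Finset.univ.sup fun i => (x i - y i).natAbs

/-- The `ℓ^1`-distance on `ℤ^d`. -/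
def l1Dist {d : ℕ} (x y : Vert d) : ℕ := ∑ i, (x i - y i).natAbs

/-- The canonical embedding `ℤ^d → ℝ^d`. -/
def toRvec {d : ℕ} (x : Vert d) : Fin d → ℝ := fun i => (x i : ℝ)

/-- `p` is a nearest-neighbour path from `x` to `y` (a list of consecutively
adjacent vertices starting at `x` and ending at `y`). -/
def IsPathFrom {d : ℕ} (x y : Vert d) (p : List (Vert d)) : Prop :=
  p.head? = some x ∧ p.getLast? = some y ∧ p.Chain' adj

/-- The (ordered) edges traversed by a path. -/
def edgesOf {d : ℕ} (p : List (Vert d)) : List (Vert d × Vert d) := p.zip p.tail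

/-- Total weight of a path for edge weights `w`. -/
noncomputable def pathWeight {d : ℕ} (w : Vert d → Vert d → ℝ≥0∞) (p : List (Vert d)) :
    ℝ≥0∞ :=
  ((edgesOf p).map fun e => w e.1 e.2).sum

/-- The first passage percolation (pseudo-)distance associated to edge weights `w`. -/
noncomputable def fppDist {d : ℕ} (w : Vert d → Vert d → ℝ≥0∞) (x y : Vert d) : ℝ≥0∞ :=
  ⨅ p : {p : List (Vert d) // IsPathFrom x y p}, pathWeight w p.1

/-- Total weight of a path for vertex weights `w`. -/
noncomputable def vertPathWeight {d : ℕ} (w : Vert d → ℝ≥0∞) (p : List (Vert d)) : ℝ≥0∞ :=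
  (p.map w).sum

/-- The first passage percolation distance associated to vertex weights `w`. -/
noncomputable def vfppDist {d : ℕ} (w : Vert d → ℝ≥0∞) (x y : Vert d) : ℝ≥0∞ :=
  ⨅ p : {p : List (Vert d) // IsPathFrom x y p}, vertPathWeight w p.1

/-- `x` and `y` are connected by a path all of whose edges belong to `S`. -/
def ConnectedIn {d : ℕ} (S : Set (Vert d × Vert d)) (x y : Vert d) : Prop :=
  ∃ p, IsPathFrom x y p ∧ ∀ e ∈ edgesOf p, e ∈ S

/-- `x` and `y` are connected by a path all of whose vertices belong to `S`. -/
def VConnectedIn {d : ℕ} (S : Set (Vert d)) (x y : Vert d) : Prop :=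
  ∃ p, IsPathFrom x y p ∧ ∀ v ∈ p, v ∈ S

/-- The cube `Q(x,r) = {y : |x-y|_∞ ≤ r}`. -/
def cubeVerts {d : ℕ} (x : Vert d) (r : ℝ) : Set (Vert d) :=
  {y | ∀ i, |(y i : ℝ) - (x i : ℝ)| ≤ r}

/-- The set of edges with weight zero. -/
def zeroSet {d : ℕ} (w : Vert d → Vert d → ℝ≥0∞) : Set (Vert d × Vert d) :=
  {e | adj e.1 e.2 ∧ w e.1 e.2 = 0}

/-! ## Configuration spaces indexed by vertices and edges -/

/-- Index set for configurations: vertices and (ordered) edges of `ℤ^d`. -/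
abbrev Coord (d : ℕ) := Vert d ⊕ (Vert d × Vert d)

/-- The vertices underlying a coordinate. -/
def coordVerts {d : ℕ} : Coord d → Set (Vert d)
  | Sum.inl v => {v}
  | Sum.inr e => {e.1, e.2}

/-- The configuration space `Ω = ∏_{e} Ω_e × ∏_x Ω_x` with all coordinate spaces
equal to `Γ`. -/
abbrev Config (d : ℕ) (Γ : Type*) := Coord d → Γ

/-- The lattice shift `τ_z` on configurations. -/
def shiftConfig {d : ℕ} {Γ : Type*} (z : Vert d) (ω : Config d Γ) : Config d Γ :=
  fun c => ω (match c with
    | Sum.inl v => Sum.inl (v + z)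
    | Sum.inr e => Sum.inr (e.1 + z, e.2 + z))

/-- A function of the configuration is supported on the set `S` of coordinates. -/
def SupportedOn {d : ℕ} {Γ β : Type*} (S : Set (Coord d)) (f : Config d Γ → β) : Prop :=
  ∀ ω ω' : Config d Γ, (∀ c ∈ S, ω c = ω' c) → f ω = f ω'

/-- An event on pairs of configurations depending only on the coordinates of the first
configuration in `S1` and of the second one in `S2`. -/
def PairSupportedOn {d : ℕ} {Γ : Type*} (S1 S2 : Set (Coord d))
    (A : Set (Config d Γ × Config d Γ)) : Prop :=
  ∀ ω1 ω2 ω1' ω2' : Config d Γ, (∀ c ∈ S1, ω1 c = ω1' c) → (∀ c ∈ S2, ω2 c = ω2' c) →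
    ((ω1, ω2) ∈ A ↔ (ω1', ω2') ∈ A)

/-- The coordinates of the box `Q̄(x,r)`: vertices of the cube `Q(x,r)` together with
the edges having both endpoints in the cube. -/
def boxCoords {d : ℕ} (x : Vert d) (r : ℝ) : Set (Coord d) :=
  {c | ∀ v ∈ coordVerts c, v ∈ cubeVerts x r}

/-- The coordinates within `ℓ^∞`-distance `r` of `x` or `y` (the neighbourhoods
`𝒩 + x` and `𝒩 + y` together with the edge `{x,y}`). -/
def nbhdCoords {d : ℕ} (r : ℕ) (x y : Vert d) : Set (Coord d) :=
  {c | ∀ v ∈ coordVerts c, linfDist v x ≤ r ∨ linfDist v y ≤ r}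

/-- Two sets of coordinates are at mutual distance at least `r`. -/
def coordSetsFar {d : ℕ} (S1 S2 : Set (Coord d)) (r : ℝ) : Prop :=
  ∀ c1 ∈ S1, ∀ c2 ∈ S2, ∀ v1 ∈ coordVerts c1, ∀ v2 ∈ coordVerts c2,
    r ≤ (linfDist v1 v2 : ℝ)

/-! ## The conditions P1, P2, P3, P3', S1, S2 and Z -/

/-- Condition **P1** (invariance and directional ergodicity): each `P u` is invariant
under lattice shifts and every event invariant under a nonzero shift is trivial. -/
def CondP1 {d : ℕ} {Γ : Type*} [MeasurableSpace Γ]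
    (P : ℝ → Measure (Config d Γ)) (I : Set ℝ) : Prop :=
  ∀ u ∈ I, (∀ z : Vert d, MeasurePreserving (shiftConfig z) (P u) (P u)) ∧
    (∀ z : Vert d, z ≠ 0 → ∀ A : Set (Config d Γ), MeasurableSet A →
      shiftConfig z ⁻¹' A = A → P u A = 0 ∨ P u A = 1)

/-- Condition **P2** (stochastic monotonicity in the parameter `u`). -/
def CondP2 {d : ℕ} {Γ : Type*} [MeasurableSpace Γ] [Preorder Γ]
    (P : ℝ → Measure (Config d Γ)) (I : Set ℝ) : Prop :=
  ∀ f : Config d Γ → ℝ, Measurable f → Monotone f → (∀ ω, f ω ∈ Set.Icc (0:ℝ) 1) →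
    ∀ u ∈ I, ∀ u' ∈ I, u ≤ u' → ∫ ω, f ω ∂(P u) ≤ ∫ ω, f ω ∂(P u')

/-- Condition **P3** (decoupling inequality with sprinkling): after possibly
extending the underlying probability space (the extension is given by `Ω'`, `π`
and the family `Q`), for distant boxes and sprinkled levels there is an event `B`
of high probability on which increasing (resp. decreasing) events on the two boxes
can be compared with their probabilities under independent copies. -/
def CondP3 {d : ℕ} {Γ : Type*} [MeasurableSpace Γ] [Preorder Γ]
    (P : ℝ → Measure (Config d Γ)) (I : Set ℝ)
    (ξP εP aP CP χP RP LP : ℝ) : Prop :=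
  1 < ξP ∧ 0 < εP ∧ 0 < aP ∧ 0 < CP ∧ 0 < χP ∧ 0 < RP ∧ 0 < LP ∧
  ∃ (Ω' : Type) (mΩ' : MeasurableSpace Ω') (π : Ω' → Config d Γ)
    (Q : ℝ → @Measure Ω' mΩ') (fP : ℝ → ℝ),
    (@Measurable Ω' (Config d Γ) mΩ' _ π) ∧
    (∀ u ∈ I, @Measure.map Ω' (Config d Γ) mΩ' _ π (Q u) = P u) ∧
    (∀ L : ℝ, LP ≤ L → Real.exp (aP * Real.log L ^ εP) ≤ fP L) ∧
    ∀ (R L : ℝ) (x1 x2 : Vert d) (u uh : ℝ), u ∈ I → uh ∈ I → RP ≤ R → LP ≤ L →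
      (∀ v1 ∈ cubeVerts x1 (L ^ ξP), ∀ v2 ∈ cubeVerts x2 (L ^ ξP),
        R * L ≤ (linfDist v1 v2 : ℝ)) →
      uh + R ^ (-χP) ≤ u →
      ∃ B : Set Ω', @MeasurableSet Ω' mΩ' B ∧
        Q u Bᶜ ≤ ENNReal.ofReal (Real.exp (-(CP * fP L))) ∧
        (∀ A : Set (Config d Γ × Config d Γ), MeasurableSet A → IsUpperSet A →
            PairSupportedOn (boxCoords x1 (L ^ ξP)) (boxCoords x2 (L ^ ξP)) A →
            Q uh {ω' | ω' ∈ B ∧ (π ω', π ω') ∈ A} ≤ ((P u).prod (P u)) A) ∧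
        (∀ A : Set (Config d Γ × Config d Γ), MeasurableSet A → IsLowerSet A →
            PairSupportedOn (boxCoords x1 (L ^ ξP)) (boxCoords x2 (L ^ ξP)) A →
            Q u {ω' | ω' ∈ B ∧ (π ω', π ω') ∈ A} ≤ ((P uh).prod (P uh)) A)

/-- Condition **P3'** (decoupling inequality for sparse sets with super-exponential
error term). -/
def CondP3' {d : ℕ} {Γ : Type*} [MeasurableSpace Γ] [Preorder Γ]
    (P : ℝ → Measure (Config d Γ)) (I : Set ℝ)
    (ξP CP χP RP LP : ℝ) : Prop :=
  1 < ξP ∧ 0 < CP ∧ 0 < χP ∧ 0 < RP ∧ 0 < LP ∧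
  ∀ (R L : ℝ) (x1 x2 : Vert d) (u uh : ℝ), u ∈ I → uh ∈ I → RP ≤ R → LP ≤ L →
    uh + R ^ (-χP) ≤ u →
    ∀ S1 S2 : Set (Coord d), S1 ⊆ boxCoords x1 (L ^ ξP) → S2 ⊆ boxCoords x2 (L ^ ξP) →
      (S1.ncard : ℝ) ≤ L ^ ξP → (S2.ncard : ℝ) ≤ L ^ ξP →
      coordSetsFar S1 S2 (R * L) →
      (∀ f1 f2 : Config d Γ → ℝ, Measurable f1 → Measurable f2 →
        Monotone f1 → Monotone f2 →
        (∀ ω, f1 ω ∈ Set.Icc (0:ℝ) 1) → (∀ ω, f2 ω ∈ Set.Icc (0:ℝ) 1) →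
        SupportedOn S1 f1 → SupportedOn S2 f2 →
        ∫ ω, f1 ω * f2 ω ∂(P uh) ≤ (∫ ω, f1 ω ∂(P u)) * (∫ ω, f2 ω ∂(P u))
          + Real.exp (-(CP * L ^ ξP))) ∧
      (∀ f1 f2 : Config d Γ → ℝ, Measurable f1 → Measurable f2 →
        Antitone f1 → Antitone f2 →
        (∀ ω, f1 ω ∈ Set.Icc (0:ℝ) 1) → (∀ ω, f2 ω ∈ Set.Icc (0:ℝ) 1) →
        SupportedOn S1 f1 → SupportedOn S2 f2 →
        ∫ ω, f1 ω * f2 ω ∂(P u) ≤ (∫ ω, f1 ω ∂(P uh)) * (∫ ω, f2 ω ∂(P uh))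
          + Real.exp (-(CP * L ^ ξP)))

/-- Condition **(Z)**: `liminf_{L→∞} sup_x P^u(Q(x,L) ↔ Q(x,2L)^c in {e : t_e = 0}) = 0`
for every `u ∈ I`. -/
def CondZ {d : ℕ} {Γ : Type*} [MeasurableSpace Γ]
    (P : ℝ → Measure (Config d Γ)) (I : Set ℝ)
    (w : Config d Γ → Vert d → Vert d → ℝ≥0∞) : Prop :=
  ∀ u ∈ I,
    Filter.liminf (fun L : ℕ =>
      ⨆ x : Vert d, P u {ω | ∃ v1 ∈ cubeVerts x (L : ℝ), ∃ v2,
        v2 ∉ cubeVerts x ((2 * L : ℕ) : ℝ) ∧ ConnectedIn (zeroSet (w ω)) v1 v2})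
      Filter.atTop = 0

/-- The function `g_P^{(δ)}` of the main theorem: equal to `L` if condition P3' holds
and otherwise given by the P3-formula. -/
noncomputable def gP3formula (δ εP aP χP L : ℝ) : ℝ :=
  min L (Real.log L ^ (-(δ * (1 + aP + aP / χP))) * Real.exp (aP * Real.log L ^ εP))

noncomputable def gdelta (p3' : Prop) (δ εP aP χP L : ℝ) : ℝ :=
  if p3' then L else gP3formula δ εP aP χP L

/-! ## The renormalization scheme -/

/-- `ρ_k = ρ` for `k < K` and `ρ_k = 1` for `k ≥ K`. -/
def rhok (ρ K k : ℕ) : ℕ := if k < K then ρ else 1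

/-- The sequence of scales `L_{k+1} = 2 L_k (1 + ρ_k/(k+6)^δ)`. -/
noncomputable def Lseq (δ : ℝ) (ρ K : ℕ) (L0 : ℝ) : ℕ → ℝ
  | 0 => L0
  | k + 1 => 2 * Lseq δ ρ K L0 k * (1 + (rhok ρ K k : ℝ) / ((k : ℝ) + 6) ^ δ)

/-- The box `C_x^k = x + [0, L_k)^d ∩ ℤ^d`. -/
def CkSet {d : ℕ} (δ : ℝ) (ρ K : ℕ) (L0 : ℝ) (k : ℕ) (x : Vert d) : Set (Vert d) :=
  {y | ∀ i, (0:ℝ) ≤ ((y i - x i : ℤ) : ℝ) ∧ ((y i - x i : ℤ) : ℝ) < Lseq δ ρ K L0 k}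

/-- The box `D_x^k = x + [-L_k, 2 L_k)^d ∩ ℤ^d`. -/
def DkSet {d : ℕ} (δ : ℝ) (ρ K : ℕ) (L0 : ℝ) (k : ℕ) (x : Vert d) : Set (Vert d) :=
  {y | ∀ i, -(Lseq δ ρ K L0 k) ≤ ((y i - x i : ℤ) : ℝ) ∧
    ((y i - x i : ℤ) : ℝ) < 2 * Lseq δ ρ K L0 k}

/-- `d_k^ω(x)`: the FPP distance between `C_x^k` and the complement of `D_x^k`. -/
noncomputable def dkDist {d : ℕ} (δ : ℝ) (ρ K : ℕ) (L0 : ℝ) (k : ℕ) (x : Vert d)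
    (w : Vert d → Vert d → ℝ≥0∞) : ℝ≥0∞ :=
  ⨅ p : {p : List (Vert d) // ∃ a b, a ∈ CkSet δ ρ K L0 k x ∧ b ∉ DkSet δ ρ K L0 k x ∧
      IsPathFrom a b p}, pathWeight w p.1

/-- `ε_k = Σ_{p ≥ k} ε/(p+6)^δ`. -/
noncomputable def epsk (δ ε : ℝ) (k : ℕ) : ℝ :=
  ∑' j : ℕ, ε / (((k + j : ℕ) : ℝ) + 6) ^ δ

/-- `a_k = 2^k ∏_{i=0}^{k-1} (1 - 1/(i+6)^δ)`. -/
noncomputable def aseq (δ : ℝ) (k : ℕ) : ℝ :=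
  2 ^ k * ∏ i ∈ Finset.range k, (1 - 1 / (((i : ℕ) : ℝ) + 6) ^ δ)

/-- A path visits `A` and visits the complement of `B` ("the path connects `A` to
`B^c`"). -/
def Crosses {d : ℕ} (p : List (Vert d)) (A B : Set (Vert d)) : Prop :=
  (∃ v ∈ p, v ∈ A) ∧ (∃ v ∈ p, v ∉ B)

/-- Two sets of vertices at mutual `ℓ^∞`-distance at least `r`. -/
def SetDistGE {d : ℕ} (A B : Set (Vert d)) (r : ℝ) : Prop :=
  ∀ a ∈ A, ∀ b ∈ B, r ≤ (linfDist a b : ℝ)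

/-- A proper embedding of the binary tree of depth `k` with base `x`, where tree
vertices of depth `n` are encoded as lists of booleans of length `n` and children
are obtained by appending a bit. -/
def ProperEmbedding {d : ℕ} (δ : ℝ) (ρ K : ℕ) (L0 : ℝ)
    (xseq yseq : ℕ → ℕ → Vert d) (k : ℕ) (x : Vert d) (τ : List Bool → Vert d) : Prop :=
  τ [] = x ∧
  (∀ n, n < k → ∀ σ : List Bool, σ.length = n →
    ∃ i < (2 + rhok ρ K (k - n - 1)) ^ d, ∃ j < 2 * d * (6 + rhok ρ K (k - n - 1)) ^ (d - 1),
      τ (σ ++ [true]) = τ σ + xseq (k - n - 1) i ∧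
      τ (σ ++ [false]) = τ σ + yseq (k - n - 1) j) ∧
  (∀ n, n < k → ∀ σ σ' : List Bool, σ.length = n → σ'.length = k - n →
    (DkSet δ ρ K L0 (k - n) (τ σ) ∩ DkSet δ ρ K L0 0 (τ (σ ++ σ'))).Nonempty)

/-- The countable product measure `ν = μ^{⊗ℕ}` characterised on cylinders. -/
def IsIIDProduct {Ω : Type*} [MeasurableSpace Ω] (μ : Measure Ω)
    (ν : Measure (ℕ → Ω)) : Prop :=
  ∀ (s : Finset ℕ) (f : ℕ → Set Ω), (∀ i ∈ s, MeasurableSet (f i)) →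
    ν {ωt | ∀ i ∈ s, ωt i ∈ f i} = ∏ i ∈ s, μ (f i)

/-- The Lorentz `L(d,1)`-norm of a nonnegative random variable. -/
noncomputable def lorentzNorm {Ω : Type*} [MeasurableSpace Ω] (d : ℕ) (P : Measure Ω)
    (X : Ω → ℝ≥0∞) : ℝ≥0∞ :=
  ∫⁻ s in Set.Ioi (0:ℝ), (P {ω | ENNReal.ofReal s < X ω}) ^ ((1:ℝ) / d)

/-! ## The discrete Gaussian free field -/

/-- The neighbours of a vertex of `ℤ^d`. -/
def nbrs {d : ℕ} (x : Vert d) : Finset (Vert d) :=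
  (Finset.univ : Finset (Fin d × Bool)).image
    (fun p => Function.update x p.1 (x p.1 + if p.2 then 1 else -1))

/-- The number of nearest-neighbour walks of length `n` from `x` to `y`. -/
def nStepCount (d : ℕ) : ℕ → Vert d → Vert d → ℕ
  | 0, x, y => if x = y then 1 else 0
  | n + 1, x, y => ∑ z ∈ nbrs x, nStepCount d n z y

/-- The Green function of the simple random walk on `ℤ^d` (with unit weights). -/
noncomputable def greenSRW (d : ℕ) (x y : Vert d) : ℝ≥0∞ :=
  ∑' n : ℕ, (nStepCount d n x y : ℝ≥0∞) / ((2 * d : ℕ) : ℝ≥0∞) ^ n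

/-- `φ` is a centred Gaussian field with covariance `cov` under `P`, characterised by
the moment generating functions of its finite linear combinations. -/
def IsCenteredGaussianField {d : ℕ} {Ω : Type*} [MeasurableSpace Ω] (P : Measure Ω)
    (φ : Ω → Vert d → ℝ) (cov : Vert d → Vert d → ℝ) : Prop :=
  (∀ x, Measurable fun ω => φ ω x) ∧
  ∀ (s : Finset (Vert d)) (c : Vert d → ℝ) (t : ℝ),
    ∫ ω, Real.exp (t * ∑ x ∈ s, c x * φ ω x) ∂P =
      Real.exp (t ^ 2 * (∑ x ∈ s, ∑ y ∈ s, c x * c y * cov x y) / 2)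

/-- The set `S` of vertices percolates (contains an infinite cluster). -/
def PercolatesIn {d : ℕ} (S : Set (Vert d)) : Prop :=
  ∃ x, {y | VConnectedIn S x y}.Infinite

/-- The critical level `h_*` for level-set percolation of the field `φ`. -/
noncomputable def hstar {d : ℕ} {Ω : Type*} [MeasurableSpace Ω] (P : Measure Ω)
    (φ : Ω → Vert d → ℝ) : ℝ :=
  sSup {h : ℝ | P {ω | PercolatesIn {x | h ≤ φ ω x}} ≠ 0}

/-- `h_f = inf {t : f t = 0}` as an extended real number (`⊤` if `f` has no zero). -/
noncomputable def hfEReal (f : ℝ → ℝ) : EReal :=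
  sInf {x : EReal | ∃ s : ℝ, f s = 0 ∧ x = (s : EReal)}

/-! ## Random conductance models -/

/-- An edge is open for conductances `a` if it is a lattice edge with positive
conductance. -/
def openAdj {d : ℕ} (a : Vert d → Vert d → ℝ) (x y : Vert d) : Prop :=
  adj x y ∧ 0 < a x y

/-- A path using only open edges. -/
def IsOpenPath {d : ℕ} (a : Vert d → Vert d → ℝ) (x y : Vert d) (p : List (Vert d)) :
    Prop :=
  p.head? = some x ∧ p.getLast? = some y ∧ p.Chain' (openAdj a)

/-- Connectivity by open paths. -/
def openConn {d : ℕ} (a : Vert d → Vert d → ℝ) (x y : Vert d) : Prop :=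
  ∃ p, IsOpenPath a x y p

/-- The union of the infinite open clusters (the infinite cluster `C_∞` when it is
unique). -/
def Cinf {d : ℕ} (a : Vert d → Vert d → ℝ) : Set (Vert d) :=
  {x | {y | openConn a x y}.Infinite}

/-- The chemical (graph) distance on the open cluster. -/
noncomputable def chemDist {d : ℕ} (a : Vert d → Vert d → ℝ) (x y : Vert d) : ℝ≥0∞ :=
  ⨅ p : {p : List (Vert d) // IsOpenPath a x y p}, ((p.1.length - 1 : ℕ) : ℝ≥0∞)

/-- The closed ball of radius `r` for the chemical distance. -/
def ballCh {d : ℕ} (a : Vert d → Vert d → ℝ) (x : Vert d) (r : ℝ) : Set (Vert d) :=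
  {y | chemDist a x y ≤ ENNReal.ofReal r}

/-- `μ^ω(x) = Σ_{y∼x} a(x,y)`. -/
noncomputable def muA {d : ℕ} (a : Vert d → Vert d → ℝ) (x : Vert d) : ℝ :=
  ∑ y ∈ nbrs x, a x y

/-- `ν^ω(x) = Σ_{y∼x, a(x,y)>0} a(x,y)⁻¹`. -/
noncomputable def nuA {d : ℕ} (a : Vert d → Vert d → ℝ) (x : Vert d) : ℝ :=
  ∑ y ∈ nbrs x, if 0 < a x y then (a x y)⁻¹ else 0

/-- The space-averaged `ℓ^p`-norm `‖f‖_{p,A}` (maximum norm for `p = ∞`). -/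
noncomputable def avgNormR {d : ℕ} (p : ℝ≥0∞) (A : Set (Vert d)) (f : Vert d → ℝ) : ℝ :=
  if p = ∞ then sSup ((fun x => |f x|) '' A)
  else ((∑' x : A, |f (x : Vert d)| ^ p.toReal) / (A.ncard : ℝ)) ^ (1 / p.toReal)

/-- The sum `Σ_{{y,z} open edge} |f(y) - f(z)|` (each unordered edge counted once). -/
noncomputable def edgeGradSum {d : ℕ} (a : Vert d → Vert d → ℝ) (f : Vert d → ℝ) : ℝ :=
  (1 / 2) * ∑' e : Vert d × Vert d, if openAdj a e.1 e.2 then |f e.2 - f e.1| else 0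

/-- The graph assumption: volume regularity of order `d` and a Sobolev inequality
with exponent `d' ≥ d` on large balls of the infinite cluster. -/
def GraphAssumption {d : ℕ} (d' : ℝ) (a : Vert d → Vert d → ℝ)
    (N4 N5 : Vert d → ℕ) (Creg CS1 : ℝ) : Prop :=
  1 ≤ Creg ∧ 1 ≤ CS1 ∧ (d : ℝ) ≤ d' ∧
  (∀ x ∈ Cinf a, ∀ n : ℕ, N4 x ≤ n →
    Creg⁻¹ * (n : ℝ) ^ d ≤ ((ballCh a x n).ncard : ℝ) ∧
      ((ballCh a x n).ncard : ℝ) ≤ Creg * (n : ℝ) ^ d) ∧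
  (∀ x ∈ Cinf a, ∀ n : ℕ, N5 x ≤ n → ∀ f : Vert d → ℝ,
    (∀ y, f y ≠ 0 → y ∈ ballCh a x n) →
    avgNormR (ENNReal.ofReal (d' / (d' - 1))) (ballCh a x n) f ≤
      CS1 * n / ((ballCh a x n).ncard : ℝ) * edgeGradSum a f)

/-- The generator `(ℒ f)(x) = Σ_{y∼x} a(x,y)(f(y)-f(x)) - h κ(x) f(x)`. -/
noncomputable def genL {d : ℕ} (a : Vert d → Vert d → ℝ) (κ : Vert d → ℝ) (h : ℝ)
    (f : Vert d → ℝ) (x : Vert d) : ℝ :=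
  (∑ y ∈ nbrs x, a x y * (f y - f x)) - h * κ x * f x

/-- The carré du champ `Γ(f,g)(x) = Σ_{y∼x} a(x,y)(f(y)-f(x))(g(y)-g(x))`. -/
noncomputable def carre {d : ℕ} (a : Vert d → Vert d → ℝ) (f g : Vert d → ℝ)
    (x : Vert d) : ℝ :=
  ∑ y ∈ nbrs x, a x y * (f y - f x) * (g y - g x)

/-- The weighted carré du champ
`Γ_η(f,g)(x) = Σ_{y∼x} av(η²)({x,y}) a(x,y)(f(y)-f(x))(g(y)-g(x))`. -/
noncomputable def carreEta {d : ℕ} (a : Vert d → Vert d → ℝ) (η f g : Vert d → ℝ)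
    (x : Vert d) : ℝ :=
  ∑ y ∈ nbrs x, ((η x ^ 2 + η y ^ 2) / 2) * (a x y * (f y - f x) * (g y - g x))

/-- The Dirichlet form `E(f) = ⟨∇f, a ∇f⟩ + h ⟨f, κ f⟩`. -/
noncomputable def dirichletE {d : ℕ} (a : Vert d → Vert d → ℝ) (κ : Vert d → ℝ)
    (h : ℝ) (f : Vert d → ℝ) : ℝ :=
  (1 / 2) * (∑' e : Vert d × Vert d,
      if adj e.1 e.2 then a e.1 e.2 * (f e.2 - f e.1) ^ 2 else 0) +
    h * ∑' x, κ x * f x ^ 2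

/-- `g` is the Green function on `C` of the walk with conductances `a` and killing
measure `h·κ`: the minimal nonnegative fundamental solution of `ℒ g(·,y) = -𝟙_y`. -/
def IsGreenFn {d : ℕ} (a : Vert d → Vert d → ℝ) (κ : Vert d → ℝ) (h : ℝ)
    (C : Set (Vert d)) (g : Vert d → Vert d → ℝ) : Prop :=
  (∀ x y, 0 ≤ g x y) ∧
  (∀ y ∈ C, ∀ x ∈ C, genL a κ h (fun z => g z y) x = -(if x = y then (1:ℝ) else 0)) ∧
  (∀ g' : Vert d → Vert d → ℝ, (∀ x y, 0 ≤ g' x y) →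
    (∀ y ∈ C, ∀ x ∈ C, genL a κ h (fun z => g' z y) x ≤ -(if x = y then (1:ℝ) else 0)) →
    ∀ x ∈ C, ∀ y ∈ C, g x y ≤ g' x y)

/-- `q t x y = P_x(X_t = y)` is the (minimal) transition function of the Markov chain
with jump rates `a(x,y)/θ(x)`, characterised via the backward Kolmogorov equations. -/
def IsHeatSemigroup {d : ℕ} (a : Vert d → Vert d → ℝ) (θ : Vert d → ℝ)
    (q : ℝ → Vert d → Vert d → ℝ) : Prop :=
  (∀ x y, q 0 x y = if x = y then (1:ℝ) else 0) ∧
  (∀ t x y, 0 ≤ q t x y) ∧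
  (∀ t x, ∑' y, q t x y ≤ 1) ∧
  (∀ x y, ∀ t : ℝ, 0 ≤ t →
    HasDerivAt (fun s => q s x y) (∑ z ∈ nbrs x, a x z / θ x * (q t z y - q t x y)) t) ∧
  (∀ q' : ℝ → Vert d → Vert d → ℝ,
    (∀ x y, q' 0 x y = if x = y then (1:ℝ) else 0) →
    (∀ t x y, 0 ≤ q' t x y) →
    (∀ x y, ∀ t : ℝ, 0 ≤ t →
      HasDerivAt (fun s => q' s x y)
        (∑ z ∈ nbrs x, a x z / θ x * (q' t z y - q' t x y)) t) →
    ∀ t : ℝ, 0 ≤ t → ∀ x y, q t x y ≤ q' t x y)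

/-- The FPP edge weight `(1 ∧ (κ(x) ∧ κ(y))/a(x,y))^{1/2}` (equal to `∞` on closed
edges); used both for the metric `d_κ` and, with `θ` in place of `κ`, for `d_θ`. -/
noncomputable def kapWeightE {d : ℕ} (a : Vert d → Vert d → ℝ) (κ : Vert d → ℝ)
    (x y : Vert d) : ℝ≥0∞ :=
  if 0 < a x y then ENNReal.ofReal (Real.sqrt (min 1 (min (κ x) (κ y) / a x y))) else ∞

/-- The FPP-type metric `d_κ` on the open cluster. -/
noncomputable def dkap {d : ℕ} (a : Vert d → Vert d → ℝ) (κ : Vert d → ℝ)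
    (x y : Vert d) : ℝ≥0∞ :=
  ⨅ p : {p : List (Vert d) // IsOpenPath a x y p},
    ((edgesOf p.1).map fun e => kapWeightE a κ e.1 e.2).sum

/-- `F_γ(r) = (1+r)^γ (1+1/r)^{1/2}` in `ℝ≥0∞` (so `F_γ(0) = ∞`). -/
noncomputable def FgamE (γ r : ℝ) : ℝ≥0∞ :=
  (1 + ENNReal.ofReal r) ^ γ * (1 + (ENNReal.ofReal r)⁻¹) ^ ((1:ℝ) / 2)

/-- The open cluster of `x` has `ℓ^1`-diameter at least `r`. -/
def clusterDiamGE {d : ℕ} (a : Vert d → Vert d → ℝ) (x : Vert d) (r : ℝ) : Prop :=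
  ∃ y z, openConn a x y ∧ openConn a x z ∧ r ≤ (l1Dist y z : ℝ)

/-- Condition **S1** (local uniqueness of large clusters). -/
def CondS1 {d : ℕ} {Γ : Type*} [MeasurableSpace Γ]
    (P : ℝ → Measure (Config d Γ)) (I : Set ℝ)
    (aC : Config d Γ → Vert d → Vert d → ℝ) : Prop :=
  ∃ fS : ℝ → ℕ → ℝ, ∀ u ∈ I, ∃ ΔS RS : ℝ, 0 < ΔS ∧
    (∀ R : ℕ, RS ≤ R → Real.log (R : ℝ) ^ (1 + ΔS) ≤ fS u R) ∧
    ∀ R : ℕ, 1 ≤ R →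
      (ENNReal.ofReal (1 - Real.exp (-(fS u R))) ≤
        P u {ω | ∃ x ∈ cubeVerts (0 : Vert d) (R : ℝ), clusterDiamGE (aC ω) x (R : ℝ)}) ∧
      (ENNReal.ofReal (1 - Real.exp (-(fS u R))) ≤
        P u {ω | ∀ x ∈ cubeVerts (0 : Vert d) (R : ℝ), ∀ y ∈ cubeVerts (0 : Vert d) (R : ℝ),
          clusterDiamGE (aC ω) x ((R : ℝ) / 10) → clusterDiamGE (aC ω) y ((R : ℝ) / 10) →
          ∃ p, IsOpenPath (aC ω) x y p ∧ ∀ v ∈ p, v ∈ cubeVerts (0 : Vert d) ((2 * R : ℕ) : ℝ)})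

/-- Condition **S2**: `u ↦ P^u(0 ∈ C_∞)` is positive and continuous on `I`. -/
def CondS2 {d : ℕ} {Γ : Type*} [MeasurableSpace Γ]
    (P : ℝ → Measure (Config d Γ)) (I : Set ℝ)
    (aC : Config d Γ → Vert d → Vert d → ℝ) : Prop :=
  (∀ u ∈ I, 0 < P u {ω | (0 : Vert d) ∈ Cinf (aC ω)}) ∧
  ContinuousOn (fun u => (P u {ω | (0 : Vert d) ∈ Cinf (aC ω)}).toReal) I

/-- Weighted `p`-th moment `E[X^p w]` (essential supremum of `X` for `p = ∞`). -/
noncomputable def wMoment {Ω : Type*} [MeasurableSpace Ω] (μm : Measure Ω) (p : ℝ≥0∞)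
    (X w : Ω → ℝ≥0∞) : ℝ≥0∞ :=
  if p = ∞ then essSup X μm else ∫⁻ ω, X ω ^ p.toReal * w ω ∂μm

/-- `p_* = p/(p-1)` (with `∞_* = 1`). -/
noncomputable def pstar (p : ℝ≥0∞) : ℝ≥0∞ :=
  if p = ∞ then 1 else ENNReal.ofReal (p.toReal / (p.toReal - 1))

/-- `‖∇η‖_{ℓ^∞(E)}`: the supremum of `|η(y)-η(x)|` over open edges. -/
noncomputable def gradSup {d : ℕ} (a : Vert d → Vert d → ℝ) (η : Vert d → ℝ) : ℝ :=
  sSup {r : ℝ | ∃ x y, openAdj a x y ∧ r = |η y - η x|}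

/-- `exp(-ζ x)` for `x ∈ ℝ≥0∞` (equal to `0` at `x = ∞`). -/
noncomputable def expNegE (ζ : ℝ) (x : ℝ≥0∞) : ℝ≥0∞ :=
  if x = ∞ then 0 else ENNReal.ofReal (Real.exp (-(ζ * x.toReal)))

/-- The `m^ω(n)` factor of the maximal inequality. -/
noncomputable def mBound {d : ℕ} (a : Vert d → Vert d → ℝ) (p q : ℝ≥0∞)
    (phi : Vert d → ℝ) (x0 : Vert d) (n : ℕ) : ℝ :=
  avgNormR p (ballCh a x0 (n : ℝ)) (fun x => max 1 (muA a x)) *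
    avgNormR q (ballCh a x0 (n : ℝ)) (fun x => max 1 (nuA a x)) *
    (1 + avgNormR p (ballCh a x0 (n : ℝ)) (carre a phi fun z => (phi z)⁻¹) * (n : ℝ) ^ 2)

/-- The Caccioppoli estimate with constant `c35` (for the data `a`, `κ`, `h`). -/
def CaccEst {d : ℕ} (a : Vert d → Vert d → ℝ) (κ : Vert d → ℝ) (h : ℝ) (c35 : ℝ) :
    Prop :=
  ∀ B : Set (Vert d), B.Finite → B ⊆ Cinf a →
    (∀ x ∈ B, ∀ y ∈ B, ∃ p, IsOpenPath a x y p ∧ ∀ v ∈ p, v ∈ B) →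
  ∀ η : Vert d → ℝ, (∀ x, η x ∈ Set.Icc (0:ℝ) 1) → (∀ x, η x ≠ 0 → x ∈ B) →
    (∀ x ∈ B, (∃ y, y ∉ B ∧ openAdj a x y) → η x = 0) →
  ∀ u : Vert d → ℝ, (∀ x, 0 ≤ u x) → (∀ x ∈ B, 0 ≤ genL a κ h u x) →
  ∀ phi : Vert d → ℝ, (∀ x, 0 < phi x) →
  ∀ α : ℝ, 1 ≤ α →
    dirichletE a κ h (fun x => η x * (phi x * u x) ^ α) ≤
      c35 * α ^ 2 * ∑' x, (phi x * u x) ^ (2 * α) *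
        (carre a η η x - carreEta a η phi (fun z => (phi z)⁻¹) x)

section Abstract
variable {α : Type*}

/-- Energy on a finite network. -/
noncomputable def EE (Λ : Finset α) (b : α → α → ℝ) (f : α → ℝ) : ℝ :=
  (1 / 2) * ∑ x ∈ Λ, ∑ y ∈ Λ, b x y * (f y - f x) ^ 2

lemma EE_nonneg (Λ : Finset α) (b : α → α → ℝ) (hb0 : ∀ x y, 0 ≤ b x y) (f : α → ℝ) :
    0 ≤ EE Λ b f := by
  unfold EE
  have : 0 ≤ ∑ x ∈ Λ, ∑ y ∈ Λ, b x y * (f y - f x) ^ 2 :=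
    Finset.sum_nonneg fun x _ => Finset.sum_nonneg fun y _ => mul_nonneg (hb0 x y) (sq_nonneg _)
  linarith

lemma green_id (Λ : Finset α) (b : α → α → ℝ) (hs : ∀ x y, b x y = b y x) (f u : α → ℝ) :
    ∑ x ∈ Λ, f x * ∑ y ∈ Λ, b x y * (u y - u x) =
      -((1 / 2) * ∑ x ∈ Λ, ∑ y ∈ Λ, b x y * ((f y - f x) * (u y - u x))) := by
  have h1 : ∑ x ∈ Λ, f x * ∑ y ∈ Λ, b x y * (u y - u x) =
      ∑ x ∈ Λ, ∑ y ∈ Λ, b x y * (f x * (u y - u x)) := by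
    refine Finset.sum_congr rfl fun x _ => ?_
    rw [Finset.mul_sum]
    exact Finset.sum_congr rfl fun y _ => by ring
  have h2 : ∑ x ∈ Λ, ∑ y ∈ Λ, b x y * (f x * (u y - u x)) =
      - ∑ x ∈ Λ, ∑ y ∈ Λ, b x y * (f y * (u y - u x)) := by
    rw [Finset.sum_comm, ← Finset.sum_neg_distrib]
    refine Finset.sum_congr rfl fun x _ => ?_
    rw [← Finset.sum_neg_distrib]
    exact Finset.sum_congr rfl fun y _ => by rw [hs y x]; ring
  have h3 : ∑ x ∈ Λ, ∑ y ∈ Λ, b x y * ((f y - f x) * (u y - u x)) =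
      ∑ x ∈ Λ, ∑ y ∈ Λ, b x y * (f y * (u y - u x)) -
      ∑ x ∈ Λ, ∑ y ∈ Λ, b x y * (f x * (u y - u x)) := by
    rw [← Finset.sum_sub_distrib]
    refine Finset.sum_congr rfl fun x _ => ?_
    rw [← Finset.sum_sub_distrib]
    exact Finset.sum_congr rfl fun y _ => by ring
  rw [h1, h3]
  linarith [h2]

/-- Exact Caccioppoli identity. -/
lemma cacc_id (Λ : Finset α) (b : α → α → ℝ) (hs : ∀ x y, b x y = b y x) (η v : α → ℝ) :
    EE Λ b (fun x => η x * v x) =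
      (1 / 2) * ∑ x ∈ Λ, ∑ y ∈ Λ, b x y * (v x * v y * (η y - η x) ^ 2)
      - ∑ x ∈ Λ, (η x ^ 2 * v x) * ∑ y ∈ Λ, b x y * (v y - v x) := by
  rw [green_id Λ b hs]
  unfold EE
  rw [sub_neg_eq_add, ← mul_add, ← Finset.sum_add_distrib]
  congr 1
  refine Finset.sum_congr rfl fun x _ => ?_
  rw [← Finset.sum_add_distrib]
  exact Finset.sum_congr rfl fun y _ => by ring

lemma cacc_trunc (Λ : Finset α) (b : α → α → ℝ) (hs : ∀ x y, b x y = b y x)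
    (hb0 : ∀ x y, 0 ≤ b x y) (η u : α → ℝ) (k : ℝ)
    (hsub : ∀ x ∈ Λ, η x ≠ 0 → k < u x → 0 ≤ ∑ y ∈ Λ, b x y * (u y - u x)) :
    EE Λ b (fun x => η x * max (u x - k) 0) ≤
      (1 / 2) * ∑ x ∈ Λ, ∑ y ∈ Λ,
        b x y * (max (u x - k) 0 * max (u y - k) 0 * (η y - η x) ^ 2) := by
  rw [cacc_id Λ b hs η (fun x => max (u x - k) 0)]
  have : 0 ≤ ∑ x ∈ Λ, (η x ^ 2 * max (u x - k) 0) *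
      ∑ y ∈ Λ, b x y * (max (u y - k) 0 - max (u x - k) 0) := by
    refine Finset.sum_nonneg fun x hx => ?_
    by_cases h1 : η x = 0
    · simp [h1]
    by_cases h2 : k < u x
    · refine mul_nonneg (mul_nonneg (sq_nonneg _) (le_max_right _ _)) ?_
      refine (hsub x hx h1 h2).trans (Finset.sum_le_sum fun y _ => ?_)
      refine mul_le_mul_of_nonneg_left ?_ (hb0 x y)
      have e : max (u x - k) 0 = u x - k := max_eq_left (by linarith)
      have := le_max_left (u y - k) 0
      rw [e]; linarith
    · have e : max (u x - k) 0 = 0 := max_eq_right (by linarith)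
      rw [e]; simp
  linarith

/-- Clipped linear cutoff. -/
noncomputable def clip01 (r : ℝ) : ℝ := max 0 (min 1 r)

lemma clip01_nonneg (r : ℝ) : 0 ≤ clip01 r := le_max_left _ _
lemma clip01_le (r : ℝ) : clip01 r ≤ 1 := max_le zero_le_one (min_le_left _ _)
lemma clip01_one {r : ℝ} (h : 1 ≤ r) : clip01 r = 1 := by
  unfold clip01; rw [min_eq_left h]; simp
lemma clip01_zero {r : ℝ} (h : r ≤ 0) : clip01 r = 0 := by
  unfold clip01; exact max_eq_left ((min_le_right _ _).trans h)
lemma clip01_lip (r s : ℝ) : |clip01 r - clip01 s| ≤ |r - s| := by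
  unfold clip01
  refine (abs_max_sub_max_le_max _ _ _ _).trans ?_
  simp only [sub_self, abs_zero]
  refine max_le (abs_nonneg _) ((abs_min_sub_min_le_max _ _ _ _).trans ?_)
  simp

set_option maxHeartbeats 1000000 in
lemma oneStep (Λ Bs : Finset α) (b : α → α → ℝ) (hs : ∀ x y, b x y = b y x)
    (hb0 : ∀ x y, 0 ≤ b x y) (a1 b1 θ : ℝ) (hθ : 0 < θ) (hϑ : θ < 1 - (a1 + b1) / 2)
    (K1 Ci Mr nB : ℝ) (hK1 : 0 < K1) (hCi : 0 < Ci) (hMr : 0 < Mr) (hnB : 0 < nB)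
    (hK : ∀ f : α → ℝ, (∀ x, 0 ≤ f x) → ∀ A : Finset α, A ⊆ Bs →
      (∀ x ∈ Λ, x ∉ A → f x = 0) → ∀ τ : ℝ, 0 < τ → ∀ A' : Finset α, A' ⊆ A →
      (∀ x ∈ A', τ ≤ f x) →
      τ * ((A'.card : ℝ) / nB) ^ θ ≤
        K1 * Mr * Real.sqrt (EE Λ b f * ((A.card : ℝ) / nB) ^ (1 - b1) / nB))
    (hμ : ∀ A : Finset α, A ⊆ Bs →
      ∑ x ∈ A, ∑ y ∈ Λ, b x y ≤ Ci * nB * ((A.card : ℝ) / nB) ^ (1 - a1))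
    (u ψ : α → ℝ) (s t M k δ ε : ℝ) (hst : s < t) (hM : 0 < M) (hk : 0 ≤ k) (hδ : 0 < δ)
    (hε : 0 < ε)
    (hsub : ∀ x ∈ Λ, ψ x ≤ t → 0 < u x → 0 ≤ ∑ y ∈ Λ, b x y * (u y - u x))
    (hsup : ∀ x ∈ Λ, ψ x ≤ t + 1 → u x ≤ M)
    (hB : ∀ x ∈ Λ, ψ x ≤ t → 0 < u x → x ∈ Bs)
    (hlip : ∀ x ∈ Λ, ∀ y ∈ Λ, 0 < b x y → |ψ x - ψ y| ≤ 1)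
    (hmeas : ∀ A : Finset α, A ⊆ Λ → (∀ x ∈ A, ψ x ≤ t ∧ k < u x) → (A.card : ℝ) / nB ≤ ε)
    (hsmall : (K1 * Real.sqrt Ci * (Mr / (t - s)) * 4 / δ) *
      ((4:ℝ) ^ (1 / (1 - (a1 + b1) / 2 - θ))) ^ θ * ε ^ (1 - (a1 + b1) / 2 - θ) ≤ 1) :
    ∀ x ∈ Λ, ψ x ≤ s → u x ≤ k + δ * M := by
  set ϑ := 1 - (a1 + b1) / 2 with hϑd
  set bb : ℝ := (4:ℝ) ^ (1 / (ϑ - θ)) with hbb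
  have hdiff : 0 < ϑ - θ := by linarith
  have hbb1 : 1 < bb := Real.one_lt_rpow (by norm_num) (by positivity)
  have hbb0 : 0 < bb := by linarith
  have hbbpow : bb ^ (ϑ - θ) = 4 := by
    rw [hbb, ← Real.rpow_mul (by norm_num)]
    rw [one_div, inv_mul_cancel₀ hdiff.ne', Real.rpow_one]
  set H := K1 * Real.sqrt Ci * (Mr / (t - s)) * 4 / δ with hH
  have hg : 0 < t - s := by linarith
  have hH0 : 0 < H := by
    have := Real.sqrt_pos.2 hCi
    positivity
  have key : ∀ j : ℕ, ∀ A : Finset α, A ⊆ Λ →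
      (∀ x ∈ A, ψ x ≤ s + (t - s) * (1/2) ^ j ∧ k + δ * M * (1 - (1/2) ^ j) < u x) →
      (A.card : ℝ) / nB ≤ ε * (bb⁻¹) ^ j := by
    intro j
    induction j with
    | zero =>
      intro A hA h
      simp only [pow_zero, mul_one, sub_self, mul_zero, add_zero] at h ⊢
      refine hmeas A hA fun x hx => ⟨?_, (h x hx).2⟩
      have := (h x hx).1; linarith
    | succ j ih =>
      intro A' hA' h'
      set qj : ℝ := (1/2 : ℝ) ^ j with hqj
      have hq0 : 0 < qj := by positivity
      have hq1 : qj ≤ 1 := pow_le_one₀ (by norm_num) (by norm_num)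
      have hqs : (1/2 : ℝ) ^ (j+1) = qj / 2 := by rw [pow_succ]; ring
      rw [hqs] at h'
      set kj := k + δ * M * (1 - qj) with hkj
      have hkj0 : 0 ≤ kj := by
        have : 0 ≤ δ * M * (1 - qj) := mul_nonneg (by positivity) (by linarith)
        linarith
      set sj := s + (t - s) * qj with hsj
      have hsjt : sj ≤ t := by
        have : (t - s) * qj ≤ (t - s) * 1 := mul_le_mul_of_nonneg_left hq1 hg.le
        linarith
      set A := Λ.filter (fun x => ψ x ≤ sj ∧ kj < u x) with hAdef
      have hAmem : ∀ x, x ∈ A ↔ x ∈ Λ ∧ ψ x ≤ sj ∧ kj < u x := by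
        intro x; rw [hAdef, Finset.mem_filter]
      have hAX := ih A (Finset.filter_subset _ _) (fun x hx => ((hAmem x).1 hx).2)
      have hAB : A ⊆ Bs := by
        intro x hx
        obtain ⟨h1, h2, h3⟩ := (hAmem x).1 hx
        exact hB x h1 (h2.trans hsjt) (by linarith)
      set η : α → ℝ := fun x => clip01 ((sj - ψ x) / ((t - s) * qj / 2)) with hη
      have hgq : 0 < (t - s) * qj / 2 := by positivity
      set f : α → ℝ := fun x => η x * max (u x - kj) 0 with hf
      have hηne : ∀ x, η x ≠ 0 → ψ x < sj := by
        intro x hx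
        by_contra hcon
        apply hx
        apply clip01_zero
        apply div_nonpos_of_nonpos_of_nonneg _ hgq.le
        linarith
      have hf0 : ∀ x, 0 ≤ f x := fun x => mul_nonneg (clip01_nonneg _) (le_max_right _ _)
      have hfA : ∀ x ∈ Λ, x ∉ A → f x = 0 := by
        intro x hx hxA
        by_contra hne
        apply hxA
        rw [hAmem]
        refine ⟨hx, (hηne x (left_ne_zero_of_mul hne)).le, ?_⟩
        by_contra hcon
        apply right_ne_zero_of_mul hne
        apply max_eq_right; linarith
      set τ := δ * M * (qj / 2) with hτ
      have hτ0 : 0 < τ := by positivity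
      have hA'A : A' ⊆ A := by
        intro x hx
        rw [hAmem]
        refine ⟨hA' hx, ?_, ?_⟩
        · have := (h' x hx).1
          have h3 : (t - s) * (qj / 2) ≤ (t - s) * qj :=
            mul_le_mul_of_nonneg_left (by linarith) hg.le
          rw [hsj]; linarith
        · have := (h' x hx).2
          have h3 : δ * M * (1 - qj) ≤ δ * M * (1 - qj/2) :=
            mul_le_mul_of_nonneg_left (by linarith) (by positivity)
          rw [hkj]; linarith
      have hfτ : ∀ x ∈ A', τ ≤ f x := by
        intro x hx
        have h1 := (h' x hx).1
        have h2 := (h' x hx).2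
        have e1 : η x = 1 := by
          apply clip01_one
          rw [le_div_iff₀ hgq]
          rw [hsj]; linarith
        have e2 : τ ≤ u x - kj := by
          rw [hτ, hkj]; linarith
        rw [hf]; simp only [e1, one_mul]
        exact e2.trans (le_max_left _ _)
      have hK' := hK f hf0 A hAB hfA τ hτ0 A' hA'A hfτ
      -- energy bound
      set Xj := (A.card : ℝ) / nB with hXj
      have hXj0 : 0 ≤ Xj := by positivity
      set X' := (A'.card : ℝ) / nB with hX'
      have hX'0 : 0 ≤ X' := by positivity
      have hE : EE Λ b f ≤ (M / ((t - s) * qj / 2)) ^ 2 * (Ci * nB * Xj ^ (1 - a1)) := by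
        refine (cacc_trunc Λ b hs hb0 η u kj ?_).trans ?_
        · intro x hx h1 h2
          exact hsub x hx ((hηne x h1).le.trans hsjt) (by linarith)
        have hterm : ∀ x ∈ Λ, ∀ y ∈ Λ,
            b x y * (max (u x - kj) 0 * max (u y - kj) 0 * (η y - η x) ^ 2) ≤
            (if x ∈ A then b x y * (M / ((t - s) * qj / 2)) ^ 2 else 0) +
            (if y ∈ A then b x y * (M / ((t - s) * qj / 2)) ^ 2 else 0) := by
          intro x hx y hy
          have hnn : ∀ z : α, 0 ≤ (if z ∈ A then b x y * (M / ((t - s) * qj / 2)) ^ 2 else 0) := by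
            intro z; split_ifs
            · exact mul_nonneg (hb0 x y) (sq_nonneg _)
            · exact le_rfl
          rcases (hb0 x y).eq_or_lt with hb | hb
          · rw [← hb]; simp
          by_cases hηη : η x = 0 ∧ η y = 0
          · rw [hηη.1, hηη.2]
            have := hnn x; have := hnn y
            simp only [sub_self]
            nlinarith
          by_cases hux : kj < u x
          swap
          · rw [max_eq_right (by linarith : u x - kj ≤ 0)]
            have := hnn x; have := hnn y
            simp only [zero_mul, mul_zero]; linarith
          by_cases huy : kj < u y
          swap
          · rw [max_eq_right (by linarith : u y - kj ≤ 0)]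
            have := hnn x; have := hnn y
            simp only [zero_mul, mul_zero]; linarith
          have hl := hlip x hx y hy hb
          have hψ : ψ x ≤ t + 1 ∧ ψ y ≤ t + 1 := by
            rw [abs_le] at hl
            rcases not_and_or.1 hηη with h1 | h1
            · have := hηne x h1; constructor <;> linarith [hl.1, hl.2]
            · have := hηne y h1; constructor <;> linarith [hl.1, hl.2]
          have hux2 : max (u x - kj) 0 ≤ M := by
            apply max_le _ hM.le
            have := hsup x hx hψ.1; linarith
          have huy2 : max (u y - kj) 0 ≤ M := by
            apply max_le _ hM.le
            have := hsup y hy hψ.2; linarith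
          have hdη : (η y - η x) ^ 2 ≤ (1 / ((t - s) * qj / 2)) ^ 2 := by
            rw [← sq_abs (η y - η x)]
            apply pow_le_pow_left₀ (abs_nonneg _)
            refine (clip01_lip _ _).trans ?_
            rw [← sub_div, abs_div, abs_of_pos hgq]
            apply div_le_div_of_nonneg_right _ hgq.le
            have : sj - ψ y - (sj - ψ x) = ψ x - ψ y := by ring
            rw [this]; exact hl
          have hmain : b x y * (max (u x - kj) 0 * max (u y - kj) 0 * (η y - η x) ^ 2) ≤
              b x y * (M / ((t - s) * qj / 2)) ^ 2 := by
            apply mul_le_mul_of_nonneg_left _ hb.le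
            have e : (M / ((t - s) * qj / 2)) ^ 2 = M * M * (1 / ((t - s) * qj / 2)) ^ 2 := by
              ring
            rw [e]
            apply mul_le_mul _ hdη (sq_nonneg _) (by positivity)
            exact mul_le_mul hux2 huy2 (le_max_right _ _) hM.le
          rcases not_and_or.1 hηη with h1 | h1
          · have hxA : x ∈ A := (hAmem x).2 ⟨hx, (hηne x h1).le, hux⟩
            have := hnn y
            rw [if_pos hxA]; linarith
          · have hyA : y ∈ A := (hAmem y).2 ⟨hy, (hηne y h1).le, huy⟩
            have := hnn x
            rw [if_pos hyA]; linarith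
        have hAΛ : A ⊆ Λ := Finset.filter_subset _ _
        have hS : ∑ x ∈ Λ, ∑ y ∈ Λ,
            (if x ∈ A then b x y * (M / ((t - s) * qj / 2)) ^ 2 else 0) =
            (M / ((t - s) * qj / 2)) ^ 2 * ∑ x ∈ A, ∑ y ∈ Λ, b x y := by
          rw [Finset.mul_sum, ← Finset.sum_subset hAΛ]
          · refine Finset.sum_congr rfl fun x hx => ?_
            rw [Finset.mul_sum]
            refine Finset.sum_congr rfl fun y hy => ?_
            rw [if_pos hx]; ring
          · intro x _ hx
            exact Finset.sum_eq_zero fun y _ => if_neg hx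
        have hS2 : ∑ x ∈ Λ, ∑ y ∈ Λ,
            (if y ∈ A then b x y * (M / ((t - s) * qj / 2)) ^ 2 else 0) =
            (M / ((t - s) * qj / 2)) ^ 2 * ∑ x ∈ A, ∑ y ∈ Λ, b x y := by
          rw [Finset.sum_comm, ← hS]
          refine Finset.sum_congr rfl fun x hx => Finset.sum_congr rfl fun y hy => ?_
          rw [hs y x]
        calc (1 / 2) * ∑ x ∈ Λ, ∑ y ∈ Λ,
              b x y * (max (u x - kj) 0 * max (u y - kj) 0 * (η y - η x) ^ 2)
            ≤ (1 / 2) * ∑ x ∈ Λ, ∑ y ∈ Λ,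
              ((if x ∈ A then b x y * (M / ((t - s) * qj / 2)) ^ 2 else 0) +
              (if y ∈ A then b x y * (M / ((t - s) * qj / 2)) ^ 2 else 0)) := by
              apply mul_le_mul_of_nonneg_left _ (by norm_num)
              exact Finset.sum_le_sum fun x hx => Finset.sum_le_sum fun y hy => hterm x hx y hy
          _ = (M / ((t - s) * qj / 2)) ^ 2 * ∑ x ∈ A, ∑ y ∈ Λ, b x y := by
              simp_rw [Finset.sum_add_distrib]
              rw [hS, hS2]; ring
          _ ≤ _ := mul_le_mul_of_nonneg_left (hμ A hAB) (sq_nonneg _)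
      -- combine
      rcases hX'0.eq_or_lt with hX'z | hX'p
      · rw [← hX'z]; positivity
      have hXjp : 0 < Xj := by
        refine hX'p.trans_le ?_
        apply div_le_div_of_nonneg_right _ hnB.le
        exact_mod_cast Finset.card_le_card hA'A
      have hsq : Real.sqrt (EE Λ b f * Xj ^ (1 - b1) / nB) ≤
          (M / ((t - s) * qj / 2)) * Real.sqrt Ci * Xj ^ ϑ := by
        have e1 : EE Λ b f * Xj ^ (1 - b1) / nB ≤
            (M / ((t - s) * qj / 2)) ^ 2 * Ci * (Xj ^ ϑ) ^ 2 := by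
          have e2 : (Xj ^ ϑ) ^ 2 = Xj ^ (1 - a1) * Xj ^ (1 - b1) := by
            rw [← Real.rpow_natCast, ← Real.rpow_mul hXj0, ← Real.rpow_add hXjp]
            congr 1; push_cast; rw [hϑd]; ring
          rw [e2, div_le_iff₀ hnB]
          have := mul_le_mul_of_nonneg_right hE (Real.rpow_nonneg hXj0 (1 - b1))
          calc _ ≤ _ := this
            _ = _ := by ring
        refine (Real.sqrt_le_sqrt e1).trans (le_of_eq ?_)
        rw [Real.sqrt_mul (by positivity), Real.sqrt_mul (by positivity),
          Real.sqrt_sq (by positivity), Real.sqrt_sq (by positivity)]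
      have hrec : X' ^ θ ≤ H * 4 ^ j * Xj ^ ϑ := by
        have h1 : τ * X' ^ θ ≤ K1 * Mr * ((M / ((t - s) * qj / 2)) * Real.sqrt Ci * Xj ^ ϑ) :=
          hK'.trans (mul_le_mul_of_nonneg_left hsq (by positivity))
        have h4 : (4:ℝ) ^ j = 1 / (qj * qj) := by
          rw [hqj, ← mul_pow, one_div, ← inv_pow]; norm_num
        have h2 : τ * (H * 4 ^ j * Xj ^ ϑ) =
            K1 * Mr * ((M / ((t - s) * qj / 2)) * Real.sqrt Ci * Xj ^ ϑ) := by
          rw [h4, hτ, hH]; field_simp; ring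
        rw [← h2] at h1
        exact le_of_mul_le_mul_left h1 hτ0
      have hfin : X' ^ θ ≤ (ε * bb⁻¹ ^ (j+1)) ^ θ := by
        refine hrec.trans ?_
        have hc0 : 0 < ε * bb⁻¹ ^ j := by positivity
        have h1 : Xj ^ ϑ ≤ (ε * bb⁻¹ ^ j) ^ ϑ :=
          Real.rpow_le_rpow hXj0 hAX (by linarith)
        have h2 : (ε * bb⁻¹ ^ j) ^ ϑ = (ε * bb⁻¹ ^ j) ^ θ * (ε * bb⁻¹ ^ j) ^ (ϑ - θ) := by
          rw [← Real.rpow_add hc0]; congr 1; ring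
        have h3 : (ε * bb⁻¹ ^ j) ^ (ϑ - θ) = ε ^ (ϑ - θ) * (4⁻¹) ^ j := by
          rw [Real.mul_rpow hε.le (by positivity), ← Real.rpow_natCast, ← Real.rpow_mul (by positivity),
            mul_comm (j:ℝ), Real.rpow_mul (by positivity), Real.inv_rpow hbb0.le, hbbpow,
            Real.rpow_natCast]
        have h5 : (ε * bb⁻¹ ^ (j+1)) ^ θ = (ε * bb⁻¹ ^ j) ^ θ * (bb ^ θ)⁻¹ := by
          rw [pow_succ, ← mul_assoc, Real.mul_rpow hc0.le (by positivity), Real.inv_rpow hbb0.le]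
        rw [h5]
        have hbθ : 0 < bb ^ θ := Real.rpow_pos_of_pos hbb0 _
        calc H * 4 ^ j * Xj ^ ϑ ≤ H * 4 ^ j * ((ε * bb⁻¹ ^ j) ^ θ * (ε ^ (ϑ - θ) * (4⁻¹) ^ j)) := by
              rw [← h3, ← h2]
              exact mul_le_mul_of_nonneg_left h1 (by positivity)
          _ = (ε * bb⁻¹ ^ j) ^ θ * (H * ε ^ (ϑ - θ)) := by
              have h44 : (4:ℝ) ^ j * (4⁻¹) ^ j = 1 := by
                rw [← mul_pow]; norm_num
              calc _ = (ε * bb⁻¹ ^ j) ^ θ * (H * ε ^ (ϑ - θ)) * ((4:ℝ) ^ j * (4⁻¹) ^ j) := by ring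
                _ = _ := by rw [h44, mul_one]
          _ ≤ (ε * bb⁻¹ ^ j) ^ θ * (bb ^ θ)⁻¹ := by
              apply mul_le_mul_of_nonneg_left _ (Real.rpow_nonneg hc0.le _)
              rw [le_inv_comm₀ (by positivity) hbθ, le_inv_comm₀ hbθ (by positivity)]
              rw [← one_div, le_div_iff₀ hbθ]
              linarith [hsmall]
      exact (Real.rpow_le_rpow_iff hX'0 (by positivity) hθ).1 hfin
  intro x hx hxs
  by_contra hcon
  push Not at hcon
  have hall : ∀ j : ℕ, 1 / nB ≤ ε * bb⁻¹ ^ j := by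
    intro j
    have := key j {x} (by simpa using hx) ?_
    · simpa using this
    · intro y hy
      rw [Finset.mem_singleton] at hy
      subst hy
      have hq0 : 0 < (1/2 : ℝ) ^ j := by positivity
      constructor
      · have : 0 < (t - s) * (1/2:ℝ) ^ j := by positivity
        linarith
      · have : 0 < δ * M * (1/2:ℝ) ^ j := by positivity
        have e : δ * M * (1 - (1/2:ℝ) ^ j) = δ * M - δ * M * (1/2:ℝ) ^ j := by ring
        rw [e]; linarith
  have hlim : Tendsto (fun j : ℕ => ε * bb⁻¹ ^ j) atTop (𝓝 (ε * 0)) :=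
    (tendsto_pow_atTop_nhds_zero_of_lt_one (by positivity) (inv_lt_one_of_one_lt₀ hbb1)).const_mul ε
  have := ge_of_tendsto' hlim hall
  have h2 : 0 < 1 / nB := by positivity
  linarith

end Abstract

section Abstract2
variable {α : Type*}

/-- The analytic input on one ball `Bs` of a finite network: a functional inequality and an
integrability bound. -/
structure NetHyp (Λ Bs : Finset α) (b : α → α → ℝ) (a1 b1 θ K1 Ci Mr nB : ℝ) : Prop where
  symm : ∀ x y, b x y = b y x
  nonneg : ∀ x y, 0 ≤ b x y
  hMr : 1 ≤ Mr
  hnB : 0 < nB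
  hK : ∀ f : α → ℝ, (∀ x, 0 ≤ f x) → ∀ A : Finset α, A ⊆ Bs →
      (∀ x ∈ Λ, x ∉ A → f x = 0) → ∀ τ : ℝ, 0 < τ → ∀ A' : Finset α, A' ⊆ A →
      (∀ x ∈ A', τ ≤ f x) →
      τ * ((A'.card : ℝ) / nB) ^ θ ≤
        K1 * Mr * Real.sqrt (EE Λ b f * ((A.card : ℝ) / nB) ^ (1 - b1) / nB)
  hμ : ∀ A : Finset α, A ⊆ Bs →
      ∑ x ∈ A, ∑ y ∈ Λ, b x y ≤ Ci * nB * ((A.card : ℝ) / nB) ^ (1 - a1)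

set_option maxHeartbeats 1000000 in
/-- De Giorgi type maximal inequality. -/
lemma maxLemma (a1 b1 θ K1 Ci Cr Q : ℝ) (dd : ℕ) (hθ : 0 < θ) (hϑ : θ < 1 - (a1 + b1) / 2)
    (hK1 : 0 < K1) (hCi : 0 < Ci) (hCr : 0 < Cr) (hQ : 0 < Q) :
    ∃ C : ℝ, 0 < C ∧ ∀ (α : Type) (Λ Bs : Finset α) (b : α → α → ℝ) (Mr nB : ℝ),
      NetHyp Λ Bs b a1 b1 θ K1 Ci Mr nB → nB ≤ Cr * Mr ^ dd →
      ∀ (u ψ : α → ℝ) (L A : ℝ), 0 < L → L ≤ Mr → Mr ≤ Q * L → 0 < A →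
      (∀ x ∈ Λ, 0 ≤ ψ x) →
      (∀ x ∈ Λ, ψ x ≤ L → 0 < u x → 0 ≤ ∑ y ∈ Λ, b x y * (u y - u x)) →
      (∀ x ∈ Λ, ψ x ≤ L → 0 < u x → x ∈ Bs) →
      (∀ x ∈ Λ, ∀ y ∈ Λ, 0 < b x y → |ψ x - ψ y| ≤ 1) →
      (∀ τ : ℝ, 0 < τ → ∀ A' : Finset α, A' ⊆ Λ → (∀ x ∈ A', ψ x ≤ L ∧ τ ≤ u x) →
        (A'.card : ℝ) / nB ≤ Real.sqrt (A / τ)) →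
      ∀ x ∈ Λ, ψ x ≤ L / 2 → u x ≤ C * A := by
  set ϑ := 1 - (a1 + b1) / 2 with hϑd
  have hdiff : 0 < ϑ - θ := by linarith
  set e := 1 / (ϑ - θ) with he
  have he0 : 0 < e := by positivity
  obtain ⟨γ, hγ⟩ : ∃ γ : ℕ, γ = max ⌈2 * e⌉₊ (2 * dd) := ⟨_, rfl⟩
  have hγe : 2 * e ≤ (γ : ℝ) := by
    refine (Nat.le_ceil _).trans ?_
    rw [hγ]; exact_mod_cast le_max_left _ _
  have hγd : 2 * dd ≤ γ := by rw [hγ]; exact le_max_right _ _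
  set bb : ℝ := (4:ℝ) ^ e with hbb
  have hbb0 : 0 < bb := by positivity
  set δ : ℝ := 1 / (2 * 2 ^ γ) with hδ
  have hδ0 : 0 < δ := by positivity
  have hsC : 0 < Real.sqrt Ci := Real.sqrt_pos.2 hCi
  set c0 := K1 * Real.sqrt Ci * 16 / δ * bb ^ θ with hc0
  have hc00 : 0 < c0 := by positivity
  set c1 := max c0 1 with hc1
  have hc1p : 1 ≤ c1 := le_max_right _ _
  have hc01 : c0 ≤ c1 := le_max_left _ _
  set C0 := 2 * c1 ^ γ + 4 ^ γ * Cr ^ 2 with hC0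
  have hC00 : 0 < C0 := by positivity
  refine ⟨C0 * (2 * Q) ^ γ, by positivity, ?_⟩
  intro α Λ Bs b Mr nB hN hnBle u ψ L A hL hLM hMQ hA hψ0 hsub hB hlip hdist x hx hxL
  have hMr := hN.hMr
  have hnB := hN.hnB
  rcases le_or_gt (u x) 0 with hux | hux
  · exact hux.trans (by positivity)
  set S := Λ.filter (fun z => ψ z ≤ L) with hS
  have hxS : x ∈ S := by
    rw [hS, Finset.mem_filter]; exact ⟨hx, by linarith⟩
  obtain ⟨xs, hxsS, hmax⟩ := Finset.exists_max_image S (fun z => (L - ψ z) ^ γ * u z) ⟨x, hxS⟩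
  obtain ⟨hxs, hxsL⟩ := Finset.mem_filter.1 hxsS
  have hmain : (L - ψ xs) ^ γ * u xs ≤ C0 * A * Mr ^ γ := by
    set g := L - ψ xs with hg
    have hg0 : 0 ≤ g := by linarith
    have hgL : g ≤ L := by linarith [hψ0 xs hxs]
    have hpos : 0 < g ^ γ * u xs := by
      refine lt_of_lt_of_le ?_ (hmax x hxS)
      apply mul_pos _ hux
      apply pow_pos; linarith
    have hus : 0 < u xs := by
      by_contra hcon
      push Not at hcon
      have := mul_nonpos_of_nonneg_of_nonpos (pow_nonneg hg0 γ) hcon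
      linarith
    have hMγ : 1 ≤ Mr ^ γ := one_le_pow₀ hMr
    rcases lt_or_ge g 4 with hg4 | hg4
    · -- near the boundary
      have h1 := hdist (u xs) hus {xs} (by simpa using hxs) (by
        intro z hz
        rw [Finset.mem_singleton] at hz
        subst hz
        exact ⟨hxsL, le_rfl⟩)
      simp only [Finset.card_singleton, Nat.cast_one] at h1
      have h2 : (1 / nB) ^ 2 ≤ A / u xs := by
        have := pow_le_pow_left₀ (by positivity) h1 2
        rwa [Real.sq_sqrt (by positivity)] at this
      have h3 : u xs ≤ A * nB ^ 2 := by
        rw [div_pow, one_pow, div_le_div_iff₀ (by positivity) hus] at h2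
        linarith
      have h4 : nB ^ 2 ≤ Cr ^ 2 * Mr ^ γ := by
        calc nB ^ 2 ≤ (Cr * Mr ^ dd) ^ 2 := pow_le_pow_left₀ hnB.le hnBle 2
          _ = Cr ^ 2 * Mr ^ (2 * dd) := by rw [mul_pow, ← pow_mul]; congr 2; ring
          _ ≤ Cr ^ 2 * Mr ^ γ :=
            mul_le_mul_of_nonneg_left (pow_le_pow_right₀ hMr hγd) (by positivity)
      have h5 : g ^ γ ≤ 4 ^ γ := pow_le_pow_left₀ hg0 hg4.le γ
      calc g ^ γ * u xs ≤ 4 ^ γ * (A * (Cr ^ 2 * Mr ^ γ)) := by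
            apply mul_le_mul h5 _ hus.le (by positivity)
            exact h3.trans (mul_le_mul_of_nonneg_left h4 hA.le)
        _ = (4 ^ γ * Cr ^ 2) * A * Mr ^ γ := by ring
        _ ≤ C0 * A * Mr ^ γ := by
            have : 4 ^ γ * Cr ^ 2 ≤ C0 := by
              rw [hC0]; have : 0 < 2 * c1 ^ γ := by positivity
              linarith
            gcongr
    · have hgp : 0 < g := by linarith
      set Y := c1 * Mr / g with hY
      have hY1 : 1 ≤ Y := by
        rw [hY, le_div_iff₀ hgp]
        nlinarith
      have hY0 : 0 < Y := by linarith
      set k := A * Y ^ γ with hk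
      have hk0 : 0 < k := by positivity
      set ε := Y ^ (-e) with hε
      have hε0 : 0 < ε := Real.rpow_pos_of_pos hY0 _
      have hstep := oneStep Λ Bs b hN.symm hN.nonneg a1 b1 θ hθ (by rw [← hϑd]; exact hϑ)
        K1 Ci Mr nB hK1 hCi
        (by linarith) hnB hN.hK hN.hμ u ψ (ψ xs) (ψ xs + g / 4) (2 ^ γ * u xs) k δ ε
        (by linarith) (by positivity) hk0.le hδ0 hε0
        (fun z hz h1 h2 => hsub z hz (by linarith) h2)
        (by
          intro z hz h1
          rcases le_or_gt (u z) 0 with huz | huz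
          · exact huz.trans (by positivity)
          have h2 : g / 2 ≤ L - ψ z := by linarith
          have h3 := hmax z (by rw [hS, Finset.mem_filter]; exact ⟨hz, by linarith⟩)
          have h4 : (g / 2) ^ γ * u z ≤ g ^ γ * u xs :=
            (mul_le_mul_of_nonneg_right (pow_le_pow_left₀ (by positivity) h2 γ) huz.le).trans h3
          rw [div_pow, div_mul_eq_mul_div, div_le_iff₀ (by positivity)] at h4
          have h5 : g ^ γ * u z ≤ g ^ γ * (2 ^ γ * u xs) := by linarith
          exact le_of_mul_le_mul_left h5 (by positivity))
        (fun z hz h1 h2 => hB z hz (by linarith) h2) hlip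
        (by
          intro A' hA' h
          refine (hdist k hk0 A' hA' (fun z hz => ⟨by linarith [(h z hz).1], (h z hz).2.le⟩)).trans ?_
          rw [hk, Real.sqrt_le_left hε0.le]
          have e1 : A / (A * Y ^ γ) = Y ^ (-(γ:ℝ)) := by
            rw [Real.rpow_neg hY0.le, Real.rpow_natCast]
            field_simp
          rw [e1, hε, ← Real.rpow_natCast, ← Real.rpow_mul hY0.le]
          apply Real.rpow_le_rpow_of_exponent_le hY1
          push_cast; linarith)
        (by
          rw [← hϑd]
          have e1 : ε ^ (ϑ - θ) = Y⁻¹ := by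
            rw [hε, ← Real.rpow_mul hY0.le, ← Real.rpow_neg_one]
            congr 1; rw [he]; field_simp
          rw [e1]
          have e2 : (ψ xs + g / 4 - ψ xs) = g / 4 := by ring
          rw [e2]
          have e3 : K1 * Real.sqrt Ci * (Mr / (g / 4)) * 4 / δ * ((4:ℝ) ^ (1 / (ϑ - θ))) ^ θ * Y⁻¹ =
              c0 / c1 := by
            have : (4:ℝ) ^ (1 / (ϑ - θ)) = bb := rfl
            rw [this, hY, hc0]
            field_simp
            norm_num
          rw [e3]
          exact div_le_one_of_le₀ hc01 (by positivity))
        xs hxs le_rfl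
      have h6 : δ * (2 ^ γ * u xs) = u xs / 2 := by
        rw [hδ]; field_simp
      have h7 : u xs ≤ 2 * k := by linarith
      calc g ^ γ * u xs ≤ g ^ γ * (2 * k) := mul_le_mul_of_nonneg_left h7 (by positivity)
        _ = 2 * c1 ^ γ * A * Mr ^ γ := by
            rw [hk, hY, div_pow, mul_pow]; field_simp
        _ ≤ C0 * A * Mr ^ γ := by
            have : 2 * c1 ^ γ ≤ C0 := by
              rw [hC0]; have : 0 < 4 ^ γ * Cr ^ 2 := by positivity
              linarith
            gcongr
  have h1 : (L / 2) ^ γ * u x ≤ C0 * A * (Q * L) ^ γ := by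
    have h2 : L / 2 ≤ L - ψ x := by linarith
    calc (L / 2) ^ γ * u x ≤ (L - ψ x) ^ γ * u x := by gcongr
      _ ≤ _ := hmax x hxS
      _ ≤ C0 * A * Mr ^ γ := hmain
      _ ≤ _ := by gcongr
  have h3 : (L / 2) ^ γ * (C0 * (2 * Q) ^ γ * A) = C0 * A * (Q * L) ^ γ := by
    have : (L / 2) ^ γ * (2 * Q) ^ γ = (Q * L) ^ γ := by
      rw [← mul_pow]; congr 1; ring
    calc _ = C0 * A * ((L / 2) ^ γ * (2 * Q) ^ γ) := by ring
      _ = _ := by rw [this]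
  rw [← h3] at h1
  exact le_of_mul_le_mul_left h1 (by positivity)

end Abstract2

lemma avgNormR_fin {d : ℕ} (p : ℝ≥0∞) (hp : p ≠ ∞) (B : Finset (Vert d)) (f : Vert d → ℝ) :
    avgNormR p (B : Set (Vert d)) f
      = ((∑ x ∈ B, |f x| ^ p.toReal) / (B.card : ℝ)) ^ (1 / p.toReal) := by
  unfold avgNormR
  rw [if_neg hp, Set.ncard_coe_finset]
  congr 2
  exact Finset.tsum_subtype' B (fun x => |f x| ^ p.toReal)

lemma avg_holder {d : ℕ} (p : ℝ≥0∞) (hp : 1 < p) (B A : Finset (Vert d)) (hA : A ⊆ B)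
    (f : Vert d → ℝ) (hf : ∀ x, 0 ≤ f x) (C : ℝ)
    (h : avgNormR p (B : Set (Vert d)) f ≤ C) :
    ∑ x ∈ A, f x ≤ C * B.card * ((A.card : ℝ) / B.card) ^ (1 - (1 / p).toReal) := by
  rcases A.eq_empty_or_nonempty with rfl | hne
  · rcases B.eq_empty_or_nonempty with rfl | hB
    · simp
    · have hC : 0 ≤ C := by
        refine le_trans ?_ h
        by_cases hpt : p = ∞
        · unfold avgNormR
          rw [if_pos hpt]
          apply Real.sSup_nonneg
          rintro _ ⟨x, _, rfl⟩; positivity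
        · rw [avgNormR_fin p hpt]; positivity
      simp only [Finset.sum_empty]
      positivity
  have hBne : B.Nonempty := hne.mono hA
  have hBc : (0:ℝ) < B.card := by exact_mod_cast hBne.card_pos
  have hAc : (0:ℝ) < A.card := by exact_mod_cast hne.card_pos
  by_cases hpt : p = ∞
  · subst hpt
    unfold avgNormR at h
    rw [if_pos rfl] at h
    have hx : ∀ x ∈ A, f x ≤ C := by
      intro x hx
      refine le_trans (le_trans (le_abs_self _) ?_) h
      apply le_csSup
      · exact (B.finite_toSet.image _).bddAbove
      · exact ⟨x, by exact_mod_cast hA hx, rfl⟩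
    calc ∑ x ∈ A, f x ≤ ∑ x ∈ A, C := Finset.sum_le_sum hx
      _ = C * B.card * ((A.card : ℝ) / B.card) ^ (1 - (1 / (∞:ℝ≥0∞)).toReal) := by
        simp
        field_simp
  · rw [avgNormR_fin p hpt] at h
    set P := p.toReal with hP
    have hP1 : 1 < P := by
      rw [hP, ← ENNReal.toReal_one]
      exact (ENNReal.toReal_lt_toReal (by simp) hpt).2 hp
    have h1p : (1 / p).toReal = 1 / P := by simp [hP]
    rw [h1p]
    have hconj : P.HolderConjugate (Real.conjExponent P) := Real.HolderConjugate.conjExponent hP1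
    have hQ : 1 / Real.conjExponent P = 1 - 1 / P := by
      have := hconj.inv_add_inv_eq_one
      rw [one_div, one_div]; linarith
    have hH := Real.inner_le_Lp_mul_Lq_of_nonneg A hconj (f := f) (g := fun _ => (1:ℝ))
      (fun i _ => hf i) (fun i _ => zero_le_one)
    simp only [mul_one, Real.one_rpow, Finset.sum_const, nsmul_eq_mul] at hH
    rw [hQ] at hH
    set S := ∑ x ∈ B, |f x| ^ P with hS
    have hS0 : 0 ≤ S := Finset.sum_nonneg fun i _ => by positivity
    have hSA : ∑ x ∈ A, f x ^ P ≤ S := by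
      rw [hS]
      refine le_trans (Finset.sum_le_sum (g := fun x => |f x| ^ P) ?_)
        (Finset.sum_le_sum_of_subset_of_nonneg hA fun i _ _ => by positivity)
      intro i _; rw [abs_of_nonneg (hf i)]
    have h2 : S ^ (1 / P) ≤ C * (B.card : ℝ) ^ (1 / P) := by
      rw [Real.div_rpow hS0 hBc.le] at h
      rwa [div_le_iff₀ (by positivity)] at h
    calc ∑ x ∈ A, f x ≤ _ := hH
      _ ≤ (C * (B.card : ℝ) ^ (1 / P)) * (A.card : ℝ) ^ (1 - 1 / P) := by
        gcongr
        refine le_trans (Real.rpow_le_rpow (Finset.sum_nonneg fun i _ => ?_) hSA (by positivity)) h2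
        exact Real.rpow_nonneg (hf i) _
      _ = _ := by
        rw [Real.div_rpow hAc.le hBc.le, Real.rpow_sub hBc, Real.rpow_one]
        have := Real.rpow_pos_of_pos hBc (1 / P)
        field_simp

lemma avg_one {d : ℕ} (B : Finset (Vert d))
    (f : Vert d → ℝ) (hf : ∀ x, 0 ≤ f x) (C : ℝ)
    (h : avgNormR 1 (B : Set (Vert d)) f ≤ C) :
    ∑ x ∈ B, f x ≤ C * B.card := by
  rcases B.eq_empty_or_nonempty with rfl | hBne
  · simp
  have hBc : (0:ℝ) < B.card := by exact_mod_cast hBne.card_pos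
  rw [avgNormR_fin 1 (by simp)] at h
  simp only [ENNReal.toReal_one, Real.rpow_one, div_one] at h
  rw [div_le_iff₀ hBc] at h
  refine le_trans (Finset.sum_le_sum fun i _ => ?_) h
  exact le_abs_self _

lemma avg_weak {d : ℕ} (s : ℝ) (hs : 0 < s) (B A : Finset (Vert d)) (hA : A ⊆ B)
    (hB : B.Nonempty)
    (f : Vert d → ℝ) (τ : ℝ) (hτ : 0 < τ) (hf : ∀ x ∈ A, τ ≤ f x) :
    τ * ((A.card : ℝ) / B.card) ^ (1 / s) ≤ avgNormR (ENNReal.ofReal s) (B : Set (Vert d)) f := by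
  have hBc : (0:ℝ) < B.card := by exact_mod_cast hB.card_pos
  rw [avgNormR_fin _ (by simp), ENNReal.toReal_ofReal hs.le]
  have h1 : τ ^ s * A.card ≤ ∑ x ∈ B, |f x| ^ s := by
    calc τ ^ s * A.card = ∑ x ∈ A, τ ^ s := by simp [mul_comm]
      _ ≤ ∑ x ∈ A, |f x| ^ s := by
        apply Finset.sum_le_sum
        intro i hi
        exact Real.rpow_le_rpow hτ.le ((hf i hi).trans (le_abs_self _)) hs.le
      _ ≤ _ := Finset.sum_le_sum_of_subset_of_nonneg hA fun i _ _ => by positivity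
  have h2 : (τ ^ s) ^ (1 / s) = τ := by
    rw [← Real.rpow_mul hτ.le, mul_one_div_cancel hs.ne', Real.rpow_one]
  calc τ * ((A.card : ℝ) / B.card) ^ (1 / s) = (τ ^ s * ((A.card : ℝ) / B.card)) ^ (1 / s) := by
        rw [Real.mul_rpow (by positivity) (by positivity), h2]
    _ ≤ _ := by
        apply Real.rpow_le_rpow (by positivity) _ (by positivity)
        rw [← mul_div_assoc]
        gcongr

lemma adj_symm {d : ℕ} {x y : Vert d} (h : adj x y) : adj y x := by
  unfold adj at *
  rw [← h]
  refine Finset.sum_congr rfl fun i _ => ?_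
  rw [← Int.natAbs_neg]; congr 1; ring

lemma mem_nbrs {d : ℕ} {x y : Vert d} : y ∈ nbrs x ↔ adj x y := by
  unfold nbrs adj
  simp only [Finset.mem_image, Finset.mem_univ, true_and]
  constructor
  · rintro ⟨⟨i, s⟩, rfl⟩
    rw [Finset.sum_eq_single i]
    · cases s <;> simp
    · intro j _ hj
      simp [Function.update_of_ne hj]
    · simp
  · intro h
    have hex : ∃ i, (x i - y i).natAbs ≠ 0 := by
      by_contra hcon
      push Not at hcon
      simp [hcon] at h
    obtain ⟨i, hi⟩ := hex
    have hsplit := Finset.add_sum_erase Finset.univ (fun i => (x i - y i).natAbs) (Finset.mem_univ i)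
    rw [h] at hsplit
    have h1 : (x i - y i).natAbs = 1 := by omega
    have h0 : ∑ j ∈ Finset.univ.erase i, (x j - y j).natAbs = 0 := by omega
    have hj : ∀ j, j ≠ i → x j = y j := by
      intro j hj
      have := (Finset.sum_eq_zero_iff.1 h0) j (by simp [hj])
      omega
    rcases Int.natAbs_eq (x i - y i) with h2 | h2
    · refine ⟨(i, false), ?_⟩
      funext j
      by_cases hji : j = i
      · subst hji; simp; omega
      · simp [Function.update_of_ne hji, hj j hji]
    · refine ⟨(i, true), ?_⟩
      funext j
      by_cases hji : j = i
      · subst hji; simp; omega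
      · simp [Function.update_of_ne hji, hj j hji]

lemma nbrs_card {d : ℕ} (x : Vert d) : (nbrs x).card ≤ 2 * d := by
  unfold nbrs
  refine Finset.card_image_le.trans ?_
  simp [mul_comm]

lemma adj_irrefl {d : ℕ} (x : Vert d) : ¬ adj x x := by
  simp [adj]

section geom
variable {d : ℕ} {a : Vert d → Vert d → ℝ}

lemma openAdj_symm (hs : ∀ x y, a x y = a y x) {x y : Vert d} (h : openAdj a x y) :
    openAdj a y x := ⟨adj_symm h.1, by rw [hs]; exact h.2⟩

lemma isOpenPath_refl (x : Vert d) : IsOpenPath a x x [x] := by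
  refine ⟨by simp, by simp, List.isChain_singleton _⟩

lemma isOpenPath_snoc {x z w : Vert d} {p : List (Vert d)} (hp : IsOpenPath a x z p)
    (h : openAdj a z w) : IsOpenPath a x w (p ++ [w]) := by
  obtain ⟨h1, h2, h3⟩ := hp
  refine ⟨by simp [List.head?_append, h1], by simp, ?_⟩
  refine List.IsChain.append h3 (List.isChain_singleton _) ?_
  intro u hu v hv
  rw [h2] at hu
  simp at hu hv
  subst hu; subst hv; exact h

lemma edges_snoc (f : Vert d × Vert d → ℝ≥0∞) (w z : Vert d) : ∀ (l : List (Vert d)) (x : Vert d),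
    (x :: l).getLast? = some z →
    ((edgesOf ((x :: l) ++ [w])).map f).sum = ((edgesOf (x :: l)).map f).sum + f (z, w) := by
  intro l
  induction l with
  | nil =>
    intro x hx
    simp at hx; subst hx
    simp [edgesOf]
  | cons b t ih =>
    intro x hx
    have := ih b (by simpa using hx)
    simp only [edgesOf, List.cons_append, List.tail_cons, List.zip_cons_cons, List.map_cons,
      List.sum_cons] at this ⊢
    rw [add_assoc, ← this]

lemma edges_snoc' (f : Vert d × Vert d → ℝ≥0∞) {x z w : Vert d} {p : List (Vert d)}
    (hp : IsOpenPath a x z p) :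
    ((edgesOf (p ++ [w])).map f).sum = ((edgesOf p).map f).sum + f (z, w) := by
  obtain ⟨h1, h2, h3⟩ := hp
  cases p with
  | nil => simp at h1
  | cons b l => exact edges_snoc f w z l b h2

lemma openConn_refl (x : Vert d) : openConn a x x := ⟨_, isOpenPath_refl x⟩

lemma openConn_snoc {x z w : Vert d} (hp : openConn a x z)
    (h : openAdj a z w) : openConn a x w := by
  obtain ⟨p, hp⟩ := hp
  exact ⟨_, isOpenPath_snoc hp h⟩

lemma openConn_iff {x z : Vert d} : openConn a x z ↔ Relation.ReflTransGen (openAdj a) x z := by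
  constructor
  · rintro ⟨p, h1, h2, h3⟩
    cases p with
    | nil => simp at h1
    | cons b l =>
      simp at h1; subst h1
      refine List.relationReflTransGen_of_exists_isChain_cons l h3 ?_
      rw [List.getLast?_eq_some_getLast (List.cons_ne_nil _ _)] at h2
      simpa using h2
  · intro h
    induction h with
    | refl => exact openConn_refl x
    | tail _ h ih => exact openConn_snoc ih h

lemma openConn_symm (hs : ∀ x y, a x y = a y x) {x z : Vert d} (h : openConn a x z) :
    openConn a z x := by
  rw [openConn_iff] at *
  induction h with
  | refl => exact .refl
  | tail _ h ih => exact Relation.ReflTransGen.head (openAdj_symm hs h) ih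

lemma openConn_trans {x z w : Vert d} (h : openConn a x z) (h' : openConn a z w) :
    openConn a x w := by
  rw [openConn_iff] at *
  exact h.trans h'

lemma Cinf_of_conn (hs : ∀ x y, a x y = a y x) {x z : Vert d} (hx : x ∈ Cinf a)
    (h : openConn a x z) : z ∈ Cinf a := by
  unfold Cinf at *
  refine Set.Infinite.mono ?_ hx
  intro w hw
  exact openConn_trans (openConn_symm hs h) hw

/-- The chemical distance as a natural number. -/
noncomputable def Dn (a : Vert d → Vert d → ℝ) (x z : Vert d) : ℕ :=
  sInf {n | ∃ p, IsOpenPath a x z p ∧ p.length - 1 = n}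

lemma Dn_le {x z : Vert d} {p : List (Vert d)} (hp : IsOpenPath a x z p) :
    Dn a x z ≤ p.length - 1 := Nat.sInf_le ⟨p, hp, rfl⟩

lemma Dn_spec {x z : Vert d} (h : openConn a x z) :
    ∃ p, IsOpenPath a x z p ∧ p.length - 1 = Dn a x z := by
  obtain ⟨p, hp⟩ := h
  exact Nat.sInf_mem (s := {n | ∃ p, IsOpenPath a x z p ∧ p.length - 1 = n}) ⟨_, p, hp, rfl⟩

lemma chem_eq {x z : Vert d} (h : openConn a x z) : chemDist a x z = (Dn a x z : ℝ≥0∞) := by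
  unfold chemDist
  apply le_antisymm
  · obtain ⟨p, hp, he⟩ := Dn_spec h
    refine (iInf_le _ ⟨p, hp⟩).trans ?_
    simp only [he]; exact le_rfl
  · refine le_iInf fun p => ?_
    exact_mod_cast Dn_le p.2

lemma chem_top {x z : Vert d} (h : ¬ openConn a x z) : chemDist a x z = ∞ := by
  unfold chemDist
  rw [iInf_eq_top]
  rintro ⟨p, hp⟩
  exact absurd ⟨p, hp⟩ h

lemma mem_ballCh {x z : Vert d} {r : ℝ} (hr : 0 ≤ r) :
    z ∈ ballCh a x r ↔ openConn a x z ∧ (Dn a x z : ℝ) ≤ r := by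
  unfold ballCh
  simp only [Set.mem_ofPred_eq]
  by_cases h : openConn a x z
  · rw [chem_eq h]
    simp only [h, true_and]
    rw [ENNReal.le_ofReal_iff_toReal_le (by simp) hr]
    simp
  · rw [chem_top h]; simp [h]

lemma Dn_self (x : Vert d) : Dn a x x = 0 := by
  have := Dn_le (isOpenPath_refl (a := a) x)
  simpa using this

lemma Dn_step {x z w : Vert d} (h : openConn a x z) (hw : openAdj a z w) :
    Dn a x w ≤ Dn a x z + 1 := by
  obtain ⟨p, hp, he⟩ := Dn_spec h
  have := Dn_le (isOpenPath_snoc hp hw)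
  have hne : p.length ≠ 0 := by
    intro h0
    obtain ⟨h1, _⟩ := hp
    rw [List.length_eq_zero_iff] at h0
    subst h0; simp at h1
  rw [List.length_append] at this
  simp at this
  omega

lemma Dn_lip (hs : ∀ x y, a x y = a y x) {x z w : Vert d} (h : openConn a x z)
    (hw : openAdj a z w) : |(Dn a x z : ℝ) - Dn a x w| ≤ 1 := by
  have h1 := Dn_step h hw
  have h2 := Dn_step (openConn_snoc h hw) (openAdj_symm hs hw)
  have h1' : (Dn a x w : ℝ) ≤ Dn a x z + 1 := by exact_mod_cast h1
  have h2' : (Dn a x z : ℝ) ≤ Dn a x w + 1 := by exact_mod_cast h2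
  rw [abs_le]; constructor <;> linarith

/-- The real FPP weight. -/
noncomputable def kw (a : Vert d → Vert d → ℝ) (κ : Vert d → ℝ) (x y : Vert d) : ℝ :=
  Real.sqrt (min 1 (min (κ x) (κ y) / a x y))

lemma kw_le_one (κ : Vert d → ℝ) (x y : Vert d) : kw a κ x y ≤ 1 := by
  unfold kw
  exact Real.sqrt_le_one.2 (min_le_left _ _)

lemma kw_nonneg (κ : Vert d → ℝ) (x y : Vert d) : 0 ≤ kw a κ x y := Real.sqrt_nonneg _

lemma kw_sq (κ : Vert d → ℝ) (hκ : ∀ x, 0 < κ x) (x y : Vert d) (h : 0 < a x y) :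
    a x y * kw a κ x y ^ 2 ≤ min (κ x) (κ y) := by
  unfold kw
  have hm : 0 < min (κ x) (κ y) := lt_min (hκ x) (hκ y)
  rw [Real.sq_sqrt (le_min zero_le_one (by positivity))]
  calc a x y * min 1 (min (κ x) (κ y) / a x y) ≤ a x y * (min (κ x) (κ y) / a x y) := by
        gcongr; exact min_le_right _ _
    _ = _ := by field_simp

lemma kw_symm (hs : ∀ x y, a x y = a y x) (κ : Vert d → ℝ) (x y : Vert d) :
    kw a κ x y = kw a κ y x := by
  unfold kw; rw [hs x y, min_comm (κ x)]

lemma dkap_le_chem (κ : Vert d → ℝ) (x z : Vert d) : dkap a κ x z ≤ chemDist a x z := by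
  unfold dkap chemDist
  refine iInf_mono fun ⟨p, hp⟩ => ?_
  have hch := hp.2.2
  simp only
  clear hp
  induction p with
  | nil => simp [edgesOf]
  | cons b l ih =>
    cases l with
    | nil => simp [edgesOf]
    | cons c t =>
      have hch' : List.IsChain (openAdj a) (b :: c :: t) := hch
      rw [List.isChain_cons_cons] at hch'
      have := ih hch'.2
      simp only [edgesOf, List.tail_cons, List.zip_cons_cons, List.map_cons, List.sum_cons,
        List.length_cons, Nat.add_sub_cancel] at this ⊢
      rw [add_comm]
      push_cast
      gcongr
      unfold kapWeightE
      rw [if_pos hch'.1.2]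
      exact ENNReal.ofReal_le_one.2 (kw_le_one κ b c)

lemma dkap_step (κ : Vert d → ℝ) {x z w : Vert d} (hw : openAdj a z w) :
    dkap a κ x w ≤ dkap a κ x z + ENNReal.ofReal (kw a κ z w) := by
  unfold dkap
  rw [ENNReal.iInf_add]
  refine le_iInf fun ⟨p, hp⟩ => ?_
  refine (iInf_le _ ⟨p ++ [w], isOpenPath_snoc hp hw⟩).trans ?_
  simp only
  rw [edges_snoc' _ hp]
  simp only
  rw [show kapWeightE a κ z w = ENNReal.ofReal (kw a κ z w) by
    unfold kapWeightE kw; rw [if_pos hw.2]]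

/-- The real FPP distance. -/
noncomputable def δr (a : Vert d → Vert d → ℝ) (κ : Vert d → ℝ) (x z : Vert d) : ℝ :=
  (dkap a κ x z).toReal

lemma δr_nonneg (κ : Vert d → ℝ) (x z : Vert d) : 0 ≤ δr a κ x z := ENNReal.toReal_nonneg

lemma δr_le (κ : Vert d → ℝ) {x z : Vert d} (h : openConn a x z) : δr a κ x z ≤ Dn a x z := by
  have := dkap_le_chem (a := a) κ x z
  rw [chem_eq h] at this
  unfold δr
  have := ENNReal.toReal_mono (by simp) this
  simpa using this

lemma δr_self (κ : Vert d → ℝ) (x : Vert d) : δr a κ x x = 0 := by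
  have := δr_le κ (openConn_refl (a := a) x)
  rw [Dn_self] at this
  exact le_antisymm (by simpa using this) (δr_nonneg κ x x)

lemma δr_step (κ : Vert d → ℝ) {x z w : Vert d} (h : openConn a x z) (hw : openAdj a z w) :
    δr a κ x w ≤ δr a κ x z + kw a κ z w := by
  have h1 := dkap_step κ (x := x) hw
  have hfin : dkap a κ x z ≠ ∞ := by
    have := dkap_le_chem (a := a) κ x z
    rw [chem_eq h] at this
    exact ne_top_of_le_ne_top (by simp) this
  unfold δr
  have := ENNReal.toReal_mono (by simp [hfin]) h1
  rwa [ENNReal.toReal_add hfin (by simp), ENNReal.toReal_ofReal (kw_nonneg κ z w)] at this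

lemma δr_lip (hs : ∀ x y, a x y = a y x) (κ : Vert d → ℝ) {x z w : Vert d} (h : openConn a x z)
    (hw : openAdj a z w) : |δr a κ x z - δr a κ x w| ≤ kw a κ z w := by
  have h1 := δr_step κ h hw
  have h2 := δr_step κ (openConn_snoc h hw) (openAdj_symm hs hw)
  rw [kw_symm hs κ w z] at h2
  rw [abs_le]; constructor <;> linarith

/-- every ball is finite (finite degrees) -/
lemma ball_finite (x : Vert d) (n : ℕ) : {z | openConn a x z ∧ Dn a x z ≤ n}.Finite := by
  have key : ∀ n : ℕ, {z : Vert d | ∃ p, IsOpenPath a x z p ∧ p.length = n + 1}.Finite := by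
    intro n
    induction n with
    | zero =>
      refine (Set.finite_singleton x).subset ?_
      rintro z ⟨p, ⟨h1, h2, _⟩, hl⟩
      match p, hl with
      | [b], _ =>
        simp at h1 h2
        simp [← h2, h1]
    | succ n ih =>
      refine (ih.biUnion (t := fun w => (nbrs w : Set (Vert d))) fun w _ => Finset.finite_toSet _).subset ?_
      rintro z ⟨p, ⟨h1, h2, h3⟩, hl⟩
      have hne : p ≠ [] := by rintro rfl; simp at hl
      have hp := List.dropLast_append_getLast hne
      have hlast : p.getLast hne = z := by
        rw [List.getLast?_eq_some_getLast hne] at h2; simpa using h2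
      rw [hlast] at hp
      have hlen : p.dropLast.length = n + 1 := by simp [hl]
      have hne2 : p.dropLast ≠ [] := by intro h0; rw [h0] at hlen; simp at hlen
      have h3' : List.IsChain (openAdj a) (p.dropLast ++ [z]) := by rw [hp]; exact h3
      rw [List.isChain_append] at h3'
      simp only [Set.mem_iUnion, Set.mem_ofPred_eq]
      refine ⟨p.dropLast.getLast hne2, ⟨p.dropLast, ⟨?_, ?_, h3'.1⟩, hlen⟩, ?_⟩
      · rw [← hp, List.head?_append_of_ne_nil _ hne2] at h1
        exact h1
      · exact List.getLast?_eq_some_getLast hne2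
      · have := h3'.2.2 _ (List.getLast?_eq_some_getLast hne2) z (by simp)
        exact_mod_cast mem_nbrs.2 this.1
  refine ((Set.finite_Iic n).biUnion (t := fun m => {z : Vert d | ∃ p, IsOpenPath a x z p ∧ p.length = m + 1}) fun m _ => key m).subset ?_
  rintro z ⟨hz, hn⟩
  obtain ⟨p, hp, he⟩ := Dn_spec hz
  simp only [Set.mem_iUnion]
  refine ⟨Dn a x z, hn, p, hp, ?_⟩
  have hne : p.length ≠ 0 := by
    intro h0
    obtain ⟨h1, _⟩ := hp
    rw [List.length_eq_zero_iff] at h0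
    subst h0; simp at h1
  omega

/-- balls as finsets -/
noncomputable def bF (a : Vert d → Vert d → ℝ) (x : Vert d) (n : ℕ) : Finset (Vert d) :=
  (ball_finite (a := a) x n).toFinset

lemma mem_bF {x z : Vert d} {n : ℕ} : z ∈ bF a x n ↔ openConn a x z ∧ Dn a x z ≤ n := by
  simp [bF]

lemma coe_bF (x : Vert d) (n : ℕ) : (bF a x n : Set (Vert d)) = ballCh a x (n : ℝ) := by
  ext z
  rw [mem_ballCh (by positivity), Finset.mem_coe, mem_bF]
  simp

lemma bF_mono (x : Vert d) {m n : ℕ} (h : m ≤ n) : bF a x m ⊆ bF a x n := by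
  intro z hz
  rw [mem_bF] at *
  exact ⟨hz.1, hz.2.trans h⟩

lemma bF_step {x z w : Vert d} {n : ℕ} (hz : z ∈ bF a x n) (hw : openAdj a z w) :
    w ∈ bF a x (n + 1) := by
  rw [mem_bF] at *
  exact ⟨openConn_snoc hz.1 hw, (Dn_step hz.1 hw).trans (by omega)⟩

lemma self_mem_bF (x : Vert d) (n : ℕ) : x ∈ bF a x n := by
  rw [mem_bF]; exact ⟨openConn_refl x, by simp [Dn_self]⟩

end geom

/-- conductances restricted to lattice edges -/
noncomputable def bb {d : ℕ} (a : Vert d → Vert d → ℝ) (x y : Vert d) : ℝ :=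
  if adj x y then a x y else 0

/-- standing assumptions at the base point `x` -/
structure Setup {d : ℕ} (a : Vert d → Vert d → ℝ) (κ : Vert d → ℝ) (x : Vert d) (d' : ℝ)
    (p q : ℝ≥0∞) (Cint Creg CS1 : ℝ) (N : ℕ) : Prop where
  hs : ∀ x y, a x y = a y x
  h0 : ∀ x y, 0 ≤ a x y
  hκ : ∀ x, 0 < κ x
  hx : x ∈ Cinf a
  hN : 1 ≤ N
  hC : 1 ≤ Creg
  hC1 : 1 ≤ CS1
  hCi : 0 < Cint
  hp : 1 < p
  hq : 1 < q
  hd' : 3 ≤ d'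
  vol1 : ∀ n : ℕ, N ≤ n → Creg⁻¹ * (n : ℝ) ^ d ≤ (bF a x n).card
  vol2 : ∀ n : ℕ, N ≤ n → ((bF a x n).card : ℝ) ≤ Creg * (n : ℝ) ^ d
  sob : ∀ n : ℕ, N ≤ n → ∀ f : Vert d → ℝ, (∀ y, f y ≠ 0 → y ∈ bF a x n) →
    avgNormR (ENNReal.ofReal (d' / (d' - 1))) (bF a x n : Set (Vert d)) f ≤
      CS1 * n / ((bF a x n).card : ℝ) * edgeGradSum a f
  mu : ∀ n : ℕ, N ≤ n → avgNormR p (bF a x n : Set (Vert d)) (muA a) ≤ Cint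
  nu : ∀ n : ℕ, N ≤ n → avgNormR q (bF a x n : Set (Vert d)) (nuA a) ≤ Cint
  ki : ∀ n : ℕ, N ≤ n → avgNormR 1 (bF a x n : Set (Vert d)) (fun z => (κ z)⁻¹) ≤ Cint

section net
variable {d : ℕ} {a : Vert d → Vert d → ℝ}

lemma bb_symm (hs : ∀ x y, a x y = a y x) (x y : Vert d) : bb a x y = bb a y x := by
  unfold bb
  by_cases h : adj x y
  · rw [if_pos h, if_pos (adj_symm h), hs]
  · rw [if_neg h, if_neg (fun h' => h (adj_symm h'))]

lemma bb_nonneg (h0 : ∀ x y, 0 ≤ a x y) (x y : Vert d) : 0 ≤ bb a x y := by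
  unfold bb; split_ifs; exacts [h0 _ _, le_rfl]

lemma bb_pos {x y : Vert d} : 0 < bb a x y ↔ openAdj a x y := by
  unfold bb openAdj
  split_ifs with h <;> simp [h]

lemma sum_nbrs_eq (h0 : ∀ x y, 0 ≤ a x y) {Λ : Finset (Vert d)} {z : Vert d}
    (hz : ∀ w, openAdj a z w → w ∈ Λ) (F : Vert d → ℝ) :
    ∑ w ∈ nbrs z, a z w * F w = ∑ w ∈ Λ, bb a z w * F w := by
  have h1 : ∀ w ∈ nbrs z, a z w * F w = bb a z w * F w := by
    intro w hw
    rw [bb, if_pos (mem_nbrs.1 hw)]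
  rw [Finset.sum_congr rfl h1]
  have hzero : ∀ w, w ∉ nbrs z → bb a z w * F w = 0 := by
    intro w hw
    rw [bb, if_neg (fun h => hw (mem_nbrs.2 h)), zero_mul]
  have hzero2 : ∀ w, w ∉ Λ → bb a z w * F w = 0 := by
    intro w hw
    have : ¬ 0 < bb a z w := fun h => hw (hz w (bb_pos.1 h))
    rw [le_antisymm (not_lt.1 this) (bb_nonneg h0 z w), zero_mul]
  rw [Finset.sum_subset (Finset.subset_union_left (s₁ := nbrs z) (s₂ := Λ))
      (fun w _ hw => hzero w hw),
    Finset.sum_subset (Finset.subset_union_right (s₁ := nbrs z) (s₂ := Λ))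
      (fun w _ hw => hzero2 w hw)]

lemma sum_bb_le_mu (h0 : ∀ x y, 0 ≤ a x y) (Λ : Finset (Vert d)) (z : Vert d) :
    ∑ w ∈ Λ, bb a z w ≤ muA a z := by
  unfold muA
  have h1 : ∑ w ∈ nbrs z, a z w = ∑ w ∈ nbrs z, bb a z w := by
    refine Finset.sum_congr rfl fun w hw => ?_
    rw [bb, if_pos (mem_nbrs.1 hw)]
  rw [h1, ← Finset.sum_filter_add_sum_filter_not Λ (fun w => w ∈ nbrs z)]
  have h2 : ∑ w ∈ Λ with w ∉ nbrs z, bb a z w = 0 := by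
    refine Finset.sum_eq_zero fun w hw => ?_
    rw [Finset.mem_filter] at hw
    rw [bb, if_neg (fun h => hw.2 (mem_nbrs.2 h))]
  rw [h2, add_zero]
  refine Finset.sum_le_sum_of_subset_of_nonneg ?_ fun i _ _ => bb_nonneg h0 _ _
  intro w hw
  exact (Finset.mem_filter.1 hw).2

lemma sum_bbinv_le_nu (h0 : ∀ x y, 0 ≤ a x y) (Λ : Finset (Vert d)) (z : Vert d) :
    ∑ w ∈ Λ, (if openAdj a z w then (bb a z w)⁻¹ else 0) ≤ nuA a z := by
  unfold nuA
  have h1 : ∑ w ∈ nbrs z, (if 0 < a z w then (a z w)⁻¹ else 0)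
      = ∑ w ∈ nbrs z, (if openAdj a z w then (bb a z w)⁻¹ else 0) := by
    refine Finset.sum_congr rfl fun w hw => ?_
    have := mem_nbrs.1 hw
    simp only [openAdj, bb, this, true_and, if_true]
  rw [h1, ← Finset.sum_filter_add_sum_filter_not Λ (fun w => w ∈ nbrs z)]
  have h2 : ∑ w ∈ Λ with w ∉ nbrs z, (if openAdj a z w then (bb a z w)⁻¹ else 0) = 0 := by
    refine Finset.sum_eq_zero fun w hw => ?_
    rw [Finset.mem_filter] at hw
    rw [if_neg (fun h => hw.2 (mem_nbrs.2 h.1))]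
  rw [h2, add_zero]
  refine Finset.sum_le_sum_of_subset_of_nonneg ?_ fun i _ _ => ?_
  · intro w hw
    exact (Finset.mem_filter.1 hw).2
  · split_ifs
    · exact inv_nonneg.2 (bb_nonneg h0 _ _)
    · exact le_rfl

lemma muA_nonneg (h0 : ∀ x y, 0 ≤ a x y) (z : Vert d) : 0 ≤ muA a z :=
  Finset.sum_nonneg fun _ _ => h0 _ _

lemma nuA_nonneg (h0 : ∀ x y, 0 ≤ a x y) (z : Vert d) : 0 ≤ nuA a z := by
  refine Finset.sum_nonneg fun w _ => ?_
  split_ifs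
  · exact inv_nonneg.2 (h0 _ _)
  · exact le_rfl

lemma grad_le (hs : ∀ x y, a x y = a y x) (h0 : ∀ x y, 0 ≤ a x y) (Λ A : Finset (Vert d))
    (hA : A ⊆ Λ)
    (hN : ∀ z ∈ A, ∀ w, openAdj a z w → w ∈ Λ) (f : Vert d → ℝ) (hf : ∀ z, z ∉ A → f z = 0) :
    edgeGradSum a f ≤ √(EE Λ (bb a) f * ∑ z ∈ A, nuA a z) := by
  have hsum : edgeGradSum a f = (1 / 2) * ∑ e ∈ Λ ×ˢ Λ,
      if openAdj a e.1 e.2 then |f e.2 - f e.1| else 0 := by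
    unfold edgeGradSum
    rw [tsum_eq_sum]
    rintro ⟨z, w⟩ he
    simp only
    split_ifs with ho
    · by_cases hz : z ∈ A
      · exact absurd (Finset.mk_mem_product (hA hz) (hN z hz w ho)) he
      · by_cases hw : w ∈ A
        · exact absurd (Finset.mk_mem_product (hN w hw z (openAdj_symm hs ho)) (hA hw)) he
        · rw [hf z hz, hf w hw]; simp
    · rfl
  set g : Vert d × Vert d → ℝ := fun e =>
    if openAdj a e.1 e.2 ∧ (e.1 ∈ A ∨ e.2 ∈ A) then (√(bb a e.1 e.2))⁻¹ else 0 with hg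
  set k : Vert d × Vert d → ℝ := fun e => √(bb a e.1 e.2) * |f e.2 - f e.1| with hk
  have hgk : ∀ e ∈ Λ ×ˢ Λ, (if openAdj a e.1 e.2 then |f e.2 - f e.1| else 0) = k e * g e := by
    rintro ⟨z, w⟩ _
    simp only [hg, hk]
    by_cases ho : openAdj a z w
    · have hpos : 0 < √(bb a z w) := Real.sqrt_pos.2 (bb_pos.2 ho)
      by_cases hzw : z ∈ A ∨ w ∈ A
      · rw [if_pos ho, if_pos ⟨ho, hzw⟩]; field_simp
      · push Not at hzw
        rw [if_pos ho, if_neg (by tauto), hf z hzw.1, hf w hzw.2]; simp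
    · rw [if_neg ho, if_neg (by tauto)]; simp
  have hk2 : ∑ e ∈ Λ ×ˢ Λ, k e ^ 2 = 2 * EE Λ (bb a) f := by
    unfold EE
    rw [Finset.sum_product, ← mul_assoc]
    norm_num
    refine Finset.sum_congr rfl fun z _ => Finset.sum_congr rfl fun w _ => ?_
    simp only [hk]
    rw [mul_pow, Real.sq_sqrt (bb_nonneg h0 _ _), sq_abs]
  have hg2 : ∑ e ∈ Λ ×ˢ Λ, g e ^ 2 ≤ 2 * ∑ z ∈ A, nuA a z := by
    set I : Vert d → Vert d → ℝ := fun z w => if openAdj a z w then (bb a z w)⁻¹ else 0 with hI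
    have hI0 : ∀ z w, 0 ≤ I z w := by
      intro z w; simp only [hI]; split_ifs
      · exact inv_nonneg.2 (bb_nonneg h0 _ _)
      · exact le_rfl
    have hIs : ∀ z w, I z w = I w z := by
      intro z w; simp only [hI]
      by_cases ho : openAdj a z w
      · rw [if_pos ho, if_pos (openAdj_symm hs ho), bb_symm hs]
      · rw [if_neg ho, if_neg (fun h => ho (openAdj_symm hs h))]
    have hstep : ∀ e ∈ Λ ×ˢ Λ, g e ^ 2 ≤ (if e.1 ∈ A then I e.1 e.2 else 0)
        + (if e.2 ∈ A then I e.1 e.2 else 0) := by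
      rintro ⟨z, w⟩ _
      simp only [hg]
      have := hI0 z w
      by_cases hc : openAdj a z w ∧ (z ∈ A ∨ w ∈ A)
      · rw [if_pos hc, inv_pow, Real.sq_sqrt (bb_nonneg h0 _ _)]
        have hIe : I z w = (bb a z w)⁻¹ := by simp only [hI]; rw [if_pos hc.1]
        rw [← hIe]
        rcases hc.2 with h | h
        · rw [if_pos h]; split_ifs <;> linarith
        · rw [if_pos h]; split_ifs <;> linarith
      · rw [if_neg hc]
        split_ifs <;> simp <;> linarith
    have hone : ∑ z ∈ Λ, ∑ w ∈ Λ, (if z ∈ A then I z w else 0) ≤ ∑ z ∈ A, nuA a z := by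
      calc ∑ z ∈ Λ, ∑ w ∈ Λ, (if z ∈ A then I z w else 0)
          = ∑ z ∈ Λ, (if z ∈ A then ∑ w ∈ Λ, I z w else 0) := by
            refine Finset.sum_congr rfl fun z _ => ?_
            split_ifs <;> simp
        _ = ∑ z ∈ A, ∑ w ∈ Λ, I z w := by
            rw [← Finset.sum_filter]
            congr 1
            ext z; simp only [Finset.mem_filter]
            exact ⟨fun h => h.2, fun h => ⟨hA h, h⟩⟩
        _ ≤ _ := Finset.sum_le_sum fun z _ => sum_bbinv_le_nu h0 Λ z
    have htwo : ∑ z ∈ Λ, ∑ w ∈ Λ, (if w ∈ A then I z w else 0) ≤ ∑ z ∈ A, nuA a z := by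
      rw [Finset.sum_comm]
      refine le_trans (le_of_eq ?_) hone
      refine Finset.sum_congr rfl fun z _ => Finset.sum_congr rfl fun w _ => ?_
      rw [hIs]
    refine (Finset.sum_le_sum hstep).trans ?_
    rw [Finset.sum_add_distrib, Finset.sum_product, Finset.sum_product]
    linarith
  rw [hsum, Finset.sum_congr rfl hgk]
  apply Real.le_sqrt_of_sq_le
  have hCS := Finset.sum_mul_sq_le_sq_mul_sq (Λ ×ˢ Λ) k g
  rw [hk2] at hCS
  have hE := EE_nonneg Λ (bb a) (bb_nonneg h0) f
  have := mul_le_mul_of_nonneg_left hg2 (mul_nonneg zero_le_two hE)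
  nlinarith

lemma netHyp {κ : Vert d → ℝ} {x : Vert d} {d' : ℝ}
    {p q : ℝ≥0∞} {Cint Creg CS1 : ℝ} {N : ℕ} (S : Setup a κ x d' p q Cint Creg CS1 N)
    (m R : ℕ) (hm : N ≤ m) (hR : m ≤ R) :
    NetHyp (bF a x (R + 1)) (bF a x m) (bb a) (1 / p).toReal (1 / q).toReal (1 - 1 / d')
      (CS1 * √Cint) Cint m (bF a x m).card := by
  have hBne : (bF a x m).Nonempty := ⟨x, self_mem_bF x m⟩
  have hBc : (0:ℝ) < (bF a x m).card := by exact_mod_cast hBne.card_pos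
  have hsub : bF a x m ⊆ bF a x (R + 1) := bF_mono x (by omega)
  have hd' := S.hd'
  refine ⟨?_, ?_, ?_, hBc, ?_, ?_⟩
  · exact bb_symm S.hs
  · exact bb_nonneg S.h0
  · exact_mod_cast S.hN.trans hm
  · intro f hf A hA hfA τ hτ A' hA' hfτ
    set F : Vert d → ℝ := fun z => if z ∈ A then f z else 0 with hF
    have h1 := S.sob m hm F (by
      intro y hy
      by_contra hc
      exact hy (by simp only [hF]; rw [if_neg (fun h => hc (hA h))]))
    have h2 := avg_weak (d' / (d' - 1)) (by apply div_pos <;> linarith) (bF a x m) A' (hA'.trans hA)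
      hBne F τ hτ (by intro z hz; simp only [hF]; rw [if_pos (hA' hz)]; exact hfτ z hz)
    have h3 : 1 / (d' / (d' - 1)) = 1 - 1 / d' := by
      have : d' ≠ 0 := by linarith
      have : d' - 1 ≠ 0 := by linarith
      field_simp
    rw [h3] at h2
    have h4 := grad_le S.hs S.h0 (bF a x (R + 1)) A (hA.trans hsub)
      (fun z hz w hw => bF_mono x (by omega) (bF_step (hA hz) hw)) F
      (by intro z hz; simp only [hF]; rw [if_neg hz])
    have hEE : EE (bF a x (R + 1)) (bb a) F = EE (bF a x (R + 1)) (bb a) f := by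
      unfold EE
      have hFf : ∀ z ∈ bF a x (R + 1), F z = f z := by
        intro z hz
        simp only [hF]
        split_ifs with h
        · rfl
        · exact (hfA z hz h).symm
      congr 1
      refine Finset.sum_congr rfl fun z hz => Finset.sum_congr rfl fun w hw => ?_
      rw [hFf z hz, hFf w hw]
    rw [hEE] at h4
    have hE := EE_nonneg (bF a x (R + 1)) (bb a) (bb_nonneg S.h0) f
    have h5 := avg_holder q S.hq (bF a x m) A hA (nuA a) (nuA_nonneg S.h0) Cint (S.nu m hm)
    set E := EE (bF a x (R + 1)) (bb a) f
    set nB : ℝ := ((bF a x m).card : ℝ)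
    set Y : ℝ := ((A.card : ℝ) / nB) ^ (1 - (1 / q).toReal)
    have hY : 0 ≤ Y := by positivity
    have hCS := S.hC1
    have hCi := S.hCi
    calc τ * ((A'.card : ℝ) / nB) ^ (1 - 1 / d') ≤ _ := h2
      _ ≤ _ := h1
      _ ≤ CS1 * m / nB * √(E * (Cint * nB * Y)) := by
        gcongr
        exact h4.trans (Real.sqrt_le_sqrt (mul_le_mul_of_nonneg_left h5 hE))
      _ = CS1 * √Cint * m * √(E * Y / nB) := by
        rw [show E * (Cint * nB * Y) = Cint * (nB ^ 2 * (E * Y / nB)) by field_simp,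
          Real.sqrt_mul hCi.le, Real.sqrt_mul (by positivity), Real.sqrt_sq hBc.le]
        field_simp
  · intro A hA
    refine le_trans ?_ (avg_holder p S.hp (bF a x m) A hA (muA a) (muA_nonneg S.h0) Cint (S.mu m hm))
    exact Finset.sum_le_sum fun z _ => sum_bb_le_mu S.h0 _ z

end net

section fv
variable {d : ℕ} {a : Vert d → Vert d → ℝ} {κ : Vert d → ℝ} {h : ℝ}

lemma genL_lin (f g : Vert d → ℝ) (c : ℝ) (z : Vert d) :
    genL a κ h (fun w => f w + c * g w) z = genL a κ h f z + c * genL a κ h g z := by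
  unfold genL
  rw [mul_sub, Finset.mul_sum, show (∑ y ∈ nbrs z, a z y * (f y - f z)) - h * κ z * f z +
    (∑ y ∈ nbrs z, c * (a z y * (g y - g z)) - c * (h * κ z * g z)) =
    (∑ y ∈ nbrs z, a z y * (f y - f z) + ∑ y ∈ nbrs z, c * (a z y * (g y - g z)))
      - (h * κ z * f z + c * (h * κ z * g z)) by ring, ← Finset.sum_add_distrib]
  congr 1
  · refine Finset.sum_congr rfl fun y _ => by ring
  · ring

lemma comparison (h0 : ∀ x y, 0 ≤ a x y) (hκ : ∀ x, 0 < κ x) (hh : 0 < h) (V : Finset (Vert d))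
    (f : Vert d → ℝ) (hf : ∀ z, z ∉ V → 0 ≤ f z) (hg : ∀ z ∈ V, genL a κ h f z ≤ 0) :
    ∀ z, 0 ≤ f z := by
  by_contra hcon
  push Not at hcon
  obtain ⟨z, hz⟩ := hcon
  have hzV : z ∈ V := by
    by_contra hc; linarith [hf z hc]
  obtain ⟨z0, hz0, hmin⟩ := V.exists_min_image f ⟨z, hzV⟩
  have hneg : f z0 < 0 := lt_of_le_of_lt (hmin z hzV) hz
  have hall : ∀ w, f z0 ≤ f w := by
    intro w
    by_cases hw : w ∈ V
    · exact hmin w hw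
    · linarith [hf w hw]
  have h1 := hg z0 hz0
  unfold genL at h1
  have h2 : 0 ≤ ∑ y ∈ nbrs z0, a z0 y * (f y - f z0) :=
    Finset.sum_nonneg fun y _ => mul_nonneg (h0 _ _) (by linarith [hall y])
  have h3 : 0 < h * κ z0 := mul_pos hh (hκ z0)
  nlinarith

lemma exists_fvGreen (h0 : ∀ x y, 0 ≤ a x y) (hκ : ∀ x, 0 < κ x) (hh : 0 < h)
    (V : Finset (Vert d)) (y : Vert d) :
    ∃ U : Vert d → ℝ, (∀ z, z ∉ V → U z = 0) ∧
      ∀ z ∈ V, genL a κ h U z = -(if z = y then (1:ℝ) else 0) := by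
  set ex : (V → ℝ) → Vert d → ℝ := fun f w => if hw : w ∈ V then f ⟨w, hw⟩ else 0 with hex
  have ex_add : ∀ (f g : V → ℝ) (c : ℝ), ex (f + c • g) = fun w => ex f w + c * ex g w := by
    intro f g c; funext w; simp only [hex]; split_ifs <;> simp
  have ex_off : ∀ (f : V → ℝ) (w : Vert d), w ∉ V → ex f w = 0 := by
    intro f w hw; simp only [hex]; rw [dif_neg hw]
  have ex_on : ∀ (f : V → ℝ) (w : V), ex f w = f w := by
    intro f w; simp [hex]
  have ex_zero : ex 0 = fun _ => 0 := by
    funext w; simp [hex]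
  have gen_zero : ∀ z, genL a κ h (fun _ => 0) z = 0 := by intro z; simp [genL]
  let T : (V → ℝ) →ₗ[ℝ] (V → ℝ) :=
    { toFun := fun f z => genL a κ h (ex f) z
      map_add' := by
        intro f g
        funext z
        have := ex_add f g 1
        rw [one_smul] at this
        simp only [Pi.add_apply]
        rw [this, genL_lin, one_mul]
      map_smul' := by
        intro c f
        funext z
        have := ex_add 0 f c
        rw [zero_add] at this
        simp only [Pi.smul_apply, RingHom.id_apply, smul_eq_mul]
        rw [this, genL_lin, ex_zero, gen_zero, zero_add] }
  have hT : ∀ f (z : V), T f z = genL a κ h (ex f) z := fun _ _ => rfl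
  have hinj : Function.Injective T := by
    rw [injective_iff_map_eq_zero]
    intro f hf
    have hz : ∀ z ∈ V, genL a κ h (ex f) z = 0 := by
      intro z hz
      have := congrFun hf ⟨z, hz⟩
      exact this
    have h1 := comparison h0 hκ hh V (ex f) (fun z hz => (ex_off f z hz).ge)
      (fun z hzV => (hz z hzV).le)
    have h2 := comparison h0 hκ hh V (fun w => 0 + (-1) * ex f w)
      (fun z hz => by rw [ex_off f z hz]; simp)
      (fun z hzV => by rw [genL_lin (fun _ => 0), gen_zero, hz z hzV]; simp)
    funext z
    have h3 := h1 z
    have h4 := h2 z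
    rw [ex_on] at h3 h4
    simp only [Pi.zero_apply]
    linarith
  have hsur := LinearMap.injective_iff_surjective.1 hinj
  obtain ⟨f, hf⟩ := hsur (fun z => -(if (z : Vert d) = y then (1:ℝ) else 0))
  refine ⟨ex f, ex_off f, fun z hz => ?_⟩
  have := congrFun hf ⟨z, hz⟩
  exact this

/-- finite volume Green function -/
noncomputable def UG (a : Vert d → Vert d → ℝ) (κ : Vert d → ℝ) (h : ℝ) (V : Finset (Vert d))
    (y : Vert d) : Vert d → ℝ :=
  if H : ∃ U : Vert d → ℝ, (∀ z, z ∉ V → U z = 0) ∧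
      ∀ z ∈ V, genL a κ h U z = -(if z = y then (1:ℝ) else 0) then H.choose else 0

lemma UG_off (h0 : ∀ x y, 0 ≤ a x y) (hκ : ∀ x, 0 < κ x) (hh : 0 < h)
    (V : Finset (Vert d)) (y z : Vert d) (hz : z ∉ V) : UG a κ h V y z = 0 := by
  unfold UG
  rw [dif_pos (exists_fvGreen h0 hκ hh V y)]
  exact (exists_fvGreen h0 hκ hh V y).choose_spec.1 z hz

lemma UG_gen (h0 : ∀ x y, 0 ≤ a x y) (hκ : ∀ x, 0 < κ x) (hh : 0 < h)
    (V : Finset (Vert d)) (y z : Vert d) (hz : z ∈ V) :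
    genL a κ h (UG a κ h V y) z = -(if z = y then (1:ℝ) else 0) := by
  unfold UG
  rw [dif_pos (exists_fvGreen h0 hκ hh V y)]
  exact (exists_fvGreen h0 hκ hh V y).choose_spec.2 z hz

lemma UG_nonneg (h0 : ∀ x y, 0 ≤ a x y) (hκ : ∀ x, 0 < κ x) (hh : 0 < h)
    (V : Finset (Vert d)) (y z : Vert d) : 0 ≤ UG a κ h V y z := by
  refine comparison h0 hκ hh V _ (fun z hz => (UG_off h0 hκ hh V y z hz).ge) (fun z hz => ?_) z
  rw [UG_gen h0 hκ hh V y z hz]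
  split_ifs <;> simp

/-- domination by any nonnegative supersolution -/
lemma UG_le (h0 : ∀ x y, 0 ≤ a x y) (hκ : ∀ x, 0 < κ x) (hh : 0 < h)
    (V : Finset (Vert d)) (y : Vert d) (G : Vert d → ℝ) (hG : ∀ z, 0 ≤ G z)
    (hG2 : ∀ z ∈ V, genL a κ h G z = -(if z = y then (1:ℝ) else 0)) (z : Vert d) :
    UG a κ h V y z ≤ G z := by
  have := comparison h0 hκ hh V (fun w => G w + (-1) * UG a κ h V y w)
    (fun z hz => by rw [UG_off h0 hκ hh V y z hz]; simpa using hG z)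
    (fun z hz => by rw [genL_lin, UG_gen h0 hκ hh V y z hz, hG2 z hz]; apply le_of_eq; ring) z
  linarith

lemma UG_mono (h0 : ∀ x y, 0 ≤ a x y) (hκ : ∀ x, 0 < κ x) (hh : 0 < h)
    {V V' : Finset (Vert d)} (hV : V ⊆ V') (y z : Vert d) :
    UG a κ h V y z ≤ UG a κ h V' y z :=
  UG_le h0 hκ hh V y _ (UG_nonneg h0 hκ hh V' y) (fun z hz => UG_gen h0 hκ hh V' y z (hV hz)) z

lemma green_le (h0 : ∀ x y, 0 ≤ a x y) (hκ : ∀ x, 0 < κ x) (hh : 0 < h)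
    (hs : ∀ x y, a x y = a y x)
    {x y : Vert d} (hx : x ∈ Cinf a) (hy : y ∈ Cinf a)
    (huniq : ∀ x ∈ Cinf a, ∀ y ∈ Cinf a, openConn a x y)
    (g : Vert d → Vert d → ℝ) (hg : IsGreenFn a κ h (Cinf a) g) (M : ℝ) (R0 : ℕ)
    (hM : ∀ R : ℕ, R0 ≤ R → UG a κ h (bF a x R) y x ≤ M) : g x y ≤ M := by
  obtain ⟨hg1, hg2, hg3⟩ := hg
  have hVC : ∀ R : ℕ, ∀ z ∈ bF a x R, z ∈ Cinf a := by
    intro R z hz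
    exact Cinf_of_conn hs hx (mem_bF.1 hz).1
  have hub : ∀ y ∈ Cinf a, ∀ z, ∀ R : ℕ, UG a κ h (bF a x R) y z ≤ g z y := by
    intro y hy z R
    exact UG_le h0 hκ hh (bF a x R) y (fun z => g z y) (fun z => hg1 z y)
      (fun z hz => hg2 y hy z (hVC R z hz)) z
  have hbdd : ∀ y ∈ Cinf a, ∀ z, BddAbove (Set.range fun R : ℕ => UG a κ h (bF a x R) y z) := by
    rintro y hy z
    refine ⟨g z y, ?_⟩
    rintro _ ⟨R, rfl⟩
    exact hub y hy z R
  set g' : Vert d → Vert d → ℝ := fun z y =>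
    if y ∈ Cinf a then ⨆ R : ℕ, UG a κ h (bF a x R) y z else 0 with hg'
  have hlim : ∀ y ∈ Cinf a, ∀ z,
      Tendsto (fun R : ℕ => UG a κ h (bF a x R) y z) atTop (𝓝 (g' z y)) := by
    intro y hy z
    simp only [hg']
    rw [if_pos hy]
    exact tendsto_atTop_ciSup (fun m n hmn => UG_mono h0 hκ hh (bF_mono x hmn) y z) (hbdd y hy z)
  have hle := hg3 g' (by
      intro z y
      simp only [hg']
      split_ifs with hyC
      · exact le_trans (UG_nonneg h0 hκ hh (bF a x 0) y z) (le_ciSup (hbdd y hyC z) 0)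
      · exact le_rfl) (by
      intro y hy z hz
      apply le_of_eq
      have ht : Tendsto (fun R : ℕ => genL a κ h (UG a κ h (bF a x R) y) z) atTop
          (𝓝 (genL a κ h (fun w => g' w y) z)) := by
        unfold genL
        refine Tendsto.sub (tendsto_finsetSum _ fun w _ => ?_) ((hlim y hy z).const_mul _)
        exact ((hlim y hy w).sub (hlim y hy z)).const_mul _
      refine tendsto_nhds_unique ht ?_
      refine tendsto_const_nhds.congr' ?_
      filter_upwards [eventually_ge_atTop (Dn a x z)] with R hR
      rw [UG_gen h0 hκ hh (bF a x R) y z (mem_bF.2 ⟨huniq x hx z hz, hR⟩)]) x hx y hy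
  refine hle.trans ?_
  refine le_of_tendsto (hlim y hy x) ?_
  filter_upwards [eventually_ge_atTop R0] with R hR using hM R hR

/-- the Laplacian of the finite volume Green function -/
lemma UG_lap (h0 : ∀ x y, 0 ≤ a x y) (hκ : ∀ x, 0 < κ x) (hh : 0 < h)
    (x : Vert d) (R R' : ℕ) (hR : R ≤ R') (y z : Vert d) (hz : z ∈ bF a x R) :
    ∑ w ∈ bF a x (R' + 1), bb a z w * (UG a κ h (bF a x R) y w - UG a κ h (bF a x R) y z)
      = -(if z = y then (1:ℝ) else 0) + h * κ z * UG a κ h (bF a x R) y z := by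
  have h1 := UG_gen h0 hκ hh (bF a x R) y z hz
  unfold genL at h1
  rw [sum_nbrs_eq h0 (Λ := bF a x (R' + 1)) (fun w hw => bF_mono x (by omega) (bF_step hz hw))
    (fun w => UG a κ h (bF a x R) y w - UG a κ h (bF a x R) y z)] at h1
  linarith

lemma UG_test (h0 : ∀ x y, 0 ≤ a x y) (hκ : ∀ x, 0 < κ x) (hh : 0 < h)
    (x : Vert d) (R R' : ℕ) (hR : R ≤ R') (y : Vert d) (hy : y ∈ bF a x R) (f : Vert d → ℝ)
    (hf : ∀ z ∈ bF a x (R' + 1), z ∉ bF a x R → f z = 0) :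
    ∑ z ∈ bF a x (R' + 1), f z * ∑ w ∈ bF a x (R' + 1),
        bb a z w * (UG a κ h (bF a x R) y w - UG a κ h (bF a x R) y z)
      = - f y + h * ∑ z ∈ bF a x R, κ z * (f z * UG a κ h (bF a x R) y z) := by
  rw [← Finset.sum_subset (bF_mono x (hR.trans (Nat.le_succ R')))
    (fun z hz hz' => by rw [hf z hz hz', zero_mul])]
  rw [Finset.sum_congr rfl (fun z hz => by rw [UG_lap h0 hκ hh x R R' hR y z hz])]
  have : ∀ z ∈ bF a x R, f z * (-(if z = y then (1:ℝ) else 0) + h * κ z * UG a κ h (bF a x R) y z)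
      = -(if z = y then f z else 0) + h * (κ z * (f z * UG a κ h (bF a x R) y z)) := by
    intro z _
    split_ifs <;> ring
  rw [Finset.sum_congr rfl this, Finset.sum_add_distrib, Finset.sum_neg_distrib,
    Finset.sum_ite_eq_of_mem' _ _ _ hy, Finset.mul_sum]

lemma UG_symm (hs : ∀ x y, a x y = a y x) (h0 : ∀ x y, 0 ≤ a x y) (hκ : ∀ x, 0 < κ x) (hh : 0 < h)
    (x : Vert d) (R : ℕ) (y z : Vert d) (hy : y ∈ bF a x R) (hz : z ∈ bF a x R) :
    UG a κ h (bF a x R) y z = UG a κ h (bF a x R) z y := by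
  have e1 := UG_test h0 hκ hh x R R le_rfl y hy (UG a κ h (bF a x R) z)
    (fun w _ hw => UG_off h0 hκ hh _ _ _ hw)
  have e2 := UG_test h0 hκ hh x R R le_rfl z hz (UG a κ h (bF a x R) y)
    (fun w _ hw => UG_off h0 hκ hh _ _ _ hw)
  rw [green_id _ _ (bb_symm hs)] at e1 e2
  have e3 : ∑ z_1 ∈ bF a x R, κ z_1 * (UG a κ h (bF a x R) z z_1 * UG a κ h (bF a x R) y z_1)
    = ∑ z_1 ∈ bF a x R, κ z_1 * (UG a κ h (bF a x R) y z_1 * UG a κ h (bF a x R) z z_1) :=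
    Finset.sum_congr rfl fun w _ => by ring
  have e4 : ∑ u ∈ bF a x (R + 1), ∑ w ∈ bF a x (R + 1), bb a u w *
      ((UG a κ h (bF a x R) z w - UG a κ h (bF a x R) z u) *
        (UG a κ h (bF a x R) y w - UG a κ h (bF a x R) y u))
      = ∑ u ∈ bF a x (R + 1), ∑ w ∈ bF a x (R + 1), bb a u w *
      ((UG a κ h (bF a x R) y w - UG a κ h (bF a x R) y u) *
        (UG a κ h (bF a x R) z w - UG a κ h (bF a x R) z u)) :=
    Finset.sum_congr rfl fun u _ => Finset.sum_congr rfl fun w _ => by ring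
  rw [e3, e4] at e1
  linarith

end fv

/-- truncation -/
noncomputable def tr (W τ s : ℝ) : ℝ := min (max (s - W) 0) τ

lemma tr_nonneg {W τ : ℝ} (hτ : 0 ≤ τ) (s : ℝ) : 0 ≤ tr W τ s := le_min (le_max_right _ _) hτ

lemma tr_le (W τ s : ℝ) : tr W τ s ≤ τ := min_le_right _ _

lemma tr_sq (W τ s t : ℝ) : (tr W τ s - tr W τ t) ^ 2 ≤ (tr W τ s - tr W τ t) * (s - t) := by
  have key : ∀ s t : ℝ, t ≤ s → 0 ≤ tr W τ s - tr W τ t ∧ tr W τ s - tr W τ t ≤ s - t := by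
    intro s t hst
    unfold tr
    constructor
    · have : max (t - W) 0 ≤ max (s - W) 0 := max_le_max (by linarith) le_rfl
      have := min_le_min this (le_refl τ)
      linarith
    · have h1 : max (s - W) 0 ≤ max (t - W) 0 + (s - t) := by
        apply max_le
        · linarith [le_max_left (t - W) 0]
        · linarith [le_max_right (t - W) 0]
      rcases min_cases (max (t - W) 0) τ with h | h
      · linarith [min_le_left (max (s - W) 0) τ]
      · linarith [min_le_right (max (s - W) 0) τ]
  rcases le_total t s with h | h
  · obtain ⟨h1, h2⟩ := key s t h
    nlinarith
  · obtain ⟨h1, h2⟩ := key t s h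
    nlinarith

lemma EE_tr {d : ℕ} {a : Vert d → Vert d → ℝ} {κ : Vert d → ℝ} {h : ℝ}
    (hs : ∀ x y, a x y = a y x) (h0 : ∀ x y, 0 ≤ a x y) (hκ : ∀ x, 0 < κ x) (hh : 0 < h)
    (x : Vert d) (R R' : ℕ) (hR : R ≤ R') (z : Vert d) (hz : z ∈ bF a x R) (W τ : ℝ)
    (hW : 0 ≤ W) (hτ : 0 < τ) :
    EE (bF a x (R' + 1)) (bb a) (fun v => tr W τ (UG a κ h (bF a x R) z v)) ≤ τ := by
  set w := UG a κ h (bF a x R) z with hw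
  have hw0 : ∀ v, 0 ≤ w v := UG_nonneg h0 hκ hh _ z
  have h1 := UG_test h0 hκ hh x R R' hR z hz (fun v => tr W τ (w v)) (by
    intro v _ hv
    simp only [hw]
    rw [UG_off h0 hκ hh _ _ _ hv]
    unfold tr
    rw [max_eq_right (by linarith), min_eq_left hτ.le])
  rw [green_id _ _ (bb_symm hs), ← hw] at h1
  have h2 : 0 ≤ h * ∑ v ∈ bF a x R, κ v * (tr W τ (w v) * w v) :=
    mul_nonneg hh.le (Finset.sum_nonneg fun v _ =>
      mul_nonneg (hκ v).le (mul_nonneg (tr_nonneg hτ.le _) (hw0 v)))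
  have h3 : EE (bF a x (R' + 1)) (bb a) (fun v => tr W τ (w v)) ≤
      (1 / 2) * ∑ u ∈ bF a x (R' + 1), ∑ v ∈ bF a x (R' + 1), bb a u v *
        ((tr W τ (w v) - tr W τ (w u)) * (w v - w u)) := by
    unfold EE
    refine mul_le_mul_of_nonneg_left ?_ (by norm_num)
    refine Finset.sum_le_sum fun u _ => Finset.sum_le_sum fun v _ => ?_
    exact mul_le_mul_of_nonneg_left (tr_sq _ _ _ _) (bb_nonneg h0 _ _)
  have h4 := tr_le W τ (w z)
  linarith

set_option maxHeartbeats 1000000 in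
lemma scale_step {d : ℕ} (d' : ℝ) (p q : ℝ≥0∞)
    (Cint Creg CS1 : ℝ) (hd' : 3 ≤ d') (hpq : (1 / p).toReal + (1 / q).toReal < 2 / d')
    (hC : 1 ≤ Creg) (hC1 : 1 ≤ CS1) (hCi : 0 < Cint) :
    ∃ C : ℝ, 0 < C ∧ ∀ (a : Vert d → Vert d → ℝ) (κ : Vert d → ℝ) (x : Vert d) (N : ℕ),
      Setup a κ x d' p q Cint Creg CS1 N → ∀ h : ℝ, 0 < h → ∀ m R R' : ℕ, N ≤ m → 2 * m ≤ R' →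
      R ≤ R' → ∀ z ∈ bF a x R, 2 * Dn a x z ≤ m → ∀ W : ℝ, 0 ≤ W →
      (∀ y ∈ bF a x R, 2 * m ≤ Dn a x y → UG a κ h (bF a x R) z y ≤ W) →
      ∀ y ∈ bF a x R, m ≤ Dn a x y →
        UG a κ h (bF a x R) z y ≤ W + C * ((m : ℝ) ^ 2 / (m : ℝ) ^ d) := by
  have hθ : 0 < 1 - 1 / d' := by
    have : 1 / d' < 1 := by rw [div_lt_one (by linarith)]; linarith
    linarith
  have hθ1 : 1 - 1 / d' ≤ 1 := by
    have : 0 ≤ 1 / d' := by positivity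
    linarith
  have hϑ : 1 - 1 / d' < 1 - ((1 / p).toReal + (1 / q).toReal) / 2 := by
    have : 2 / d' = 2 * (1 / d') := by ring
    linarith
  have hK : 0 < CS1 * √Cint := by positivity
  set K := CS1 * √Cint with hKd
  obtain ⟨C, hCpos, hmax⟩ := maxLemma _ _ _ K Cint Creg 8 d hθ hϑ hK hCi (by linarith)
    (by norm_num)
  refine ⟨C * (4 * K ^ 2 * Creg), by positivity, ?_⟩
  intro a κ x N S h hh m R R' hm hmR hR z hz hzm W hW hWb y hy hym
  have hs := S.hs
  have h0 := S.h0
  have hκ := S.hκ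
  have hm1 : 1 ≤ m := S.hN.trans hm
  have hmpos : (0:ℝ) < m := by exact_mod_cast hm1
  have net := netHyp S (2 * m) R' (by omega) hmR
  set w := UG a κ h (bF a x R) z with hw
  have hw0 : ∀ v, 0 ≤ w v := UG_nonneg h0 hκ hh _ z
  have hwoff : ∀ v, v ∉ bF a x R → w v = 0 := fun v hv => UG_off h0 hκ hh _ z v hv
  set nB : ℝ := ((bF a x (2 * m)).card : ℝ) with hnBd
  have hnB : 0 < nB := net.hnB
  have hinB : ∀ v, W < w v → v ∈ bF a x (2 * m) ∧ v ∈ bF a x R := by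
    intro v hv
    have hvR : v ∈ bF a x R := by
      by_contra hc
      rw [hwoff v hc] at hv; linarith
    refine ⟨?_, hvR⟩
    rw [mem_bF]
    refine ⟨(mem_bF.1 hvR).1, ?_⟩
    by_contra hc
    have := hWb v hvR (by omega)
    linarith
  set A := 4 * K ^ 2 * (m : ℝ) ^ 2 / nB with hA
  have hApos : 0 < A := by positivity
  set ψ : Vert d → ℝ := fun v => max ((m : ℝ) - Dn a x v) 0 with hψ
  have hres := hmax (Vert d) (bF a x (R' + 1)) (bF a x (2 * m)) (bb a) ((2 * m : ℕ) : ℝ) nB net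
    (S.vol2 (2 * m) (by omega)) (fun v => w v - W) ψ ((m : ℝ) / 4) A (by positivity)
    (by push_cast; linarith) (by push_cast; linarith) hApos
    (fun v _ => le_max_right _ _)
    (by
      intro v _ hvψ hvu
      have hvR := (hinB v (by linarith)).2
      have hlap := UG_lap h0 hκ hh x R R' hR z v hvR
      have hne : v ≠ z := by
        rintro rfl
        have h2 : (2:ℝ) * Dn a x v ≤ m := by exact_mod_cast hzm
        have h3 : (m : ℝ) - Dn a x v ≤ m / 4 := (le_max_left _ _).trans hvψ
        linarith
      rw [if_neg hne, ← hw] at hlap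
      have h4 : ∑ u ∈ bF a x (R' + 1), bb a v u * ((w u - W) - (w v - W))
          = ∑ u ∈ bF a x (R' + 1), bb a v u * (w u - w v) :=
        Finset.sum_congr rfl fun u _ => by ring
      rw [h4, hlap]
      have := mul_nonneg (mul_nonneg hh.le (hκ v).le) (hw0 v)
      linarith)
    (by
      intro v _ _ hvu
      exact (hinB v (by linarith)).1)
    (by
      intro u hu v hv hb
      have h1 := Dn_lip hs (mem_bF.1 hu).1 (bb_pos.1 hb)
      simp only [hψ]
      refine (abs_max_sub_max_le_abs _ _ _).trans ?_
      rw [show (m : ℝ) - Dn a x u - (m - Dn a x v) = -((Dn a x u : ℝ) - Dn a x v) by ring, abs_neg]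
      exact h1)
    (by
      intro τ hτ A' hA' hA'u
      have hsubB : A' ⊆ bF a x (2 * m) := by
        intro v hv
        exact (hinB v (by linarith [(hA'u v hv).2])).1
      have hk := net.hK (fun v => tr W τ (w v)) (fun v => tr_nonneg hτ.le _)
        (bF a x (2 * m)) (Finset.Subset.refl _) (by
          intro v _ hv
          have : ¬ W < w v := fun hc => hv (hinB v hc).1
          unfold tr
          rw [max_eq_right (by linarith), min_eq_left hτ.le]) τ hτ A' hsubB (by
          intro v hv
          have := (hA'u v hv).2
          exact le_min (this.trans (le_max_left _ _)) le_rfl)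
      rw [← hnBd, div_self hnB.ne', Real.one_rpow, mul_one] at hk
      have hE := EE_tr hs h0 hκ hh x R R' hR z hz W τ hW hτ
      rw [← hw] at hE
      set X : ℝ := (A'.card : ℝ) / nB with hX
      have hX0 : 0 ≤ X := by positivity
      have hX1 : X ≤ 1 := by
        rw [hX, div_le_one hnB]
        rw [hnBd]
        exact_mod_cast Finset.card_le_card hsubB
      have hXθ : X ≤ X ^ (1 - 1 / d') := by
        rcases hX0.eq_or_lt with h | h
        · rw [← h]; exact Real.rpow_nonneg le_rfl _
        · calc X = X ^ (1:ℝ) := (Real.rpow_one X).symm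
            _ ≤ _ := Real.rpow_le_rpow_of_exponent_ge h hX1 hθ1
      have h5 : τ * X ≤ K * (2 * m : ℕ) * √(τ / nB) := by
        calc τ * X ≤ τ * X ^ (1 - 1 / d') := by gcongr
          _ ≤ _ := hk
          _ ≤ _ := by gcongr
      apply Real.le_sqrt_of_sq_le
      have h6 : (τ * X) ^ 2 ≤ (K * (2 * m : ℕ)) ^ 2 * (τ / nB) := by
        calc (τ * X) ^ 2 ≤ (K * (2 * m : ℕ) * √(τ / nB)) ^ 2 := by
              gcongr
          _ = _ := by rw [mul_pow, Real.sq_sqrt (by positivity)]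
      rw [hA, le_div_iff₀ hτ, le_div_iff₀ hnB]
      have h7 : (τ * X) ^ 2 * nB ≤ (K * (2 * m : ℕ)) ^ 2 * τ := by
        calc (τ * X) ^ 2 * nB ≤ (K * (2 * m : ℕ)) ^ 2 * (τ / nB) * nB := by gcongr
          _ = _ := by field_simp
      push_cast at h7
      have h8 : τ * (X ^ 2 * τ * nB) ≤ τ * (4 * K ^ 2 * (m : ℝ) ^ 2) := by
        calc _ = (τ * X) ^ 2 * nB := by ring
          _ ≤ _ := h7
          _ = _ := by ring
      exact le_of_mul_le_mul_left h8 hτ)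
    y (bF_mono x (by omega) hy)
    (by
      simp only [hψ]
      have : (m : ℝ) ≤ Dn a x y := by exact_mod_cast hym
      rw [max_eq_right (by linarith)]
      positivity)
  have hAle : A ≤ 4 * K ^ 2 * Creg * ((m : ℝ) ^ 2 / (m : ℝ) ^ d) := by
    have hv := S.vol1 (2 * m) (by omega)
    rw [← hnBd] at hv
    have hv2 : Creg⁻¹ * (m : ℝ) ^ d ≤ nB := by
      refine le_trans ?_ hv
      have : (m : ℝ) ≤ (2 * m : ℕ) := by push_cast; linarith
      gcongr
    rw [hA]
    calc 4 * K ^ 2 * (m : ℝ) ^ 2 / nB ≤ 4 * K ^ 2 * (m : ℝ) ^ 2 / (Creg⁻¹ * (m : ℝ) ^ d) := by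
          gcongr
      _ = _ := by field_simp
  have := mul_le_mul_of_nonneg_left hAle hCpos.le
  linarith

set_option maxHeartbeats 1000000 in
lemma step1 {d : ℕ} (hd : 3 ≤ d) (d' : ℝ) (p q : ℝ≥0∞)
    (Cint Creg CS1 : ℝ) (hd' : 3 ≤ d') (hpq : (1 / p).toReal + (1 / q).toReal < 2 / d')
    (hC : 1 ≤ Creg) (hC1 : 1 ≤ CS1) (hCi : 0 < Cint) :
    ∃ C : ℝ, 0 < C ∧ ∀ (a : Vert d → Vert d → ℝ) (κ : Vert d → ℝ) (x : Vert d) (N : ℕ),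
      Setup a κ x d' p q Cint Creg CS1 N → ∀ h : ℝ, 0 < h → ∀ ρ R : ℕ, N ≤ ρ →
      ∀ z ∈ bF a x R, 2 * Dn a x z ≤ ρ → ∀ y ∈ bF a x R, ρ ≤ Dn a x y →
        UG a κ h (bF a x R) z y ≤ C * ((ρ : ℝ) ^ 2 / (ρ : ℝ) ^ d) := by
  obtain ⟨C, hCpos, hstep⟩ := scale_step (d := d) d' p q Cint Creg CS1 hd' hpq hC hC1 hCi
  refine ⟨2 * C, by positivity, ?_⟩
  intro a κ x N S h hh ρ R hρ z hz hzρ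
  have hρ1 : 1 ≤ ρ := S.hN.trans hρ
  obtain ⟨K, hK⟩ : ∃ K : ℕ, R < 2 ^ K := ⟨R, Nat.lt_two_pow_self⟩
  have hind : ∀ j : ℕ, j ≤ K → ∀ y ∈ bF a x R, 2 ^ (K - j) * ρ ≤ Dn a x y →
      UG a κ h (bF a x R) z y ≤
        2 * C * (((2 ^ (K - j) * ρ : ℕ) : ℝ) ^ 2 / ((2 ^ (K - j) * ρ : ℕ) : ℝ) ^ d) := by
    intro j
    induction j with
    | zero =>
      intro _ y hy hyD
      have h1 := (mem_bF.1 hy).2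
      have h2 : 2 ^ K ≤ 2 ^ K * ρ := Nat.le_mul_of_pos_right _ (by omega)
      simp only [Nat.sub_zero] at hyD
      omega
    | succ j ih =>
      intro hj y hy hyD
      have ih' := ih (by omega)
      set m := 2 ^ (K - (j + 1)) * ρ with hm
      have h2m : 2 ^ (K - j) * ρ = 2 * m := by
        rw [hm, show K - j = (K - (j + 1)) + 1 by omega, pow_succ]; ring
      rw [h2m] at ih'
      have hmρ : ρ ≤ m := by
        rw [hm]; exact Nat.le_mul_of_pos_left _ (by positivity)
      have hmpos : (0:ℝ) < m := by
        have : 0 < m := by omega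
        exact_mod_cast this
      have hst := hstep a κ x N S h hh m R (max R (2 * m)) (hρ.trans hmρ) (le_max_right _ _)
        (le_max_left _ _) z hz (hzρ.trans hmρ) _ (by positivity) ih' y hy hyD
      refine hst.trans ?_
      have h3 : ((2 * m : ℕ) : ℝ) ^ 2 / ((2 * m : ℕ) : ℝ) ^ d
          ≤ (1 / 2) * ((m : ℝ) ^ 2 / (m : ℝ) ^ d) := by
        push_cast
        rw [mul_pow, mul_pow, mul_div_mul_comm]
        refine mul_le_mul_of_nonneg_right ?_ (by positivity)
        obtain ⟨k, rfl⟩ := Nat.exists_eq_add_of_le hd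
        rw [pow_add]
        have : (1:ℝ) ≤ 2 ^ k := one_le_pow₀ (by norm_num)
        rw [div_le_div_iff₀ (by positivity) (by norm_num)]
        nlinarith
      have h4 := mul_le_mul_of_nonneg_left h3 (show 0 ≤ 2 * C by positivity)
      linarith
  have := hind K le_rfl
  simpa using this

lemma phi_le (s t k δ δ' : ℝ) (hs : 0 < s) (ht0 : 0 ≤ t) (ht : t ≤ 1) (hk : k ≤ 1)
    (h : |δ - δ'| ≤ k) :
    max 1 (s⁻¹ * Real.exp (-(t * δ))) ≤ (1 + 2 * t * k) * max 1 (s⁻¹ * Real.exp (-(t * δ'))) := by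
  have hk0 : 0 ≤ k := (abs_nonneg _).trans h
  have htk : 0 ≤ t * k := mul_nonneg ht0 hk0
  have htk1 : t * k ≤ 1 := by nlinarith
  have h1 : Real.exp (t * k) ≤ 1 + 2 * t * k := by
    have := Real.abs_exp_sub_one_sub_id_le (x := t * k) (by rw [abs_of_nonneg htk]; exact htk1)
    have := le_of_abs_le this
    nlinarith
  have hm : (1:ℝ) ≤ max 1 (s⁻¹ * Real.exp (-(t * δ'))) := le_max_left _ _
  apply max_le
  · nlinarith
  · have h2 : Real.exp (-(t * δ)) ≤ Real.exp (t * k) * Real.exp (-(t * δ')) := by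
      rw [← Real.exp_add]
      apply Real.exp_le_exp.2
      have := (abs_le.1 h).1
      nlinarith
    calc s⁻¹ * Real.exp (-(t * δ)) ≤ s⁻¹ * (Real.exp (t * k) * Real.exp (-(t * δ'))) := by gcongr
      _ = Real.exp (t * k) * (s⁻¹ * Real.exp (-(t * δ'))) := by ring
      _ ≤ (1 + 2 * t * k) * max 1 (s⁻¹ * Real.exp (-(t * δ'))) := by
          apply mul_le_mul h1 (le_max_right _ _) (by positivity) (by positivity)

lemma agmon_T1 (b u u' η η' φ φ' t k c c' : ℝ) (hb : 0 ≤ b) (hu : 0 ≤ u) (hu' : 0 ≤ u')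
    (hη : 0 ≤ η) (hη' : 0 ≤ η') (hφ : 1 ≤ φ) (hφ' : 1 ≤ φ')
    (h1 : φ ≤ (1 + 2 * t * k) * φ') (h2 : φ' ≤ (1 + 2 * t * k) * φ)
    (ht : 0 ≤ t) (hk : 0 ≤ k) (hc : b * k ^ 2 ≤ c) (hc' : b * k ^ 2 ≤ c') :
    b * (u * u') * (η * η' * (φ - φ') ^ 2) ≤
      2 * t ^ 2 * (c * (η * φ * u) ^ 2 + c' * (η' * φ' * u') ^ 2) := by
  have hsq : (φ - φ') ^ 2 ≤ 4 * t ^ 2 * k ^ 2 * (φ * φ') := by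
    have htk := mul_nonneg ht hk
    rcases le_total φ' φ with hle | hle
    · have e1 : φ - φ' ≤ 2 * t * k * φ' := by linarith
      have : (φ - φ') ^ 2 ≤ (2 * t * k * φ') ^ 2 := pow_le_pow_left₀ (by linarith) e1 2
      have e3 : (2 * t * k * φ') ^ 2 ≤ 4 * t ^ 2 * k ^ 2 * (φ * φ') := by
        calc (2 * t * k * φ') ^ 2 = 4 * t ^ 2 * k ^ 2 * (φ' * φ') := by ring
          _ ≤ _ := by gcongr
      linarith
    · have e1 : φ' - φ ≤ 2 * t * k * φ := by linarith
      have : (φ' - φ) ^ 2 ≤ (2 * t * k * φ) ^ 2 := pow_le_pow_left₀ (by linarith) e1 2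
      have e3 : (2 * t * k * φ) ^ 2 ≤ 4 * t ^ 2 * k ^ 2 * (φ * φ') := by
        calc (2 * t * k * φ) ^ 2 = 4 * t ^ 2 * k ^ 2 * (φ * φ) := by ring
          _ ≤ _ := by gcongr
      have : (φ - φ') ^ 2 = (φ' - φ) ^ 2 := by ring
      linarith
  set X := η * φ * u with hX
  set X' := η' * φ' * u' with hX'
  have hX0 : 0 ≤ X := by positivity
  have hX'0 : 0 ≤ X' := by positivity
  calc b * (u * u') * (η * η' * (φ - φ') ^ 2)
      ≤ b * (u * u') * (η * η' * (4 * t ^ 2 * k ^ 2 * (φ * φ'))) := by gcongr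
    _ = 4 * t ^ 2 * ((b * k ^ 2) * (X * X')) := by rw [hX, hX']; ring
    _ ≤ 4 * t ^ 2 * ((b * k ^ 2) * ((X ^ 2 + X' ^ 2) / 2)) := by
        gcongr
        nlinarith [sq_nonneg (X - X')]
    _ = 2 * t ^ 2 * ((b * k ^ 2) * X ^ 2 + (b * k ^ 2) * X' ^ 2) := by ring
    _ ≤ _ := by gcongr

lemma agmon_T2 (η η' φ φ' t k e : ℝ) 
    (hη' : 0 ≤ η') (hη'1 : η' ≤ 1) (hφ : 1 ≤ φ) (hφ' : 1 ≤ φ')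
    (h1 : φ ≤ (1 + 2 * t * k) * φ') (h2 : φ' ≤ (1 + 2 * t * k) * φ)
    (ht : 0 ≤ t) (ht1 : t ≤ 1) (hk : 0 ≤ k) (hk1 : k ≤ 1) (he : |η - η'| ≤ e)
    (hone : φ = 1 ∨ φ' = 1) :
    (η - η') * (η * φ ^ 2 - η' * φ' ^ 2) ≤ e * (9 * e + 8 * t) := by
  have htk : t * k ≤ t := by nlinarith
  have htk0 := mul_nonneg ht hk
  have hd : |φ - φ'| ≤ 2 * t ∧ φ ≤ 3 ∧ φ' ≤ 3 ∧ φ + φ' ≤ 4 := by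
    rcases hone with h | h
    · subst h
      refine ⟨abs_le.2 ⟨?_, ?_⟩, ?_, ?_, ?_⟩ <;> nlinarith
    · subst h
      refine ⟨abs_le.2 ⟨?_, ?_⟩, ?_, ?_, ?_⟩ <;> nlinarith
  obtain ⟨hd1, hd2, hd3, hd4⟩ := hd
  have he0 : 0 ≤ e := (abs_nonneg _).trans he
  have hA : |η * φ ^ 2 - η' * φ' ^ 2| ≤ 9 * e + 8 * t := by
    have : η * φ ^ 2 - η' * φ' ^ 2 = (η - η') * φ ^ 2 + η' * ((φ - φ') * (φ + φ')) := by ring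
    rw [this]
    refine (abs_add_le _ _).trans (add_le_add ?_ ?_)
    · rw [abs_mul, abs_of_nonneg (sq_nonneg φ)]
      have : φ ^ 2 ≤ 9 := by nlinarith
      calc |η - η'| * φ ^ 2 ≤ e * 9 := by gcongr
        _ = _ := by ring
    · rw [abs_mul, abs_mul, abs_of_nonneg hη', abs_of_nonneg (show 0 ≤ φ + φ' by linarith)]
      calc η' * (|φ - φ'| * (φ + φ')) ≤ 1 * ((2 * t) * 4) := by gcongr
        _ = _ := by ring
  calc _ ≤ |(η - η') * (η * φ ^ 2 - η' * φ' ^ 2)| := le_abs_self _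
    _ = |η - η'| * |η * φ ^ 2 - η' * φ' ^ 2| := abs_mul _ _
    _ ≤ _ := by gcongr

set_option maxHeartbeats 1000000 in
/-- the pointwise bound in the Agmon estimate -/
lemma agmon_pt {d : ℕ} {a : Vert d → Vert d → ℝ} {κ : Vert d → ℝ} {x : Vert d}
    (hs : ∀ x y, a x y = a y x) (h0 : ∀ x y, 0 ≤ a x y) (hκ : ∀ x, 0 < κ x)
    (h lam s M : ℝ) (hh : 0 < h) (hh1 : h ≤ 1) (hl : 0 < lam) (hl1 : lam ≤ 1) (hsp : 0 < s)
    (ρ : ℕ) (hρ : 8 ≤ ρ)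
    (hsb : ∀ z, openConn a x z → ρ < 4 * Dn a x z → Real.exp (-(lam * √h * δr a κ x z)) ≤ s)
    (u : Vert d → ℝ) (hu : ∀ z, 0 ≤ u z) 
    (huM : ∀ z, openConn a x z → 2 * Dn a x z ≤ ρ → u z ≤ M)
    (η φ : Vert d → ℝ) (hη : η = fun z => clip01 (3 - 8 * Dn a x z / ρ))
    (hφ : φ = fun z => max 1 (s⁻¹ * Real.exp (-(lam * √h * δr a κ x z))))
    (v w : Vert d) (hv : openConn a x v) :
    bb a v w * (u v * u w * (η w * φ w - η v * φ v) ^ 2) ≤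
      (if w ∈ nbrs v then 2 * (lam * √h) ^ 2 *
        (κ v * (η v * φ v * u v) ^ 2 + κ w * (η w * φ w * u w) ^ 2) else 0) +
      (if Dn a x v ≤ ρ then bb a v w * (M ^ 2 * (576 * (1 + √h * ρ) / (ρ : ℝ) ^ 2)) else 0) := by
  have hρpos : (0:ℝ) < ρ := by
    have : 0 < ρ := by omega
    exact_mod_cast this
  have hM2 : 0 ≤ M ^ 2 * (576 * (1 + √h * ρ) / (ρ : ℝ) ^ 2) := by positivity
  have hbn := bb_nonneg h0 v w
  by_cases hb : 0 < bb a v w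
  swap
  · have : bb a v w = 0 := le_antisymm (not_lt.1 hb) hbn
    rw [this, zero_mul, zero_mul, ite_self, add_zero]
    split_ifs
    · have := (hκ v).le
      have := (hκ w).le
      positivity
    · exact le_rfl
  have hop := bb_pos.1 hb
  have hw : openConn a x w := openConn_snoc hv hop
  rw [if_pos (mem_nbrs.2 hop.1)]
  have hbe : bb a v w = a v w := by rw [bb, if_pos hop.1]
  set t := lam * √h with ht
  have hsq1 : √h ≤ 1 := Real.sqrt_le_one.2 hh1
  have hsq0 : 0 ≤ √h := Real.sqrt_nonneg _
  have ht0 : 0 ≤ t := by positivity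
  have ht1 : t ≤ 1 := by rw [ht]; nlinarith
  have htle : t ≤ √h := by rw [ht]; nlinarith
  set k := kw a κ v w with hk
  have hk0 : 0 ≤ k := kw_nonneg κ v w
  have hk1 : k ≤ 1 := kw_le_one κ v w
  have hδ := δr_lip hs κ hv hop
  have hφv : 1 ≤ φ v := by rw [hφ]; exact le_max_left _ _
  have hφw : 1 ≤ φ w := by rw [hφ]; exact le_max_left _ _
  have p1 : φ v ≤ (1 + 2 * t * k) * φ w := by
    rw [hφ]; exact phi_le s t k _ _ hsp ht0 ht1 hk1 hδ
  have p2 : φ w ≤ (1 + 2 * t * k) * φ v := by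
    rw [hφ]; exact phi_le s t k _ _ hsp ht0 ht1 hk1 (by rw [abs_sub_comm]; exact hδ)
  have hηv0 : 0 ≤ η v := by rw [hη]; exact clip01_nonneg _
  have hηw0 : 0 ≤ η w := by rw [hη]; exact clip01_nonneg _
  have hηv1 : η v ≤ 1 := by rw [hη]; exact clip01_le _
  have hηw1 : η w ≤ 1 := by rw [hη]; exact clip01_le _
  have hkq := kw_sq κ hκ v w hop.2
  have T1 := agmon_T1 (bb a v w) (u v) (u w) (η v) (η w) (φ v) (φ w) t k (κ v) (κ w) hbn (hu v)
    (hu w) hηv0 hηw0 hφv hφw p1 p2 ht0 hk0 (by rw [hbe]; exact hkq.trans (min_le_left _ _))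
    (by rw [hbe]; exact hkq.trans (min_le_right _ _))
  have hid : (η w * φ w - η v * φ v) ^ 2 = η v * η w * (φ v - φ w) ^ 2
      + (η v - η w) * (η v * φ v ^ 2 - η w * φ w ^ 2) := by ring
  have hsplit : bb a v w * (u v * u w * (η w * φ w - η v * φ v) ^ 2)
      = bb a v w * (u v * u w) * (η v * η w * (φ v - φ w) ^ 2)
      + bb a v w * (u v * u w * ((η v - η w) * (η v * φ v ^ 2 - η w * φ w ^ 2))) := by
    rw [hid]; ring
  rw [hsplit]
  refine add_le_add T1 ?_
  by_cases hne : η v = η w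
  · rw [hne, sub_self, zero_mul, mul_zero, mul_zero]
    split_ifs
    · positivity
    · exact le_rfl
  have hlip := Dn_lip hs hv hop
  have hlip' := abs_le.1 hlip
  have he : |η v - η w| ≤ 8 / ρ := by
    rw [hη]
    refine (clip01_lip _ _).trans ?_
    have : (3 - 8 * (Dn a x v : ℝ) / ρ) - (3 - 8 * Dn a x w / ρ)
      = -(8 / ρ) * ((Dn a x v : ℝ) - Dn a x w) := by ring
    rw [this, abs_mul, abs_neg, abs_of_nonneg (by positivity)]
    calc 8 / (ρ:ℝ) * _ ≤ 8 / ρ * 1 := by gcongr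
      _ = _ := by ring
  have hone' : ∀ z, openConn a x z → ρ < 4 * Dn a x z → φ z = 1 := by
    intro z hz hzD
    rw [hφ]
    apply max_eq_left
    rw [inv_mul_le_iff₀ hsp, mul_one]
    exact hsb z hz hzD
  have hη1 : ∀ z, 4 * Dn a x z ≤ ρ → η z = 1 := by
    intro z hz
    rw [hη]
    apply clip01_one
    have : (4:ℝ) * Dn a x z ≤ ρ := by exact_mod_cast hz
    have : 8 * (Dn a x z:ℝ) / ρ ≤ 2 := by rw [div_le_iff₀ hρpos]; linarith
    linarith
  have hη0 : ∀ z, 3 * ρ ≤ 8 * Dn a x z → η z = 0 := by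
    intro z hz
    rw [hη]
    apply clip01_zero
    have : (3:ℝ) * ρ ≤ 8 * Dn a x z := by exact_mod_cast hz
    have : 3 ≤ 8 * (Dn a x z:ℝ) / ρ := by rw [le_div_iff₀ hρpos]; linarith
    linarith
  have hone : φ v = 1 ∨ φ w = 1 := by
    by_cases h1 : 4 * Dn a x v ≤ ρ
    · by_cases h2 : 4 * Dn a x w ≤ ρ
      · exact absurd ((hη1 v h1).trans (hη1 w h2).symm) hne
      · exact Or.inr (hone' w hw (by omega))
    · exact Or.inl (hone' v hv (by omega))
  have hl1 : Dn a x v ≤ Dn a x w + 1 := by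
    have : (Dn a x v : ℝ) ≤ Dn a x w + 1 := by linarith
    exact_mod_cast this
  have hl2 : Dn a x w ≤ Dn a x v + 1 := by
    have : (Dn a x w : ℝ) ≤ Dn a x v + 1 := by linarith
    exact_mod_cast this
  have hD : 2 * Dn a x v ≤ ρ ∧ 2 * Dn a x w ≤ ρ := by
    by_cases h1 : 3 * ρ ≤ 8 * Dn a x v
    · by_cases h2 : 3 * ρ ≤ 8 * Dn a x w
      · exact absurd ((hη0 v h1).trans (hη0 w h2).symm) hne
      · omega
    · omega
  rw [if_pos (by omega)]
  have T2 := agmon_T2 (η v) (η w) (φ v) (φ w) t k (8 / ρ) hηw0 hηw1 hφv hφw p1 p2 ht0 ht1 hk0 hk1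
    he hone
  have hT2 : (η v - η w) * (η v * φ v ^ 2 - η w * φ w ^ 2) ≤ 576 * (1 + √h * ρ) / (ρ : ℝ) ^ 2 := by
    refine T2.trans ?_
    rw [le_div_iff₀ (by positivity)]
    have : 8 / (ρ:ℝ) * (9 * (8 / ρ) + 8 * t) * (ρ:ℝ) ^ 2 = 576 + 64 * t * ρ := by
      field_simp; ring
    rw [this]
    have : t * ρ ≤ √h * ρ := by gcongr
    have : 0 ≤ √h * ρ := by positivity
    nlinarith
  have hM1 := huM v hv hD.1
  have hM3 := huM w hw hD.2
  have hM0 : 0 ≤ M := (hu v).trans hM1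
  refine mul_le_mul_of_nonneg_left ?_ hbn
  calc u v * u w * ((η v - η w) * (η v * φ v ^ 2 - η w * φ w ^ 2))
      ≤ u v * u w * (576 * (1 + √h * ρ) / (ρ : ℝ) ^ 2) := by
        refine mul_le_mul_of_nonneg_left hT2 (mul_nonneg (hu v) (hu w))
    _ ≤ (M * M) * (576 * (1 + √h * ρ) / (ρ : ℝ) ^ 2) := by
        refine mul_le_mul_of_nonneg_right ?_ (by positivity)
        exact mul_le_mul hM1 hM3 (hu w) hM0
    _ = _ := by ring

lemma nbr_sum {d : ℕ} (Λ : Finset (Vert d)) (F : Vert d → ℝ) (hF : ∀ v, 0 ≤ F v) (c : ℝ)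
    (hc : 0 ≤ c) :
    ∑ v ∈ Λ, ∑ w ∈ Λ, (if w ∈ nbrs v then c * (F v + F w) else 0) ≤ 4 * d * c * ∑ v ∈ Λ, F v := by
  have hsw : ∑ v ∈ Λ, ∑ w ∈ Λ, (if w ∈ nbrs v then c * F w else 0)
      = ∑ v ∈ Λ, ∑ w ∈ Λ, (if w ∈ nbrs v then c * F v else 0) := by
    rw [Finset.sum_comm]
    refine Finset.sum_congr rfl fun v _ => Finset.sum_congr rfl fun w _ => ?_
    have : v ∈ nbrs w ↔ w ∈ nbrs v := by
      rw [mem_nbrs, mem_nbrs]; exact ⟨adj_symm, adj_symm⟩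
    by_cases h : w ∈ nbrs v
    · rw [if_pos h, if_pos (this.2 h)]
    · rw [if_neg h, if_neg (fun h' => h (this.1 h'))]
  have hone : ∑ v ∈ Λ, ∑ w ∈ Λ, (if w ∈ nbrs v then c * F v else 0) ≤ ∑ v ∈ Λ, 2 * d * (c * F v) := by
    refine Finset.sum_le_sum fun v _ => ?_
    rw [← Finset.sum_filter, Finset.sum_const, nsmul_eq_mul]
    refine mul_le_mul_of_nonneg_right ?_ (mul_nonneg hc (hF v))
    have h1 : (Λ.filter (fun w => w ∈ nbrs v)).card ≤ 2 * d := by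
      refine le_trans (Finset.card_le_card ?_) (nbrs_card v)
      intro w hw
      exact (Finset.mem_filter.1 hw).2
    exact_mod_cast h1
  have hsplit : ∑ v ∈ Λ, ∑ w ∈ Λ, (if w ∈ nbrs v then c * (F v + F w) else 0)
      = ∑ v ∈ Λ, ∑ w ∈ Λ, (if w ∈ nbrs v then c * F v else 0)
        + ∑ v ∈ Λ, ∑ w ∈ Λ, (if w ∈ nbrs v then c * F w else 0) := by
    rw [← Finset.sum_add_distrib]
    refine Finset.sum_congr rfl fun v _ => ?_
    rw [← Finset.sum_add_distrib]
    refine Finset.sum_congr rfl fun w _ => ?_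
    split_ifs <;> ring
  rw [hsplit, hsw]
  have : ∑ v ∈ Λ, 2 * d * (c * F v) = 2 * d * c * ∑ v ∈ Λ, F v := by
    rw [Finset.mul_sum]
    exact Finset.sum_congr rfl fun v _ => by ring
  linarith

set_option maxHeartbeats 1000000 in
lemma step2 {d : ℕ} (hd : 3 ≤ d) (d' : ℝ) (p q : ℝ≥0∞)
    (Cint Creg CS1 : ℝ) (hd' : 3 ≤ d') (hpq : (1 / p).toReal + (1 / q).toReal < 2 / d')
    (hC : 1 ≤ Creg) (hC1 : 1 ≤ CS1) (hCi : 0 < Cint) :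
    ∃ C : ℝ, 0 < C ∧ ∀ (a : Vert d → Vert d → ℝ) (κ : Vert d → ℝ) (x : Vert d) (N : ℕ),
      Setup a κ x d' p q Cint Creg CS1 N → ∀ h : ℝ, 0 < h → h ≤ 1 → ∀ ρ R : ℕ, N ≤ ρ → 8 ≤ ρ →
      ρ ≤ R → ∀ y ∈ bF a x R, Dn a x y = ρ → ∀ s : ℝ, 0 < s →
      (∀ z, openConn a x z → ρ < 4 * Dn a x z →
        Real.exp (-(1 / (4 * d) * √h * δr a κ x z)) ≤ s) →
      ∀ A : Finset (Vert d), (∀ v ∈ A, v ∈ bF a x R ∧ 4 * Dn a x v ≤ ρ) →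
      h * ∑ v ∈ A, κ v * (s⁻¹ * Real.exp (-(1 / (4 * d) * √h * δr a κ x v))
          * UG a κ h (bF a x R) y v) ^ 2 ≤ C * ((1 + √h * ρ) * ((ρ : ℝ) ^ 2 / (ρ : ℝ) ^ d)) := by
  obtain ⟨C1, hC1pos, hst1⟩ := step1 (d := d) hd d' p q Cint Creg CS1 hd' hpq hC hC1 hCi
  refine ⟨576 * Cint * Creg * C1 ^ 2, by positivity, ?_⟩
  intro a κ x N S h hh hh1 ρ R hNρ hρ8 hρR y hy hyD s hsp hsb A hA
  have hs := S.hs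
  have h0 := S.h0
  have hκ := S.hκ
  have hd3 : (3:ℝ) ≤ d := by exact_mod_cast hd
  set lam : ℝ := 1 / (4 * d) with hlam
  have hl : 0 < lam := by positivity
  have hl1 : lam ≤ 1 := by
    rw [hlam, div_le_one (by positivity)]; linarith
  set u := UG a κ h (bF a x R) y with hu
  have hu0 : ∀ z, 0 ≤ u z := UG_nonneg h0 hκ hh _ y
  have hρpos : (0:ℝ) < ρ := by
    have : 0 < ρ := by omega
    exact_mod_cast this
  set M := C1 * ((ρ : ℝ) ^ 2 / (ρ : ℝ) ^ d) with hM
  have hMpos : 0 < M := by positivity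
  have huM : ∀ z, openConn a x z → 2 * Dn a x z ≤ ρ → u z ≤ M := by
    intro z hz hzD
    by_cases hzR : z ∈ bF a x R
    · rw [hu, UG_symm hs h0 hκ hh x R y z hy hzR]
      exact hst1 a κ x N S h hh ρ R hNρ z hzR hzD y hy hyD.ge
    · rw [hu, UG_off h0 hκ hh _ _ _ hzR]; exact hMpos.le
  set η : Vert d → ℝ := fun z => clip01 (3 - 8 * Dn a x z / ρ) with hη
  set φ : Vert d → ℝ := fun z => max 1 (s⁻¹ * Real.exp (-(lam * √h * δr a κ x z))) with hφ
  set Λ := bF a x (R + 1) with hΛ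
  set Sm := ∑ z ∈ Λ, κ z * (η z * φ z * u z) ^ 2 with hSm
  have hsub : bF a x R ⊆ Λ := bF_mono x (by omega)
  have hSmR : ∑ z ∈ bF a x R, κ z * (η z * φ z * u z) ^ 2 = Sm := by
    rw [hSm]
    refine Finset.sum_subset hsub fun z _ hz => ?_
    rw [hu, UG_off h0 hκ hh _ _ _ hz]; ring
  have hηy : η y = 0 := by
    simp only [hη]
    apply clip01_zero
    rw [hyD, mul_div_assoc, div_self hρpos.ne']; norm_num
  have hcac := cacc_id Λ (bb a) (bb_symm hs) (fun z => η z * φ z) u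
  have htest := UG_test h0 hκ hh x R R le_rfl y hy (fun z => (η z * φ z) ^ 2 * u z) (by
    intro z _ hz
    simp only [hu]
    rw [UG_off h0 hκ hh _ _ _ hz, mul_zero])
  rw [← hu, ← hΛ] at htest
  have hE0 := EE_nonneg Λ (bb a) (bb_nonneg h0) (fun z => η z * φ z * u z)
  have hsm2 : ∑ z ∈ bF a x R, κ z * ((η z * φ z) ^ 2 * u z * u z) = Sm := by
    rw [← hSmR]
    exact Finset.sum_congr rfl fun z _ => by ring
  rw [hcac, htest, hsm2, hηy] at hE0
  have hmain : h * Sm ≤ (1 / 2) * ∑ v ∈ Λ, ∑ w ∈ Λ,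
      bb a v w * (u v * u w * (η w * φ w - η v * φ v) ^ 2) := by
    have : -((0 * φ y) ^ 2 * u y) = 0 := by ring
    linarith
  set G := M ^ 2 * (576 * (1 + √h * ρ) / (ρ : ℝ) ^ 2) with hG
  have hG0 : 0 ≤ G := by positivity
  have hbound : ∑ v ∈ Λ, ∑ w ∈ Λ, bb a v w * (u v * u w * (η w * φ w - η v * φ v) ^ 2) ≤
      ∑ v ∈ Λ, ∑ w ∈ Λ, (if w ∈ nbrs v then 2 * (lam * √h) ^ 2 *
        (κ v * (η v * φ v * u v) ^ 2 + κ w * (η w * φ w * u w) ^ 2) else 0) +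
      ∑ v ∈ Λ, ∑ w ∈ Λ, (if Dn a x v ≤ ρ then bb a v w * G else 0) := by
    rw [← Finset.sum_add_distrib]
    refine Finset.sum_le_sum fun v hv => ?_
    rw [← Finset.sum_add_distrib]
    refine Finset.sum_le_sum fun w _ => ?_
    exact agmon_pt hs h0 hκ h lam s M hh hh1 hl hl1 hsp ρ hρ8 hsb u hu0 huM η φ hη hφ v w
      (mem_bF.1 hv).1
  have hb1 := nbr_sum Λ (fun v => κ v * (η v * φ v * u v) ^ 2)
    (fun v => mul_nonneg (hκ v).le (sq_nonneg _)) (2 * (lam * √h) ^ 2) (by positivity)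
  rw [← hSm] at hb1
  have hcoef : 4 * (d:ℝ) * (2 * (lam * √h) ^ 2) = h * (1 / (2 * d)) := by
    rw [mul_pow, Real.sq_sqrt hh.le, hlam]
    field_simp; ring
  rw [hcoef] at hb1
  have hSm0 : 0 ≤ Sm := Finset.sum_nonneg fun v _ => mul_nonneg (hκ v).le (sq_nonneg _)
  have hb1' : h * (1 / (2 * (d:ℝ))) * Sm ≤ h * Sm := by
    have : 1 / (2 * (d:ℝ)) ≤ 1 := by rw [div_le_one (by positivity)]; linarith
    have : h * (1 / (2 * (d:ℝ))) ≤ h * 1 := by gcongr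
    nlinarith
  have hb2 : ∑ v ∈ Λ, ∑ w ∈ Λ, (if Dn a x v ≤ ρ then bb a v w * G else 0)
      ≤ G * (Cint * (Creg * (ρ:ℝ) ^ d)) := by
    have e1 : ∑ v ∈ Λ, ∑ w ∈ Λ, (if Dn a x v ≤ ρ then bb a v w * G else 0)
        = ∑ v ∈ Λ with Dn a x v ≤ ρ, ∑ w ∈ Λ, bb a v w * G := by
      rw [Finset.sum_filter]
      refine Finset.sum_congr rfl fun v _ => ?_
      split_ifs <;> simp
    have e2 : (Λ.filter fun v => Dn a x v ≤ ρ) ⊆ bF a x ρ := by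
      intro v hv
      rw [Finset.mem_filter] at hv
      exact mem_bF.2 ⟨(mem_bF.1 hv.1).1, hv.2⟩
    have e3 : ∑ v ∈ bF a x ρ, muA a v ≤ Cint * (bF a x ρ).card := by
      have hcard : (0:ℝ) < (bF a x ρ).card := by
        have : 0 < (bF a x ρ).card := Finset.card_pos.2 ⟨x, self_mem_bF x ρ⟩
        exact_mod_cast this
      have := avg_holder p S.hp (bF a x ρ) (bF a x ρ) (Finset.Subset.refl _) (muA a)
        (muA_nonneg h0) Cint (S.mu ρ hNρ)
      rwa [div_self hcard.ne', Real.one_rpow, mul_one] at this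
    rw [e1]
    calc _ ≤ ∑ v ∈ bF a x ρ, ∑ w ∈ Λ, bb a v w * G :=
          Finset.sum_le_sum_of_subset_of_nonneg e2 fun v _ _ =>
            Finset.sum_nonneg fun w _ => mul_nonneg (bb_nonneg h0 _ _) hG0
      _ ≤ ∑ v ∈ bF a x ρ, muA a v * G := by
          refine Finset.sum_le_sum fun v _ => ?_
          rw [← Finset.sum_mul]
          exact mul_le_mul_of_nonneg_right (sum_bb_le_mu h0 Λ v) hG0
      _ = G * ∑ v ∈ bF a x ρ, muA a v := by rw [← Finset.sum_mul, mul_comm]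
      _ ≤ G * (Cint * (bF a x ρ).card) := by gcongr
      _ ≤ _ := by
          have := S.vol2 ρ hNρ
          gcongr
  have hfin : h * Sm ≤ G * (Cint * (Creg * (ρ:ℝ) ^ d)) := by linarith
  have hAle : ∑ v ∈ A, κ v * (s⁻¹ * Real.exp (-(lam * √h * δr a κ x v)) * u v) ^ 2 ≤ Sm := by
    calc _ ≤ ∑ v ∈ A, κ v * (η v * φ v * u v) ^ 2 := by
          refine Finset.sum_le_sum fun v hv => ?_
          have hη1 : η v = 1 := by
            simp only [hη]
            apply clip01_one
            have : (4:ℝ) * Dn a x v ≤ ρ := by exact_mod_cast (hA v hv).2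
            have : 8 * (Dn a x v:ℝ) / ρ ≤ 2 := by rw [div_le_iff₀ hρpos]; linarith
            linarith
          rw [hη1, one_mul]
          have hu0v := hu0 v
          have : s⁻¹ * Real.exp (-(lam * √h * δr a κ x v)) ≤ φ v := le_max_right _ _
          have hκv := (hκ v).le
          gcongr
      _ ≤ Sm := Finset.sum_le_sum_of_subset_of_nonneg (fun v hv => hsub (hA v hv).1)
          fun v _ _ => mul_nonneg (hκ v).le (sq_nonneg _)
  calc _ ≤ h * Sm := by gcongr
    _ ≤ _ := hfin
    _ = _ := by
      rw [hG, hM]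
      field_simp

lemma sqrt_one_add_le (r : ℝ) (hr : 0 ≤ r) : 1 + √r ≤ 2 * (1 + r) := by
  have h1 := Real.sq_sqrt hr
  nlinarith [sq_nonneg (√r - 1), Real.sqrt_nonneg r]

lemma ell_bound (h : ℝ) (hh : 0 < h) (N ρ : ℕ) (hN : 1 ≤ N) (hρ : 8 ≤ ρ) (hNρ : 4 * N ≤ ρ)
    (hhN : √h * N ≤ 1) :
    ∃ ℓ : ℕ, N ≤ ℓ ∧ 4 * ℓ ≤ ρ ∧ √h * ℓ ≤ 1 ∧ (ρ : ℝ) ≤ 8 * (1 + √h * ρ) * ℓ := by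
  have hq : 0 < √h := Real.sqrt_pos.2 hh
  have hρ0 : (0:ℝ) ≤ ρ := by positivity
  set m := ⌊(√h)⁻¹⌋₊ with hm
  have hmN : N ≤ m := by
    apply Nat.le_floor
    rw [← one_div, le_div_iff₀ hq]; linarith
  have hm1 : √h * m ≤ 1 := by
    have : (m:ℝ) ≤ (√h)⁻¹ := Nat.floor_le (by positivity)
    rw [← one_div, le_div_iff₀ hq] at this; linarith
  rcases le_total (ρ / 4) m with hle | hle
  · refine ⟨ρ / 4, by omega, by omega, ?_, ?_⟩
    · have : ((ρ / 4 : ℕ) : ℝ) ≤ m := by exact_mod_cast hle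
      calc _ ≤ √h * m := by gcongr
        _ ≤ 1 := hm1
    · have h8 : (ρ:ℝ) ≤ 8 * ((ρ / 4 : ℕ) : ℝ) := by
        have : ρ ≤ 8 * (ρ / 4) := by omega
        exact_mod_cast this
      have h9 : 0 ≤ √h * ρ := by positivity
      have h10 : (0:ℝ) ≤ ((ρ / 4 : ℕ) : ℝ) := by positivity
      nlinarith
  · refine ⟨m, hmN, by omega, hm1, ?_⟩
    have hm1' : (1:ℝ) ≤ m := by exact_mod_cast hN.trans hmN
    have : (√h)⁻¹ < m + 1 := Nat.lt_floor_add_one _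
    rw [← one_div, div_lt_iff₀ hq] at this
    have h2 : 1 ≤ 2 * (√h * m) := by nlinarith
    have h3 : (ρ:ℝ) * 1 ≤ ρ * (2 * (√h * m)) := by gcongr
    nlinarith

lemma big_case (d : ℕ) (C2 h k r ρ N : ℝ) (hC2 : 0 < C2) (hk : 0 < k) (hN : 1 ≤ N)
    (hρ : 1 ≤ ρ) (hr : r = h * ρ ^ 2) (hh : 1 < h * N ^ 2)
    (hbig : 2 * C2 * N ^ (2 * d + 2) / k ≤ ρ) (X : ℝ) 
    (hX : h * (k * X ^ 2) ≤ C2 * ((1 + √r) * (ρ ^ 2 / ρ ^ d))) (hd : 1 ≤ d) :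
    X ≤ (1 + r) ^ d * (ρ ^ 2 / ρ ^ d) := by
  have hN0 : 0 < N := by linarith
  have hρ0 : 0 < ρ := by linarith
  have hh0 : 0 < h := by
    by_contra hc
    nlinarith [sq_nonneg N]
  have hr0 : 0 < r := by rw [hr]; positivity
  apply le_of_sq_le_sq _ (by positivity)
  have h1 := sqrt_one_add_le r hr0.le
  have hrN : ρ ^ 2 ≤ r * N ^ 2 := by
    rw [hr]; nlinarith [sq_nonneg ρ, pow_pos hρ0 2]
  have hrd : ρ ^ (2 * d) ≤ (1 + r) ^ d * N ^ (2 * d) := by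
    calc ρ ^ (2 * d) = (ρ ^ 2) ^ d := by rw [pow_mul]
      _ ≤ (r * N ^ 2) ^ d := by gcongr
      _ = r ^ d * N ^ (2 * d) := by rw [mul_pow, pow_mul]
      _ ≤ _ := by gcongr; linarith
  rw [div_le_iff₀ hk] at hbig
  -- h k X^2 ≤ 2 C2 (1+r) ρ^2/ρ^d
  have h2 : h * (k * X ^ 2) ≤ C2 * ((2 * (1 + r)) * (ρ ^ 2 / ρ ^ d)) := hX.trans (by gcongr)
  have h3 : C2 * ((2 * (1 + r)) * (ρ ^ 2 / ρ ^ d)) ≤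
      h * (k * ((1 + r) ^ d * (ρ ^ 2 / ρ ^ d)) ^ 2) := by
    have e1 : (2 * C2 * N ^ (2 * d + 2)) * (ρ ^ d * 1) ≤ ρ * k * (ρ ^ d * ρ) := by gcongr
    have e2 : 2 * C2 * N ^ (2 * d + 2) * ρ ^ d ≤ k * ρ ^ 2 * (h * N ^ 2 * (N ^ (2 * d) *
        (1 + r) ^ d * (ρ ^ d / ρ ^ (2 * d)))) := by
      have e3 : ρ ^ d ≤ N ^ (2 * d) * (1 + r) ^ d * (ρ ^ d / ρ ^ (2 * d)) := by
        rw [mul_div_assoc', le_div_iff₀ (by positivity)]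
        calc ρ ^ d * ρ ^ (2 * d) ≤ ρ ^ d * ((1 + r) ^ d * N ^ (2 * d)) := by gcongr
          _ = _ := by ring
      calc 2 * C2 * N ^ (2 * d + 2) * ρ ^ d ≤ k * ρ ^ 2 * (1 * ρ ^ d) := by linarith
        _ ≤ _ := by gcongr
    have e4 : N ^ (2 * d + 2) * (2 * C2 * ρ ^ d) ≤
        N ^ (2 * d + 2) * (k * ρ ^ 2 * (h * ((1 + r) ^ d * (ρ ^ d / ρ ^ (2 * d))))) := by
      calc _ = 2 * C2 * N ^ (2 * d + 2) * ρ ^ d := by ring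
        _ ≤ _ := e2
        _ = _ := by ring
    have e5 := le_of_mul_le_mul_left e4 (by positivity)
    have e6 : (1 + r) ≤ (1 + r) ^ d := le_self_pow₀ (by linarith) (by omega)
    calc C2 * ((2 * (1 + r)) * (ρ ^ 2 / ρ ^ d))
        = (2 * C2 * ρ ^ d) * ((1 + r) * (ρ ^ 2 / ρ ^ (2 * d))) := by
          rw [show 2 * d = d + d by ring, pow_add]; field_simp
      _ ≤ (k * ρ ^ 2 * (h * ((1 + r) ^ d * (ρ ^ d / ρ ^ (2 * d))))) *
          ((1 + r) ^ d * (ρ ^ 2 / ρ ^ (2 * d))) := by gcongr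
      _ = h * (k * ((1 + r) ^ d * (ρ ^ 2 / ρ ^ d)) ^ 2) * (ρ ^ d / ρ ^ (2 * d)) := by
          rw [show 2 * d = d + d by ring, pow_add]; field_simp
      _ ≤ h * (k * ((1 + r) ^ d * (ρ ^ 2 / ρ ^ d)) ^ 2) * 1 := by
          gcongr
          rw [div_le_one (by positivity)]
          exact pow_le_pow_right₀ hρ (by omega)
      _ = _ := by ring
  have h4 := h2.trans h3
  have h5 := le_of_mul_le_mul_left h4 hh0
  exact le_of_mul_le_mul_left h5 hk

lemma A_bound (d : ℕ) (K h r ρ ℓ s : ℝ) (hK : 0 < K) (hh : 0 < h) (hρ : 1 ≤ ρ) (hℓ : 0 < ℓ)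
    (hs : 0 < s) (hr : r = h * ρ ^ 2) (hρℓ : ρ ≤ 8 * (1 + √r) * ℓ) (hd : 1 ≤ d) :
    √(K * s ^ 2 * ((1 + √r) * (ρ ^ 2 / ρ ^ d)) / (h * ℓ ^ d)) ≤
      √(K * 8 ^ d * 2 ^ (d + 1)) * ((1 + r) ^ d * √(1 + 1 / r) * (ρ ^ 2 / ρ ^ d) * s) := by
  have hρ0 : 0 < ρ := by linarith
  have hr0 : 0 < r := by rw [hr]; positivity
  rw [Real.sqrt_le_left (by positivity)]
  have e0 : (√(K * 8 ^ d * 2 ^ (d + 1)) * ((1 + r) ^ d * √(1 + 1 / r) * (ρ ^ 2 / ρ ^ d) * s)) ^ 2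
      = (K * 8 ^ d * 2 ^ (d + 1)) * ((1 + r) ^ (2 * d) * (1 + 1 / r) * (ρ ^ 2 / ρ ^ d) ^ 2 * s ^ 2) := by
    simp only [mul_pow]
    rw [Real.sq_sqrt (by positivity), Real.sq_sqrt (by positivity), ← pow_mul (1 + r), mul_comm d 2]
  rw [e0]
  have h1 := sqrt_one_add_le r hr0.le
  have hq := Real.sqrt_nonneg r
  have e1 : ρ ^ d / ℓ ^ d ≤ 8 ^ d * (1 + √r) ^ d := by
    rw [div_le_iff₀ (by positivity)]
    calc ρ ^ d ≤ (8 * (1 + √r) * ℓ) ^ d := by gcongr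
      _ = _ := by rw [mul_pow, mul_pow]
  have e2 : (1 + √r) ^ (d + 1) ≤ 2 ^ (d + 1) * (1 + r) ^ (2 * d) := by
    calc (1 + √r) ^ (d + 1) ≤ (2 * (1 + r)) ^ (d + 1) := by gcongr
      _ = 2 ^ (d + 1) * (1 + r) ^ (d + 1) := by rw [mul_pow]
      _ ≤ _ := by
        gcongr
        · linarith
        · omega
  calc K * s ^ 2 * ((1 + √r) * (ρ ^ 2 / ρ ^ d)) / (h * ℓ ^ d)
      = K * s ^ 2 * (ρ ^ 2 / ρ ^ d) ^ 2 * (1 + √r) * (ρ ^ d / ℓ ^ d) * (1 / r) := by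
        rw [hr]; field_simp
    _ ≤ K * s ^ 2 * (ρ ^ 2 / ρ ^ d) ^ 2 * (1 + √r) * (8 ^ d * (1 + √r) ^ d) * (1 + 1 / r) := by
        gcongr
        linarith
    _ = K * s ^ 2 * (ρ ^ 2 / ρ ^ d) ^ 2 * 8 ^ d * (1 + √r) ^ (d + 1) * (1 + 1 / r) := by ring
    _ ≤ K * s ^ 2 * (ρ ^ 2 / ρ ^ d) ^ 2 * 8 ^ d * (2 ^ (d + 1) * (1 + r) ^ (2 * d)) * (1 + 1 / r) := by
        gcongr
    _ = _ := by ring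

set_option maxHeartbeats 1000000 in
lemma step3 {d : ℕ} (hd : 3 ≤ d) (d' : ℝ) (p q : ℝ≥0∞)
    (Cint Creg CS1 : ℝ) (hd' : 3 ≤ d') (hpq : (1 / p).toReal + (1 / q).toReal < 2 / d')
    (hC : 1 ≤ Creg) (hC1 : 1 ≤ CS1) (hCi : 0 < Cint) :
    ∃ C : ℝ, 0 < C ∧ ∀ (a : Vert d → Vert d → ℝ) (κ : Vert d → ℝ) (x : Vert d) (N : ℕ),
      Setup a κ x d' p q Cint Creg CS1 N → ∃ N11 : ℕ, 1 ≤ N11 ∧ ∀ h : ℝ, 0 < h → h ≤ 1 →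
      ∀ ρ R : ℕ, N11 ≤ ρ → ρ ≤ R → ∀ y ∈ bF a x R, Dn a x y = ρ → ∀ s : ℝ, 0 < s →
      (∀ z, openConn a x z → ρ < 4 * Dn a x z →
        Real.exp (-(1 / (4 * d) * √h * δr a κ x z)) ≤ s) →
      UG a κ h (bF a x R) y x ≤ C * ((1 + h * (ρ:ℝ) ^ 2) ^ d * √(1 + 1 / (h * (ρ:ℝ) ^ 2))
        * ((ρ : ℝ) ^ 2 / (ρ : ℝ) ^ d) * s) := by
  have hθ : 0 < 1 - 1 / d' := by
    have : 1 / d' < 1 := by rw [div_lt_one (by linarith)]; linarith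
    linarith
  have hϑ : 1 - 1 / d' < 1 - ((1 / p).toReal + (1 / q).toReal) / 2 := by
    have : 2 / d' = 2 * (1 / d') := by ring
    linarith
  have hK : 0 < CS1 * √Cint := by positivity
  obtain ⟨C3, hC3, hmax⟩ := maxLemma _ _ _ (CS1 * √Cint) Cint Creg 1 d hθ hϑ hK hCi (by linarith)
    (by norm_num)
  obtain ⟨C2, hC2, hst2⟩ := step2 (d := d) hd d' p q Cint Creg CS1 hd' hpq hC hC1 hCi
  have hCr : 0 < Creg := by linarith
  set K := 9 * Cint * C2 * Creg with hKd
  have hKpos : 0 < K := by positivity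
  refine ⟨1 + C3 * √(K * 8 ^ d * 2 ^ (d + 1)), by positivity, ?_⟩
  intro a κ x N S
  have hs := S.hs
  have h0 := S.h0
  have hκ := S.hκ
  have hN1 := S.hN
  refine ⟨max (max (4 * N) 8) ⌈2 * C2 * (N:ℝ) ^ (2 * d + 2) / κ x⌉₊,
    le_trans (by norm_num) ((le_max_right (4 * N) 8).trans (le_max_left _ _)), ?_⟩
  intro h hh hh1 ρ R hρN hρR y hy hyD s hsp hsb
  have hρ4 : 4 * N ≤ ρ := (le_max_left _ _).trans ((le_max_left _ _).trans hρN)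
  have hρ8 : 8 ≤ ρ := (le_max_right _ _).trans ((le_max_left _ _).trans hρN)
  have hρbig : 2 * C2 * (N:ℝ) ^ (2 * d + 2) / κ x ≤ ρ :=
    (Nat.le_ceil _).trans (by exact_mod_cast (le_max_right _ _).trans hρN)
  have hρ1 : (1:ℝ) ≤ ρ := by
    have : 1 ≤ ρ := by omega
    exact_mod_cast this
  have hρ0 : (0:ℝ) < ρ := by linarith
  obtain ⟨r, hr⟩ : ∃ r : ℝ, r = h * (ρ:ℝ) ^ 2 := ⟨_, rfl⟩
  have hr0 : 0 < r := by rw [hr]; positivity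
  have hsr : √r = √h * ρ := by
    rw [hr, Real.sqrt_mul hh.le, Real.sqrt_sq hρ0.le]
  rw [← hr]
  have hA2 := hst2 a κ x N S h hh hh1 ρ R (by omega) hρ8 hρR y hy hyD s hsp hsb
  rw [← hsr] at hA2
  set u := UG a κ h (bF a x R) y with hu
  have hu0 : ∀ z, 0 ≤ u z := UG_nonneg h0 hκ hh _ y
  have hsq1 : 1 ≤ √(1 + 1 / r) := by
    apply Real.one_le_sqrt.2
    have : 0 < 1 / r := by positivity
    linarith
  set Y := (1 + r) ^ d * √(1 + 1 / r) * ((ρ : ℝ) ^ 2 / (ρ : ℝ) ^ d) * s with hY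
  have hY0 : 0 < Y := by positivity
  by_cases hcase : √h * N ≤ 1
  swap
  · -- large killing
    have hb := hA2 {x} (by
      intro v hv
      rw [Finset.mem_singleton] at hv
      subst hv
      exact ⟨self_mem_bF _ _, by rw [Dn_self]; omega⟩)
    rw [Finset.sum_singleton, δr_self, mul_zero, neg_zero, Real.exp_zero, mul_one] at hb
    have hhN : 1 < h * (N:ℝ) ^ 2 := by
      have h1 := not_le.1 hcase
      have h2 : h * (N:ℝ) ^ 2 = (√h * N) ^ 2 := by rw [mul_pow, Real.sq_sqrt hh.le]
      rw [h2]
      nlinarith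
    have hX := big_case d C2 h (κ x) r ρ N hC2 (hκ x) (by exact_mod_cast hN1) hρ1 hr hhN hρbig
      (s⁻¹ * u x) hb (by omega)
    rw [inv_mul_le_iff₀ hsp] at hX
    calc u x ≤ s * ((1 + r) ^ d * ((ρ:ℝ) ^ 2 / (ρ:ℝ) ^ d)) := hX
      _ = (1 + r) ^ d * 1 * ((ρ:ℝ) ^ 2 / (ρ:ℝ) ^ d) * s := by ring
      _ ≤ Y := by rw [hY]; gcongr
      _ = 1 * Y := (one_mul _).symm
      _ ≤ _ := by
        gcongr
        have : 0 ≤ C3 * √(K * 8 ^ d * 2 ^ (d + 1)) := by positivity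
        linarith
  -- small killing
  obtain ⟨ℓ, hNℓ, hℓρ, hℓ1, hρℓ⟩ := ell_bound h hh N ρ hN1 hρ8 hρ4 hcase
  rw [← hsr] at hρℓ
  have hℓpos : (0:ℝ) < ℓ := by
    have : 0 < ℓ := by omega
    exact_mod_cast this
  have net := netHyp S ℓ R hNℓ (by omega)
  set nB : ℝ := ((bF a x ℓ).card : ℝ) with hnBd
  have hnB : 0 < nB := net.hnB
  set A := √(K * s ^ 2 * ((1 + √r) * ((ρ:ℝ) ^ 2 / (ρ:ℝ) ^ d)) / (h * (ℓ:ℝ) ^ d)) with hA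
  have hApos : 0 < A := Real.sqrt_pos.2 (by positivity)
  have hAb := A_bound d K h r ρ ℓ s hKpos hh hρ1 hℓpos hsp hr hρℓ (by omega)
  rw [← hA, ← hY] at hAb
  have hres := hmax (Vert d) (bF a x (R + 1)) (bF a x ℓ) (bb a) (ℓ : ℝ) nB net
    (S.vol2 ℓ hNℓ) u (fun v => (Dn a x v : ℝ)) ℓ A hℓpos le_rfl (by linarith) hApos
    (fun v _ => Nat.cast_nonneg _)
    (by
      intro v hv hvD _
      have hvD' : Dn a x v ≤ ℓ := by exact_mod_cast hvD
      have hvR : v ∈ bF a x R := mem_bF.2 ⟨(mem_bF.1 hv).1, by omega⟩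
      have hlap := UG_lap h0 hκ hh x R R le_rfl y v hvR
      have hne : v ≠ y := by
        rintro rfl
        omega
      rw [if_neg hne, ← hu] at hlap
      rw [hlap]
      have := mul_nonneg (mul_nonneg hh.le (hκ v).le) (hu0 v)
      linarith)
    (by
      intro v hv hvD _
      exact mem_bF.2 ⟨(mem_bF.1 hv).1, by exact_mod_cast hvD⟩)
    (by
      intro v hv w _ hb
      exact Dn_lip hs (mem_bF.1 hv).1 (bb_pos.1 hb))
    (by
      intro τ hτ A' hA' hA'u
      have hsubB : A' ⊆ bF a x ℓ := by
        intro v hv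
        exact mem_bF.2 ⟨(mem_bF.1 (hA' hv)).1, by exact_mod_cast (hA'u v hv).1⟩
      have hb := hA2 A' (by
        intro v hv
        have h1 := mem_bF.1 (hsubB hv)
        exact ⟨mem_bF.2 ⟨h1.1, by omega⟩, by omega⟩)
      set f : Vert d → ℝ := fun v => s⁻¹ * Real.exp (-(1 / (4 * d) * √h * δr a κ x v)) * u v with hf
      have hfu : ∀ v ∈ A', τ ≤ 3 * s * f v := by
        intro v hv
        refine (hA'u v hv).2.trans ?_
        have h1 := mem_bF.1 (hsubB hv)
        have hδ : δr a κ x v ≤ ℓ := (δr_le κ h1.1).trans (by exact_mod_cast h1.2)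
        have hδ0 := δr_nonneg (a := a) κ x v
        have hle : 1 / (4 * (d:ℝ)) * √h * δr a κ x v ≤ 1 := by
          have hd3 : (3:ℝ) ≤ d := by exact_mod_cast hd
          have : 1 / (4 * (d:ℝ)) ≤ 1 := by
            rw [div_le_one (by positivity)]; linarith
          calc 1 / (4 * (d:ℝ)) * √h * δr a κ x v ≤ 1 * √h * ℓ := by gcongr
            _ ≤ 1 := by linarith
        have hexp : 1 ≤ 3 * Real.exp (-(1 / (4 * d) * √h * δr a κ x v)) := by
          have h3 : Real.exp (-1) ≤ Real.exp (-(1 / (4 * d) * √h * δr a κ x v)) :=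
            Real.exp_le_exp.2 (by linarith)
          have h4 : 1 ≤ 3 * Real.exp (-1) := by
            rw [Real.exp_neg, ← div_eq_mul_inv, le_div_iff₀ (Real.exp_pos 1)]
            linarith [Real.exp_one_lt_d9]
          linarith
        have h5 : 3 * s * f v = (3 * Real.exp (-(1 / (4 * d) * √h * δr a κ x v))) * u v := by
          simp only [hf]; field_simp
        rw [h5]
        have := hu0 v
        nlinarith
      set X : ℝ := (A'.card : ℝ) / nB with hX
      have hX0 : 0 ≤ X := by positivity
      have hX1 : X ≤ 1 := by
        rw [hX, div_le_one hnB, hnBd]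
        exact_mod_cast Finset.card_le_card hsubB
      have hcs : (∑ v ∈ A', f v) ^ 2 ≤ (∑ v ∈ A', (κ v)⁻¹) * ∑ v ∈ A', κ v * f v ^ 2 := by
        refine Finset.sum_sq_le_sum_mul_sum_of_sq_eq_mul A' (fun v _ => inv_nonneg.2 (hκ v).le)
          (fun v _ => mul_nonneg (hκ v).le (sq_nonneg _)) (fun v _ => ?_)
        have := (hκ v).ne'
        field_simp
      have hki : ∑ v ∈ A', (κ v)⁻¹ ≤ Cint * nB := by
        refine le_trans (Finset.sum_le_sum_of_subset_of_nonneg hsubB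
          fun v _ _ => inv_nonneg.2 (hκ v).le) ?_
        exact avg_one _ _ (fun v => inv_nonneg.2 (hκ v).le) Cint (S.ki ℓ hNℓ)
      have hF0 : 0 ≤ ∑ v ∈ A', κ v * f v ^ 2 :=
        Finset.sum_nonneg fun v _ => mul_nonneg (hκ v).le (sq_nonneg _)
      have hcard : (A'.card : ℝ) * τ ≤ 3 * s * ∑ v ∈ A', f v := by
        rw [Finset.mul_sum, ← nsmul_eq_mul, ← Finset.sum_const]
        exact Finset.sum_le_sum hfu
      set T := (1 + √r) * ((ρ:ℝ) ^ 2 / (ρ:ℝ) ^ d) with hT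
      have hT0 : 0 < T := by positivity
      have hsq : ((A'.card : ℝ) * τ) ^ 2 * h ≤ 9 * s ^ 2 * (Cint * nB) * (C2 * T) := by
        calc ((A'.card : ℝ) * τ) ^ 2 * h ≤ (3 * s * ∑ v ∈ A', f v) ^ 2 * h := by gcongr
          _ = 9 * s ^ 2 * ((∑ v ∈ A', f v) ^ 2 * h) := by ring
          _ ≤ 9 * s ^ 2 * ((Cint * nB * ∑ v ∈ A', κ v * f v ^ 2) * h) := by
              have : (∑ v ∈ A', f v) ^ 2 ≤ Cint * nB * ∑ v ∈ A', κ v * f v ^ 2 :=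
                hcs.trans (by gcongr)
              gcongr
          _ = 9 * s ^ 2 * (Cint * nB) * (h * ∑ v ∈ A', κ v * f v ^ 2) := by ring
          _ ≤ _ := by gcongr
      have hXA : X * τ ≤ A := by
        rw [hA]
        apply Real.le_sqrt_of_sq_le
        rw [le_div_iff₀ (by positivity)]
        have hv := S.vol1 ℓ hNℓ
        rw [← hnBd] at hv
        have hv' : (ℓ:ℝ) ^ d ≤ Creg * nB := by
          rw [inv_mul_le_iff₀ hCr] at hv; exact hv
        have hXe : X * τ = (A'.card : ℝ) * τ / nB := by rw [hX]; ring
        rw [hXe, div_pow]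
        calc ((A'.card : ℝ) * τ) ^ 2 / nB ^ 2 * (h * (ℓ:ℝ) ^ d)
            = (((A'.card : ℝ) * τ) ^ 2 * h) * ((ℓ:ℝ) ^ d / nB ^ 2) := by ring
          _ ≤ (9 * s ^ 2 * (Cint * nB) * (C2 * T)) * (Creg * nB / nB ^ 2) := by gcongr
          _ = K * s ^ 2 * T := by rw [hKd]; field_simp
      apply Real.le_sqrt_of_sq_le
      rw [le_div_iff₀ hτ]
      calc X ^ 2 * τ = X * (X * τ) := by ring
        _ ≤ 1 * (X * τ) := by gcongr
        _ ≤ A := by linarith)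
    x (self_mem_bF _ _) (by simp only [Dn_self]; push_cast; positivity)
  calc u x ≤ C3 * A := hres
    _ ≤ C3 * (√(K * 8 ^ d * 2 ^ (d + 1)) * Y) := by gcongr
    _ = C3 * √(K * 8 ^ d * 2 ^ (d + 1)) * Y := by ring
    _ ≤ _ := by gcongr; linarith

lemma hpq_real (d' : ℝ) (p q : ℝ≥0∞) (hp : 1 < p) (hq : 1 < q) (hd' : 0 < d')
    (hpq : 1 / p + 1 / q < ENNReal.ofReal (2 / d')) :
    (1 / p).toReal + (1 / q).toReal < 2 / d' := by
  have h1 : 1 / p ≠ ∞ := by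
    rw [one_div]; exact ENNReal.inv_ne_top.2 (zero_lt_one.trans hp).ne'
  have h2 : 1 / q ≠ ∞ := by
    rw [one_div]; exact ENNReal.inv_ne_top.2 (zero_lt_one.trans hq).ne'
  rw [← ENNReal.toReal_add h1 h2]
  exact (ENNReal.lt_ofReal_iff_toReal_lt (ENNReal.add_ne_top.2 ⟨h1, h2⟩)).1 hpq

lemma setup_of {d : ℕ} {a : Vert d → Vert d → ℝ} {κ : Vert d → ℝ} {x : Vert d} {d' : ℝ}
    {p q : ℝ≥0∞} {Cint Creg CS1 : ℝ}
    (hs : ∀ x y, a x y = a y x) (h0 : ∀ x y, 0 ≤ a x y) (hκ : ∀ x, 0 < κ x) (hx : x ∈ Cinf a)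
    (hp : 1 < p) (hq : 1 < q) (hd' : 3 ≤ d') (hCi : 0 < Cint)
    {N4 N5 N10 : Vert d → ℕ} (hG : GraphAssumption d' a N4 N5 Creg CS1)
    (hint : ∀ x ∈ Cinf a, ∀ n : ℕ, N10 x ≤ n →
        avgNormR p (ballCh a x (n : ℝ)) (muA a) ≤ Cint ∧
        avgNormR q (ballCh a x (n : ℝ)) (nuA a) ≤ Cint ∧
        avgNormR p (ballCh a x (n : ℝ)) κ ≤ Cint ∧
        avgNormR 1 (ballCh a x (n : ℝ)) (fun z => (κ z)⁻¹) ≤ Cint) :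
    Setup a κ x d' p q Cint Creg CS1 (max (max (N4 x) (N5 x)) (max (N10 x) 1)) := by
  obtain ⟨hC, hC1, _, hvol, hsob⟩ := hG
  have hnc : ∀ n : ℕ, (ballCh a x (n:ℝ)).ncard = (bF a x n).card := by
    intro n
    rw [← coe_bF, Set.ncard_coe_finset]
  refine ⟨hs, h0, hκ, hx, ?_, hC, hC1, hCi, hp, hq, hd', ?_, ?_, ?_, ?_, ?_, ?_⟩
  · exact (le_max_right _ _).trans (le_max_right _ _)
  · intro n hn
    have := (hvol x hx n (by omega)).1
    rwa [hnc] at this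
  · intro n hn
    have := (hvol x hx n (by omega)).2
    rwa [hnc] at this
  · intro n hn f hf
    have := hsob x hx n (by omega) f (by
      intro y hy
      rw [← coe_bF]
      exact Finset.mem_coe.2 (hf y hy))
    rwa [hnc, ← coe_bF] at this
  · intro n hn
    rw [coe_bF]; exact (hint x hx n (by omega)).1
  · intro n hn
    rw [coe_bF]; exact (hint x hx n (by omega)).2.1
  · intro n hn
    rw [coe_bF]; exact (hint x hx n (by omega)).2.2.2

lemma Fgam_eq (d : ℕ) (r : ℝ) (hr : 0 < r) :
    FgamE (d : ℝ) r = ENNReal.ofReal ((1 + r) ^ d * √(1 + 1 / r)) := by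
  unfold FgamE
  have h1 : 1 + ENNReal.ofReal r = ENNReal.ofReal (1 + r) := by
    rw [ENNReal.ofReal_add zero_le_one hr.le, ENNReal.ofReal_one]
  have h2 : 1 + (ENNReal.ofReal r)⁻¹ = ENNReal.ofReal (1 + 1 / r) := by
    rw [ENNReal.ofReal_add zero_le_one (by positivity), ENNReal.ofReal_one, one_div,
      ENNReal.ofReal_inv_of_pos hr]
  rw [h1, h2, ENNReal.rpow_natCast, ← ENNReal.ofReal_pow (by positivity),
    ENNReal.ofReal_rpow_of_pos (by positivity), ← ENNReal.ofReal_mul (by positivity),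
    Real.sqrt_eq_rpow]

/-- Proposition `prop:Agmon`: for `d ≥ 3`, under the graph
assumption and averaged integrability of `μ^ω, ν^ω, κ^ω, 1/κ^ω`, there are
`λ = λ(d) ∈ (0,1)`, `γ = γ(d',p,q) ∈ (1,∞)` and `c₂₉ = c₂₉(d',p,q,C_int)` such
that the Green function of the walk with killing `h κ` satisfies the Agmon-type
bound `g(x,y) ≤ c₂₉ F_γ(h ρ(x,y)²) ρ(x,y)^{2-d} max_{z ∉ B(x,ρ(x,y)/4)}
e^{-λ √h d_κ(x,z)}`. -/
theorem statement10
    {d : ℕ} (hd : 3 ≤ d) (d' : ℝ)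
    (p q : ℝ≥0∞) (hp : 1 < p) (hq : 1 < q)
    (hpq : 1 / p + 1 / q < ENNReal.ofReal (2 / d'))
    (Cint Creg CS1 : ℝ) (hCint : 0 < Cint) :
    ∃ lam γ c29 : ℝ, lam ∈ Set.Ioo (0:ℝ) 1 ∧ 1 < γ ∧ 0 < c29 ∧
      ∀ (a : Vert d → Vert d → ℝ), (∀ x y, a x y = a y x) → (∀ x y, 0 ≤ a x y) →
      (∀ x ∈ Cinf a, ∀ y ∈ Cinf a, openConn a x y) →
      ∀ κ : Vert d → ℝ, (∀ x, 0 < κ x) →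
      ∀ N4 N5 : Vert d → ℕ, GraphAssumption d' a N4 N5 Creg CS1 →
      ∀ N10 : Vert d → ℕ,
      (∀ x ∈ Cinf a, ∀ n : ℕ, N10 x ≤ n →
        avgNormR p (ballCh a x (n : ℝ)) (muA a) ≤ Cint ∧
        avgNormR q (ballCh a x (n : ℝ)) (nuA a) ≤ Cint ∧
        avgNormR p (ballCh a x (n : ℝ)) κ ≤ Cint ∧
        avgNormR 1 (ballCh a x (n : ℝ)) (fun z => (κ z)⁻¹) ≤ Cint) →
      ∀ g : ℝ → Vert d → Vert d → ℝ,
        (∀ h ∈ Set.Icc (0:ℝ) 1, IsGreenFn a κ h (Cinf a) (g h)) →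
      ∀ x ∈ Cinf a, ∃ N11 : ℕ, ∀ y ∈ Cinf a,
        (N11 : ℝ≥0∞) ≤ chemDist a x y → ∀ h ∈ Set.Icc (0:ℝ) 1,
        ENNReal.ofReal (g h x y) ≤
          ENNReal.ofReal c29 * FgamE γ (h * (chemDist a x y).toReal ^ 2) *
            ENNReal.ofReal ((chemDist a x y).toReal ^ ((2:ℝ) - d)) *
            ⨆ z : {z : Vert d // z ∈ Cinf a ∧ z ∉ ballCh a x ((chemDist a x y).toReal / 4)},
              ENNReal.ofReal
                (Real.exp (-(lam * Real.sqrt h * (dkap a κ x z.1).toReal))) := by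
  by_cases hconst : 1 ≤ Creg ∧ 1 ≤ CS1 ∧ (d : ℝ) ≤ d'
  swap
  · refine ⟨1 / 2, 2, 1, ⟨by norm_num, by norm_num⟩, by norm_num, by norm_num, ?_⟩
    intro a _ _ _ κ _ N4 N5 hG
    exact absurd ⟨hG.1, hG.2.1, hG.2.2.1⟩ hconst
  obtain ⟨hC, hC1, hdd'⟩ := hconst
  have hd3 : (3:ℝ) ≤ d := by exact_mod_cast hd
  have hd' : 3 ≤ d' := hd3.trans hdd'
  have hpq' := hpq_real d' p q hp hq (by linarith) hpq
  obtain ⟨C, hCpos, hst3⟩ := step3 (d := d) hd d' p q Cint Creg CS1 hd' hpq' hC hC1 hCint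
  refine ⟨1 / (4 * d), d, C, ⟨by positivity, ?_⟩, by linarith, hCpos, ?_⟩
  · rw [div_lt_one (by positivity)]; linarith
  intro a hs h0 huniq κ hκ N4 N5 hG N10 hint g hg x hx
  have S : Setup a κ x d' p q Cint Creg CS1 (max (max (N4 x) (N5 x)) (max (N10 x) 1)) :=
    setup_of hs h0 hκ hx hp hq hd' hCint hG hint
  obtain ⟨N11, hN11, hmain⟩ := hst3 a κ x _ S
  refine ⟨N11, ?_⟩
  intro y hy hNy h hh
  have hxy : openConn a x y := huniq x hx y hy
  rw [chem_eq hxy] at hNy ⊢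
  rw [ENNReal.toReal_natCast]
  obtain ⟨ρ, hρ⟩ : ∃ ρ : ℕ, ρ = Dn a x y := ⟨_, rfl⟩
  rw [← hρ] at hNy ⊢
  have hNρ : N11 ≤ ρ := by exact_mod_cast hNy
  have hρ0 : (0:ℝ) < ρ := by
    have : 0 < ρ := by omega
    exact_mod_cast this
  set S0 : ℝ≥0∞ := ⨆ z : {z : Vert d // z ∈ Cinf a ∧ z ∉ ballCh a x ((ρ : ℝ) / 4)},
      ENNReal.ofReal (Real.exp (-(1 / (4 * (d:ℝ)) * Real.sqrt h * (dkap a κ x z.1).toReal))) with hS0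
  have hS1 : S0 ≤ 1 := by
    rw [hS0]
    refine iSup_le fun z => ?_
    rw [ENNReal.ofReal_le_one, Real.exp_le_one_iff]
    have : 0 ≤ 1 / (4 * (d:ℝ)) * Real.sqrt h * (dkap a κ x z.1).toReal := by positivity
    linarith
  have hS0le : ∀ z, z ∈ Cinf a → z ∉ ballCh a x ((ρ : ℝ) / 4) →
      ENNReal.ofReal (Real.exp (-(1 / (4 * (d:ℝ)) * Real.sqrt h * (dkap a κ x z).toReal))) ≤ S0 := by
    intro z hz hz'
    rw [hS0]
    exact le_iSup (fun z : {z : Vert d // z ∈ Cinf a ∧ z ∉ ballCh a x ((ρ : ℝ) / 4)} =>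
      ENNReal.ofReal (Real.exp (-(1 / (4 * (d:ℝ)) * Real.sqrt h * (dkap a κ x z.1).toReal))))
      ⟨z, hz, hz'⟩
  have hSpos : 0 < S0 := by
    have hex : ∃ z, z ∈ Cinf a ∧ z ∉ ballCh a x ((ρ : ℝ) / 4) := by
      by_contra hcon
      push Not at hcon
      have hfin : {z | openConn a x z} ⊆ (bF a x ρ : Set (Vert d)) := by
        intro z hz
        have hzb := hcon z (Cinf_of_conn hs hx hz)
        rw [mem_ballCh (by positivity)] at hzb
        refine Finset.mem_coe.2 (mem_bF.2 ⟨hzb.1, ?_⟩)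
        have : (Dn a x z : ℝ) ≤ ρ := by linarith [hzb.2]
        exact_mod_cast this
      exact hx ((Finset.finite_toSet _).subset hfin)
    obtain ⟨z, hz, hz'⟩ := hex
    refine lt_of_lt_of_le ?_ (hS0le z hz hz')
    exact ENNReal.ofReal_pos.2 (Real.exp_pos _)
  have hS0top : S0 ≠ ∞ := ne_top_of_le_ne_top ENNReal.one_ne_top hS1
  have hpow : ENNReal.ofReal ((ρ:ℝ) ^ ((2:ℝ) - d)) ≠ 0 := by
    rw [Ne, ENNReal.ofReal_eq_zero, not_le]
    exact Real.rpow_pos_of_pos hρ0 _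
  have hc29 : ENNReal.ofReal C ≠ 0 := by
    rw [Ne, ENNReal.ofReal_eq_zero, not_le]; exact hCpos
  rcases hh.1.eq_or_lt with hz | hpos
  · -- no killing: the right side is infinite
    have hF : FgamE (d:ℝ) (h * (ρ:ℝ) ^ 2) = ∞ := by
      rw [← hz, zero_mul]
      unfold FgamE
      simp
    rw [hF, ENNReal.mul_top hc29, ENNReal.top_mul hpow, ENNReal.top_mul hSpos.ne']
    exact le_top
  have hsr : 0 < S0.toReal := ENNReal.toReal_pos hSpos.ne' hS0top
  have hr0 : 0 < h * (ρ:ℝ) ^ 2 := by positivity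
  have hgle : g h x y ≤ C * ((1 + h * (ρ:ℝ) ^ 2) ^ d * √(1 + 1 / (h * (ρ:ℝ) ^ 2))
        * ((ρ : ℝ) ^ 2 / (ρ : ℝ) ^ d) * S0.toReal) := by
    refine green_le h0 hκ hpos hs hx hy huniq (g h) (hg h hh) _ ρ ?_
    intro R hR
    refine hmain h hpos hh.2 ρ R hNρ hR y (mem_bF.2 ⟨hxy, by omega⟩) hρ.symm S0.toReal hsr ?_
    intro z hz hzD
    refine (ENNReal.ofReal_le_iff_le_toReal hS0top).1 ?_
    refine hS0le z (Cinf_of_conn hs hx hz) ?_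
    rw [mem_ballCh (by positivity)]
    rintro ⟨_, hle⟩
    have : (ρ:ℝ) < 4 * Dn a x z := by exact_mod_cast hzD
    linarith
  refine (ENNReal.ofReal_le_ofReal hgle).trans (le_of_eq ?_)
  rw [Fgam_eq d _ hr0]
  have hrp : (ρ:ℝ) ^ ((2:ℝ) - d) = (ρ : ℝ) ^ 2 / (ρ : ℝ) ^ d := by
    rw [Real.rpow_sub hρ0, Real.rpow_natCast, Real.rpow_two]
  rw [hrp]
  conv_rhs => rw [← ENNReal.ofReal_toReal hS0top]
  rw [← ENNReal.ofReal_mul hCpos.le, ← ENNReal.ofReal_mul (by positivity),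
    ← ENNReal.ofReal_mul (by positivity)]
  congr 1
  ring

end FPPPaper
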